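/- arXiv:2412.05999 — 5 statements merged into one kernel-verified Lean document; each statement's English description precedes it below -/
import Mathlib

section
/- Let n ≥ 1, let A be an alternating matrix over F of size 2n×2n (respectively (2n+1)×(2n+1)), and suppose there exist U ∈ GL_m(𝔬) (m the size of A) and integers λ_1 ≥ … ≥ λ_n such that U·A·Uᵀ equals the block-diagonal matrix diag(J(λ_1), …, J(λ_n)) (respectively diag(J(λ_1), …, J(λ_n), 0) with a final 1×1 zero block). Then for every 1 ≤ k ≤ n, 2(λ_n + λ_{n−1} + ⋯ + λ_{n−k+1}) equals the minimum, over all subsets I of the row indices with |I| = 2k, of v(det A_{I,I}), where A_{I,I} is the principal submatrix of A with rows and columns indexed by I. -/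
open scoped Classical

/-- The block-diagonal matrix `diag(J(λ₁), …, J(λ_r), 0)` of size `m × m`, where
`J(d) = [[0, π^d], [−π^d, 0]]`. For `0 ≤ l < r`, block `l` occupies rows/columns `2l, 2l+1`. -/
noncomputable def altBlockDiag {F : Type} [Field F] (π : F) (m r : ℕ) (lam : ℕ → ℤ) :
    Matrix (Fin m) (Fin m) F :=
  Matrix.of fun i j =>
    if i.val + 1 = j.val ∧ j.val < 2 * r ∧ i.val % 2 = 0 then π ^ lam (i.val / 2)
    else if j.val + 1 = i.val ∧ i.val < 2 * r ∧ j.val % 2 = 0 then -π ^ lam (j.val / 2)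
    else 0


lemma val_cb_left {F : Type} [Field F] (W : AddValuation F (WithTop ℤ)) {ι : Type} [Fintype ι] {r : ℕ}
    (M : Matrix (Fin r) ι F) (hM : ∀ i j, 0 ≤ W (M i j)) (N : Matrix ι (Fin r) F) (c : WithTop ℤ)
    (h : ∀ g : Fin r → ι, c ≤ W (N.submatrix g id).det) : c ≤ W (M * N).det := by
  have e : (M * N).det = ∑ g : Fin r → ι, (∏ i, M i (g i)) * (N.submatrix g id).det := by
    have e1 : (M * N) = fun i => ∑ j, M i j • N j := by
      ext i k
      simp [Matrix.mul_apply]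
    rw [e1]
    refine (MultilinearMap.map_sum (Matrix.detRowAlternating (n := Fin r) (R := F)).toMultilinearMap _).trans ?_
    refine Finset.sum_congr rfl fun g _ => ?_
    rw [MultilinearMap.map_smul_univ]
    rfl
  rw [e]
  refine AddValuation.map_le_sum W fun g _ => ?_
  rw [AddValuation.map_mul]
  have : 0 ≤ W (∏ i, M i (g i)) := by
    refine Finset.prod_induction _ (fun x => 0 ≤ W x) ?_ ?_ ?_
    · intro a b ha hb
      rw [AddValuation.map_mul]; exact add_nonneg ha hb
    · simp
    · intro i _; exact hM _ _
  calc c = 0 + c := by simp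
    _ ≤ _ := add_le_add this (h g)

lemma val_cb {F : Type} [Field F] (W : AddValuation F (WithTop ℤ)) {ι : Type} [Fintype ι] {r : ℕ}
    (U : Matrix ι ι F) (hU : ∀ i j, 0 ≤ W (U i j)) (A : Matrix ι ι F) (c : WithTop ℤ)
    (h : ∀ g h : Fin r → ι, c ≤ W (A.submatrix g h).det) (p q : Fin r → ι) :
    c ≤ W ((U * A * U.transpose).submatrix p q).det := by
  have e : (U * A * U.transpose).submatrix p q =
      (U.submatrix p id) * ((A * U.transpose).submatrix id q) := by
    rw [Matrix.mul_assoc]; rfl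
  rw [e]
  refine val_cb_left W _ (fun i j => hU _ _) _ c fun g => ?_
  rw [← Matrix.det_transpose]
  have e2 : (((A * U.transpose).submatrix id q).submatrix g id).transpose =
      (U.submatrix q id) * (A.submatrix g id).transpose := by
    ext x y
    simp [Matrix.mul_apply, mul_comm]
  rw [e2]
  refine val_cb_left W _ (fun i j => hU _ _) _ c fun g' => ?_
  have := h g g'
  rw [← Matrix.det_transpose] at this
  exact this

lemma val_lap_row {F : Type} [Field F] (W : AddValuation F (WithTop ℤ)) {r : ℕ}
    (M : Matrix (Fin (r+1)) (Fin (r+1)) F) (i : Fin (r+1)) (a c : WithTop ℤ)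
    (ha : ∀ j, a ≤ W (M i j))
    (h : ∀ j : Fin (r+1), c ≤ W (M.submatrix i.succAbove j.succAbove).det) : a + c ≤ W M.det := by
  rw [Matrix.det_succ_row M i]
  refine AddValuation.map_le_sum W fun j _ => ?_
  rw [mul_assoc, AddValuation.map_mul, AddValuation.map_mul, AddValuation.map_pow,
    AddValuation.map_neg, AddValuation.map_one, smul_zero, zero_add]
  exact add_le_add (ha j) (h j)

lemma val_lap_col {F : Type} [Field F] (W : AddValuation F (WithTop ℤ)) {r : ℕ}
    (M : Matrix (Fin (r+1)) (Fin (r+1)) F) (j : Fin (r+1)) (a c : WithTop ℤ)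
    (ha : ∀ i, a ≤ W (M i j))
    (h : ∀ i : Fin (r+1), c ≤ W (M.submatrix i.succAbove j.succAbove).det) : a + c ≤ W M.det := by
  rw [← Matrix.det_transpose]
  refine val_lap_row W _ j a c ha fun i => ?_
  have := h i
  rw [← Matrix.det_transpose] at this
  exact this

/-- minors of `B + C R`, where `C` is integral -/
lemma val_rank2 {F : Type} [Field F] (W : AddValuation F (WithTop ℤ)) {r : ℕ}
    (B : Matrix (Fin (r+2)) (Fin (r+2)) F) (C : Matrix (Fin (r+2)) (Fin 2) F)
    (R : Matrix (Fin 2) (Fin (r+2)) F) (a c : WithTop ℤ)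
    (hB : ∀ i j, a ≤ W (B i j)) (hR : ∀ i j, a ≤ W (R i j)) (hC : ∀ i j, 0 ≤ W (C i j))
    (h : ∀ g h : Fin r → Fin (r+2), c ≤ W (B.submatrix g h).det) :
    a + (a + c) ≤ W (B + C * R).det := by
  have e : (B + C * R).det = (Matrix.fromBlocks B (-C) R 1).det := by
    rw [Matrix.det_fromBlocks_one₂₂]; simp
  rw [e, ← Matrix.det_submatrix_equiv_self (finSumFinEquiv (m := r+2) (n := 2)).symm]
  set N := (Matrix.fromBlocks B (-C) R 1).submatrix (finSumFinEquiv (m := r+2) (n := 2)).symm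
    (finSumFinEquiv (m := r+2) (n := 2)).symm with hN
  have hs : ∀ x : Fin (r+2+2), ∀ hx : x.val < r+2,
      (finSumFinEquiv (m := r+2) (n := 2)).symm x = Sum.inl ⟨x.val, hx⟩ := by
    intro x hx
    rw [Equiv.symm_apply_eq]; ext; simp
  have hs2 : ∀ x : Fin (r+2+2), ∀ hx : r+2 ≤ x.val,
      ∃ y, (finSumFinEquiv (m := r+2) (n := 2)).symm x = Sum.inr y := by
    intro x hx
    refine ⟨⟨x.val - (r+2), by omega⟩, ?_⟩
    rw [Equiv.symm_apply_eq]; ext; simp; omega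
  have c1 : ∀ x (y : Fin (r+2+2)), r+2 ≤ y.val → 0 ≤ W (N x y) := by
    intro x y hy
    obtain ⟨z, hz⟩ := hs2 y hy
    simp only [hN, Matrix.submatrix_apply, hz]
    rcases (finSumFinEquiv (m := r+2) (n := 2)).symm x with w | w
    · simpa using hC w z
    · simp only [Matrix.fromBlocks_apply₂₂, Matrix.one_apply]
      split_ifs <;> simp
  have c2 : ∀ x (y : Fin (r+2+2)), y.val < r+2 → a ≤ W (N x y) := by
    intro x y hy
    simp only [hN, Matrix.submatrix_apply, hs y hy]
    rcases (finSumFinEquiv (m := r+2) (n := 2)).symm x with w | w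
    · simpa using hB _ _
    · simpa using hR _ _
  rw [← zero_add (a + (a + c))]
  refine val_lap_col W N (Fin.last _) _ _ (fun i => c1 _ _ (by simp)) fun i => ?_
  rw [← zero_add (a + (a + c))]
  refine val_lap_col W _ (Fin.last _) _ _ (fun i => c1 _ _ (by simp)) fun i' => ?_
  refine val_lap_row W _ (Fin.last _) _ _ (fun j => c2 _ _ (by simp)) fun j => ?_
  refine val_lap_row W _ (Fin.last _) _ _ (fun j => c2 _ _ (by simp)) fun j' => ?_
  simp only [Matrix.submatrix_submatrix, Fin.succAbove_last]
  have hr : ∀ x : Fin r, (i.succAbove (i'.succAbove x.castSucc.castSucc)).val < r+2 := by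
    intro x
    simp only [Fin.succAbove]
    split_ifs <;> simp <;> omega
  convert h (fun x => ⟨_, hr x⟩) (fun y => j.succAbove (j'.succAbove y)) using 3
  ext x y
  simp only [hN, Matrix.submatrix_apply, Function.comp]
  rw [hs _ (hr x), hs _ (by simp)]
  simp

lemma val_principal {F : Type} [Field F] (W : AddValuation F (WithTop ℤ)) (hW : ∀ x, W x = ⊤ ↔ x = 0)
    {ι : Type} [Finite ι] [Nonempty ι] (k : ℕ) :
    ∀ (A : Matrix ι ι F) (hA : ∀ i j, A j i = - A i j) (hd : ∀ i, A i i = 0),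
    ∃ f : Fin (2*k) → ι, ∀ g h : Fin (2*k) → ι,
      W (A.submatrix f f).det ≤ W (A.submatrix g h).det := by
  induction k with
  | zero =>
    intro A hA hd
    refine ⟨fun _ => Classical.arbitrary ι, fun g h => ?_⟩
    have : IsEmpty (Fin (2*0)) := by simp; infer_instance
    rw [Matrix.det_isEmpty, Matrix.det_isEmpty]
  | succ k ih =>
    intro A hA hd
    obtain ⟨⟨i, j⟩, hij⟩ := Finite.exists_min (fun p : ι × ι => W (A p.1 p.2))
    have hmin : ∀ x y, W (A i j) ≤ W (A x y) := fun x y => hij (x, y)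
    by_cases h0 : A i j = 0
    · refine ⟨fun _ => Classical.arbitrary ι, fun g h => ?_⟩
      have hz : A = 0 := by
        ext x y
        have := hmin x y
        rw [h0, AddValuation.map_zero, top_le_iff, hW] at this
        simpa using this
      have : (A.submatrix g h).det = 0 := by
        haveI : Nonempty (Fin (2*(k+1))) := ⟨⟨0, by omega⟩⟩
        rw [hz]; exact Matrix.det_zero
      rw [this]; simp
    · set a := A i j with ha
      have hji : A j i = -a := hA i j
      let C : Matrix ι (Fin 2) F := Matrix.of fun x s => if s = 0 then A x j / a else - (A x i / a)
      let R : Matrix (Fin 2) ι F := Matrix.of fun s y => if s = 0 then A i y else A j y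
      let B : Matrix ι ι F := A - C * R
      have hB : ∀ x y, B x y = A x y - (A x j / a * A i y - A x i / a * A j y) := by
        intro x y
        simp [B, C, R, Matrix.mul_apply, Fin.sum_univ_two]; ring
      have htop : W a ≠ ⊤ := by rwa [Ne, hW]
      have hint : ∀ x y, 0 ≤ W (A x y / a) := by
        intro x y
        have h1 : W (A x y) = W a + W (A x y / a) := by
          rw [← AddValuation.map_mul]; congr 1; field_simp
        have h2 := hmin x y
        rw [h1] at h2
        have h3 : W a + 0 ≤ W a + W (A x y / a) := by simpa using h2
        exact (WithTop.add_le_add_iff_left htop).1 h3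
      have hCi : ∀ x s, 0 ≤ W (C x s) := by
        intro x s
        simp only [C, Matrix.of_apply]
        split_ifs
        · exact hint _ _
        · rw [AddValuation.map_neg]; exact hint _ _
      have hRi : ∀ s y, W a ≤ W (R s y) := by
        intro s y
        simp only [R, Matrix.of_apply]
        split_ifs <;> exact hmin _ _
      have hBi : ∀ x y, W a ≤ W (B x y) := by
        intro x y
        have key : ∀ p q r s, W a ≤ W (A p q / a * A r s) := by
          intro p q r s
          rw [AddValuation.map_mul, ← zero_add (W a)]
          exact add_le_add (hint _ _) (hmin _ _)
        rw [hB]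
        exact AddValuation.map_le_sub _ (hmin _ _) (AddValuation.map_le_sub _ (key _ _ _ _) (key _ _ _ _))
      obtain ⟨f, hf⟩ := ih B (by
          intro x y
          rw [hB, hB, hA x y, hA j x, hA j y, hA i x, hA i y]
          field_simp; ring) (by
          intro x
          rw [hB, hd, hA j x, hA i x]
          field_simp; ring)
      let P : Fin (2*k) ⊕ Fin 2 → ι := Sum.elim f (fun s => if s = 0 then i else j)
      refine ⟨P ∘ (finSumFinEquiv (m := 2*k) (n := 2)).symm, fun g h => ?_⟩
      have e1 : (A.submatrix (P ∘ (finSumFinEquiv (m := 2*k) (n := 2)).symm)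
          (P ∘ (finSumFinEquiv (m := 2*k) (n := 2)).symm)).det = a * (a * (B.submatrix f f).det) := by
        have : A.submatrix (P ∘ (finSumFinEquiv (m := 2*k) (n := 2)).symm)
          (P ∘ (finSumFinEquiv (m := 2*k) (n := 2)).symm) = (A.submatrix P P).submatrix
            (finSumFinEquiv (m := 2*k) (n := 2)).symm (finSumFinEquiv (m := 2*k) (n := 2)).symm := rfl
        rw [this, Matrix.det_submatrix_equiv_self]
        let J : Matrix (Fin 2) (Fin 2) F := !![0, a; -a, 0]
        have e2 : A.submatrix P P = Matrix.fromBlocks (B.submatrix f f) (C.submatrix f id) 0 1 *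
            Matrix.fromBlocks 1 0 (R.submatrix id f) J := by
          rw [Matrix.fromBlocks_multiply]
          ext (x | x) (y | y)
          · have hBA : A = B + C * R := by simp [B]
            simp only [Matrix.submatrix_apply, P, Sum.elim_inl, Matrix.fromBlocks_apply₁₁, Matrix.mul_one]
            conv_lhs => rw [hBA]
            rfl
          · simp only [Matrix.submatrix_apply, P, Sum.elim_inl, Sum.elim_inr, Matrix.fromBlocks_apply₁₂]
            fin_cases y <;> simp [C, J, Matrix.mul_apply, Fin.sum_univ_two] <;> field_simp
          · simp only [Matrix.submatrix_apply, P, Sum.elim_inl, Sum.elim_inr, Matrix.fromBlocks_apply₂₁]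
            fin_cases x <;> simp [R]
          · simp only [Matrix.submatrix_apply, P, Sum.elim_inl, Sum.elim_inr, Matrix.fromBlocks_apply₂₂]
            fin_cases x <;> fin_cases y <;> simp [J, hd, hji, ← ha]
        rw [e2, Matrix.det_mul, Matrix.det_fromBlocks_zero₂₁, Matrix.det_fromBlocks_zero₁₂]
        simp [J, Matrix.det_fin_two]; ring
      refine le_trans (le_of_eq (congrArg W e1)) ?_
      rw [AddValuation.map_mul, AddValuation.map_mul]
      have e3 : A.submatrix g h = B.submatrix g h + (C.submatrix g id) * (R.submatrix id h) := by
        have hBA : A = B + C * R := by simp [B]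
        conv_lhs => rw [hBA]
        rfl
      rw [e3]
      exact val_rank2 W (r := 2*k) (B.submatrix g h) (C.submatrix g id) (R.submatrix id h) _ _
        (fun _ _ => hBi _ _) (fun _ _ => hRi _ _) (fun _ _ => hCi _ _) (fun g' h' => hf _ _)

lemma val_zpow {F : Type} [Field F] (W : AddValuation F (WithTop ℤ)) (p : F) (hp : W p = 1)
    (z : ℤ) : W (p ^ z) = (z : WithTop ℤ) := by
  have hp0 : p ≠ 0 := by
    rintro rfl
    rw [AddValuation.map_zero] at hp
    exact WithTop.top_ne_one hp
  have hn : ∀ n : ℕ, W (p ^ n) = ((n : ℤ) : WithTop ℤ) := by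
    intro n
    induction n with
    | zero => simp
    | succ n ih => rw [pow_succ, AddValuation.map_mul, ih, hp]; push_cast; rfl
  obtain ⟨n, rfl | rfl⟩ := z.eq_nat_or_neg
  · rw [zpow_natCast, hn]
  · have h1 : W (p ^ (-(n:ℤ))) + W (p ^ n) = 0 := by
      rw [← AddValuation.map_mul, zpow_neg, zpow_natCast, inv_mul_cancel₀ (pow_ne_zero _ hp0),
        AddValuation.map_one]
    rw [hn] at h1
    cases hx : W (p ^ (-(n:ℤ))) with
    | top => rw [hx] at h1; simp at h1
    | coe x =>
      rw [hx] at h1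
      have h2 : x + (n:ℤ) = 0 := by exact_mod_cast h1
      have h3 : x = -(n:ℤ) := by omega
      rw [h3]

lemma val_prod {F : Type} [Field F] (W : AddValuation F (WithTop ℤ)) {ι : Type} (s : Finset ι)
    (f : ι → F) : W (∏ i ∈ s, f i) = ∑ i ∈ s, W (f i) := by
  induction s using Finset.induction_on with
  | empty => simp
  | insert a s ha ih => rw [Finset.prod_insert ha, Finset.sum_insert ha, AddValuation.map_mul, ih]

lemma val_sign_mul {F : Type} [Field F] (W : AddValuation F (WithTop ℤ)) (u : ℤˣ) (x : F) :
    W (((u : ℤ) : F) * x) = W x := by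
  rcases Int.units_eq_one_or u with rfl | rfl <;> simp

lemma sum_half (w : ℕ → ℤ) (k : ℕ) :
    ∑ x ∈ Finset.range (2 * k), w (x / 2) = 2 * ∑ x ∈ Finset.range k, w x := by
  induction k with
  | zero => simp
  | succ k ih =>
    rw [show 2 * (k + 1) = 2 * k + 1 + 1 by ring, Finset.sum_range_succ, Finset.sum_range_succ, ih,
      Finset.sum_range_succ]
    rw [show (2 * k + 1) / 2 = k by omega, show 2 * k / 2 = k by omega]
    ring

lemma sum_tail (lam : ℕ → ℤ) (n k : ℕ) (hk : k ≤ n) :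
    ∑ x : Fin (2 * k), lam (n - k + x.val / 2) = 2 * ∑ i ∈ Finset.Ico (n - k) n, lam i := by
  rw [Fin.sum_univ_eq_sum_range (fun x => lam (n - k + x / 2)), sum_half (fun x => lam (n - k + x)),
    Finset.sum_Ico_eq_sum_range, show n - (n - k) = k by omega]

lemma sum_min (lam : ℕ → ℤ) (n k : ℕ) (hk1 : 1 ≤ k) (hk : k ≤ n)
    (hlam : ∀ i j, i ≤ j → j < n → lam j ≤ lam i) (S : Finset ℕ) (hS : ∀ x ∈ S, x < 2 * n)
    (hc : S.card = 2 * k) :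
    2 * ∑ i ∈ Finset.Ico (n - k) n, lam i ≤ ∑ x ∈ S, lam (x / 2) := by
  have hT : ∑ x ∈ Finset.Ico (2 * (n - k)) (2 * n), lam (x / 2) =
      2 * ∑ i ∈ Finset.Ico (n - k) n, lam i := by
    rw [← sum_tail lam n k hk, Finset.sum_Ico_eq_sum_range,
      Fin.sum_univ_eq_sum_range (fun x => lam (n - k + x / 2)),
      show 2 * n - 2 * (n - k) = 2 * k by omega]
    refine Finset.sum_congr rfl fun x _ => ?_
    congr 1; omega
  rw [← hT]
  set T := Finset.Ico (2 * (n - k)) (2 * n) with hTd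
  have hTc : T.card = 2 * k := by rw [hTd, Nat.card_Ico]; omega
  have h1 : (S \ T).card = (T \ S).card := by
    have a1 := Finset.card_sdiff_add_card_inter S T
    have a2 := Finset.card_sdiff_add_card_inter T S
    rw [Finset.inter_comm] at a2
    omega
  have h2 : ∑ x ∈ T \ S, lam (x / 2) ≤ (T \ S).card • lam (n - k) := by
    refine Finset.sum_le_card_nsmul _ _ _ fun x hx => ?_
    rw [Finset.mem_sdiff, hTd, Finset.mem_Ico] at hx
    exact hlam _ _ (by omega) (by omega)
  have h3 : (S \ T).card • lam (n - k) ≤ ∑ x ∈ S \ T, lam (x / 2) := by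
    refine Finset.card_nsmul_le_sum _ _ _ fun x hx => ?_
    rw [Finset.mem_sdiff, hTd, Finset.mem_Ico] at hx
    have := hS x hx.1
    exact hlam _ _ (by omega) (by omega)
  have e1 := Finset.sum_inter_add_sum_sdiff S T (fun x => lam (x / 2))
  have e2 := Finset.sum_inter_add_sum_sdiff T S (fun x => lam (x / 2))
  rw [Finset.inter_comm] at e2
  rw [h1] at h3
  linarith

lemma val_block {F : Type} [Field F] (W : AddValuation F (WithTop ℤ)) (p : F) (hp : W p = 1)
    (m n : ℕ) (lam : ℕ → ℤ) (i j : Fin m) (h : altBlockDiag p m n lam i j ≠ 0) :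
    j.val < 2 * n ∧ W (altBlockDiag p m n lam i j) = (lam (j.val / 2) : WithTop ℤ) := by
  simp only [altBlockDiag, Matrix.of_apply] at h ⊢
  split_ifs at h ⊢ with h1 h2
  · rw [val_zpow W p hp, show i.val / 2 = j.val / 2 by omega]
    exact ⟨h1.2.1, rfl⟩
  · rw [AddValuation.map_neg, val_zpow W p hp]
    exact ⟨by omega, rfl⟩
  · exact absurd rfl h

lemma val_block_lower {F : Type} [Field F] (W : AddValuation F (WithTop ℤ)) (p : F) (hp : W p = 1)
    (m n k : ℕ) (lam : ℕ → ℤ) (hk1 : 1 ≤ k) (hk : k ≤ n)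
    (hlam : ∀ i j, i ≤ j → j < n → lam j ≤ lam i) (g h : Fin (2 * k) → Fin m) :
    ((2 * ∑ i ∈ Finset.Ico (n - k) n, lam i : ℤ) : WithTop ℤ) ≤
      W ((altBlockDiag p m n lam).submatrix g h).det := by
  by_cases hh : Function.Injective h
  swap
  · rw [Function.Injective] at hh
    push Not at hh
    obtain ⟨x, y, hxy, hne⟩ := hh
    rw [Matrix.det_zero_of_column_eq hne (fun z => by simp [hxy])]
    simp
  rw [Matrix.det_apply']
  refine AddValuation.map_le_sum W fun σ _ => ?_
  rw [val_sign_mul]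
  by_cases h0 : ∏ x, (altBlockDiag p m n lam).submatrix g h (σ x) x = 0
  · rw [h0]; simp
  have hne : ∀ x, altBlockDiag p m n lam (g (σ x)) (h x) ≠ 0 := by
    intro x hx
    exact h0 (Finset.prod_eq_zero (Finset.mem_univ x) hx)
  rw [val_prod]
  have e : ∑ x, W ((altBlockDiag p m n lam).submatrix g h (σ x) x) =
      ((∑ x, lam ((h x).val / 2) : ℤ) : WithTop ℤ) := by
    rw [WithTop.coe_sum]
    exact Finset.sum_congr rfl fun x _ => (val_block W p hp m n lam _ _ (hne x)).2
  rw [e, WithTop.coe_le_coe]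
  have hinj : Function.Injective (fun x => (h x).val) := Fin.val_injective.comp hh
  have := sum_min lam n k hk1 hk hlam (Finset.univ.image fun x => (h x).val) (by
    intro y hy
    rw [Finset.mem_image] at hy
    obtain ⟨x, _, rfl⟩ := hy
    exact (val_block W p hp m n lam _ _ (hne x)).1) (by
    rw [Finset.card_image_of_injective _ hinj]; simp)
  rwa [Finset.sum_image (fun x _ y _ hxy => hinj hxy)] at this

lemma val_block_eq {F : Type} [Field F] (W : AddValuation F (WithTop ℤ)) (p : F) (hp : W p = 1)
    (m n k : ℕ) (lam : ℕ → ℤ) (hk : k ≤ n) (hm : 2 * n ≤ m) :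
    ∃ g : Fin (2 * k) → Fin m, W ((altBlockDiag p m n lam).submatrix g g).det =
      ((2 * ∑ i ∈ Finset.Ico (n - k) n, lam i : ℤ) : WithTop ℤ) := by
  refine ⟨fun x => ⟨2 * (n - k) + x.val, by omega⟩, ?_⟩
  let t : Fin (2 * k) → Fin (2 * k) := fun x =>
    if hx : x.val % 2 = 0 then ⟨x.val + 1, by omega⟩ else ⟨x.val - 1, by omega⟩
  have ht : Function.Involutive t := by
    intro x
    have hx := x.isLt
    ext
    by_cases h : x.val % 2 = 0
    · have h1 : t x = ⟨x.val + 1, by omega⟩ := dif_pos h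
      have h2 : t ⟨x.val + 1, by omega⟩ = ⟨x.val + 1 - 1, by omega⟩ := dif_neg (by simp only; omega)
      rw [h1, h2]; simp
    · have h1 : t x = ⟨x.val - 1, by omega⟩ := dif_neg h
      have h2 : t ⟨x.val - 1, by omega⟩ = ⟨x.val - 1 + 1, by omega⟩ := dif_pos (by simp only; omega)
      rw [h1, h2]; simp only; omega
  let d : Fin (2 * k) → F := fun y => if y.val % 2 = 0 then - p ^ lam (n - k + y.val / 2)
    else p ^ lam (n - k + y.val / 2)
  have e : (altBlockDiag p m n lam).submatrix (fun x : Fin (2 * k) => (⟨2 * (n - k) + x.val, by omega⟩ : Fin m))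
      (fun x : Fin (2 * k) => (⟨2 * (n - k) + x.val, by omega⟩ : Fin m)) =
      (Matrix.diagonal d).submatrix (ht.toPerm t) id := by
    ext x y
    have hx := x.isLt
    have hy := y.isLt
    simp only [Matrix.submatrix_apply, altBlockDiag, Matrix.of_apply, Matrix.diagonal_apply, id,
      Function.Involutive.coe_toPerm]
    have htx : t x = y ↔ (x.val % 2 = 0 ∧ x.val + 1 = y.val) ∨ (x.val % 2 = 1 ∧ y.val + 1 = x.val) := by
      rw [Fin.ext_iff]
      simp only [t]
      split_ifs <;> simp <;> omega
    by_cases hxy : t x = y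
    · rw [if_pos hxy]
      rw [hxy]
      rw [htx] at hxy
      simp only [d]
      rcases hxy with hxy | hxy
      · rw [if_pos (by omega), if_neg (by omega)]
        congr 2; omega
      · rw [if_neg (by omega), if_pos (by omega), if_pos (by omega)]
        congr 3; omega
    · rw [if_neg hxy]
      rw [htx] at hxy
      rw [if_neg (by omega), if_neg (by omega)]
  rw [e, Matrix.det_permute, val_sign_mul, Matrix.det_diagonal, val_prod, ← sum_tail lam n k hk,
    WithTop.coe_sum]
  refine Finset.sum_congr rfl fun x _ => ?_
  simp only [d]
  split_ifs
  · rw [AddValuation.map_neg, val_zpow W p hp]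
  · rw [val_zpow W p hp]

/-- if an alternating `A` of size `2n` (resp. `2n+1`) has Smith form
`diag(J(λ₁), …, J(λ_n))` (resp. with an extra zero row/column) with `λ₁ ≥ … ≥ λ_n`, then for
`1 ≤ k ≤ n`, `2(λ_n + ⋯ + λ_{n−k+1})` is the minimum over principal `2k × 2k` minors
(indexed by strictly monotone `f : Fin 2k → Fin m`) of `v (det A_{I,I})`. -/
theorem stmt2 {F : Type} [Field F] (v : F → WithTop ℤ)
    (hv0 : ∀ x, v x = ⊤ ↔ x = 0)
    (hvmul : ∀ x y, v (x * y) = v x + v y)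
    (hvadd : ∀ x y, min (v x) (v y) ≤ v (x + y))
    (π : F) (hπ : v π = 1)
    (O : Subring F) (hO : ∀ x, x ∈ O ↔ 0 ≤ v x)
    (n m : ℕ) (hn : 1 ≤ n) (hm : m = 2 * n ∨ m = 2 * n + 1)
    (A : Matrix (Fin m) (Fin m) F)
    (hAalt : A.transpose = -A) (hAdiag : ∀ i, A i i = 0)
    (U : Matrix (Fin m) (Fin m) F) (hU : ∀ i j, U i j ∈ O)
    (hUinv : ∃ V : Matrix (Fin m) (Fin m) F, (∀ i j, V i j ∈ O) ∧ U * V = 1 ∧ V * U = 1)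
    (lam : ℕ → ℤ) (hlam : ∀ i j, i ≤ j → j < n → lam j ≤ lam i)
    (hdiag : U * A * U.transpose = altBlockDiag π m n lam)
    (k : ℕ) (hk1 : 1 ≤ k) (hkn : k ≤ n) :
    (Finset.univ.filter fun f : Fin (2 * k) → Fin m => ∀ i j, i < j → f i < f j).inf
        (fun f => v ((A.submatrix f f).det))
      = ((2 * ∑ i ∈ Finset.Ico (n - k) n, lam i : ℤ) : WithTop ℤ) := by
  have hv1 : v 1 = 0 := by
    have h1 := hvmul 1 1
    rw [mul_one] at h1
    have h2 : v 1 ≠ ⊤ := by rw [Ne, hv0]; exact one_ne_zero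
    cases hx : v 1 with
    | top => exact absurd hx h2
    | coe x =>
      rw [hx] at h1
      have h3 : x = x + x := by exact_mod_cast h1
      have h4 : x = 0 := by omega
      rw [h4]; rfl
  let W : AddValuation F (WithTop ℤ) := AddValuation.of v ((hv0 0).2 rfl) hv1 hvadd hvmul
  have hWv : ∀ x, W x = v x := fun x => rfl
  have hWπ : W π = 1 := hπ
  obtain ⟨V, hV, hUV, hVU⟩ := hUinv
  have hA : A = V * altBlockDiag π m n lam * V.transpose := by
    have hT : U.transpose * V.transpose = 1 := by
      rw [← Matrix.transpose_mul, hVU, Matrix.transpose_one]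
    rw [← hdiag]
    calc A = (V * U) * A * (U.transpose * V.transpose) := by rw [hVU, hT]; simp
      _ = _ := by simp only [Matrix.mul_assoc]
  have hm2 : 2 * n ≤ m := by omega
  apply le_antisymm
  · haveI : Nonempty (Fin m) := ⟨⟨0, by omega⟩⟩
    obtain ⟨f, hf⟩ := val_principal W hv0 k A
      (fun i j => by simpa using congrFun (congrFun hAalt i) j) hAdiag
    obtain ⟨g, hg⟩ := val_block_eq W π hWπ m n k lam hkn hm2
    have h1 := val_cb W U (fun i j => (hO _).1 (hU i j)) A _ hf g g
    rw [hdiag, hg] at h1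
    have hinj : Function.Injective f := by
      by_contra hh
      rw [Function.Injective] at hh
      push Not at hh
      obtain ⟨x, y, hxy, hne⟩ := hh
      rw [Matrix.det_zero_of_column_eq hne (fun z => by simp [hxy]), AddValuation.map_zero,
        top_le_iff] at h1
      exact WithTop.coe_ne_top h1
    have hs : StrictMono (f ∘ Tuple.sort f) :=
      (Tuple.monotone_sort f).strictMono_of_injective (hinj.comp (Tuple.sort f).injective)
    refine le_trans (Finset.inf_le (b := f ∘ Tuple.sort f) ?_) ?_
    · simp only [Finset.mem_filter, Finset.mem_univ, true_and]
      exact fun i j hij => hs hij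
    · rw [← Matrix.submatrix_submatrix, Matrix.det_submatrix_equiv_self]
      exact h1
  · refine Finset.le_inf fun f _ => ?_
    rw [hA]
    exact val_cb W V (fun i j => (hO _).1 (hV i j)) _ _
      (val_block_lower W π hWπ m n k lam hk1 hkn hlam) f f
end

section
/- Let B be a 2n×2n alternating matrix over F and let U ∈ GL_{2n}(𝔬). Then for every 1 ≤ k ≤ n, the minimum over all subsets I ⊆ {1,…,2n} with |I| = 2k of v(det B_{I,I}) equals the minimum over all such subsets I of v(det (U·B·Uᵀ)_{I,I}), where both minima are taken in ℤ ∪ {∞} and C_{I,I} denotes the principal submatrix of C with rows and columns indexed by I. -/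
open scoped Classical

/-- An alternating matrix of odd size has zero determinant (any characteristic). -/
theorem odd_alt_det {F : Type} [Field F] {ι : Type} [Fintype ι] [DecidableEq ι]
    (hodd : Odd (Fintype.card ι)) (G : Matrix ι ι F)
    (hG : ∀ i j, G j i = - G i j) (hd : ∀ i, G i i = 0) : G.det = 0 := by
  rw [Matrix.det_apply']
  refine Finset.sum_ninvolution (fun σ => σ⁻¹) ?_ ?_ ?_ ?_
  · intro σ
    have h1 : ∏ i, G (σ⁻¹ i) i = ∏ i, G i (σ i) := by
      rw [← Equiv.prod_comp σ]
      simp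
    rw [h1, Equiv.Perm.sign_inv]
    have h2 : ∏ i, G i (σ i) = - ∏ i, G (σ i) i := by
      have : ∀ i, G i (σ i) = - G (σ i) i := fun i => hG _ _
      rw [Finset.prod_congr rfl (fun i _ => this i), Finset.prod_neg, Finset.card_univ,
        hodd.neg_one_pow]
      ring
    rw [h2]; ring
  · intro σ hσ hinv
    apply hσ
    have hfix : ∃ i, σ i = i := by
      by_contra hno
      push Not at hno
      have h0 : ∑ _i : ι, (1 : ZMod 2) = 0 := by
        refine Finset.sum_ninvolution (fun i => σ i) (fun _ => by decide) (fun i _ => hno i)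
          (fun _ => Finset.mem_univ _) (fun i => ?_)
        have : σ⁻¹ (σ i) = i := by simp
        rwa [hinv] at this
      simp only [Finset.sum_const, Finset.card_univ, nsmul_eq_mul, mul_one] at h0
      rw [ZMod.natCast_eq_zero_iff_even] at h0
      exact (Nat.not_even_iff_odd.mpr hodd) h0
    obtain ⟨i, hi⟩ := hfix
    rw [Finset.prod_eq_zero (Finset.mem_univ i) (by rw [hi, hd]), mul_zero]
  · intro σ; exact Finset.mem_univ _
  · intro σ; simp

/-- `x ⬝ B x = 0`. -/
theorem alt_self {F : Type} [Field F] {m : Type} [Fintype m]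
    (B : Matrix m m F) (hB : ∀ i j, B j i = - B i j) (hd : ∀ i, B i i = 0) (x : m → F) :
    x ⬝ᵥ B.mulVec x = 0 := by
  simp only [dotProduct, Matrix.mulVec, Finset.mul_sum]
  rw [← Finset.sum_product']
  refine Finset.sum_ninvolution (fun p => (p.2, p.1)) ?_ ?_ ?_ ?_
  · rintro ⟨i, j⟩
    simp only [hB i j]; ring
  · rintro ⟨i, j⟩ h heq
    apply h
    simp only [Prod.mk.injEq] at heq
    simp [heq.1, hd]
  · simp
  · simp

theorem alt_skew {F : Type} [Field F] {m : Type} [Fintype m]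
    (B : Matrix m m F) (hB : ∀ i j, B j i = - B i j) (x y : m → F) :
    y ⬝ᵥ B.mulVec x = - (x ⬝ᵥ B.mulVec y) := by
  simp only [dotProduct, Matrix.mulVec, Finset.mul_sum]
  rw [Finset.sum_comm, ← Finset.sum_neg_distrib]
  refine Finset.sum_congr rfl fun i _ => ?_
  rw [← Finset.sum_neg_distrib]
  refine Finset.sum_congr rfl fun j _ => ?_
  rw [hB i j]; ring

theorem gram_apply {F : Type} [Field F] {m ι : Type} [Fintype m]
    (B : Matrix m m F) (X : Matrix ι m F) (s t : ι) :
    (X * B * X.transpose) s t = X s ⬝ᵥ B.mulVec (X t) := by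
  rw [Matrix.mul_assoc, Matrix.mul_apply]
  simp [dotProduct, Matrix.mulVec, Matrix.mul_apply]

/-- Matrices with a special null vector away from slot `a`. -/
theorem det_sq_aux {F : Type} [Field F] {ι : Type} [Fintype ι] [DecidableEq ι]
    (A : Matrix ι ι F) (a i : ι) (u : ι → F) (l : F) (hua : u a = 0)
    (h1 : A.mulVec u = Pi.single a l) (h2 : Matrix.vecMul u A = Pi.single a (-l)) :
    u i * u i * A.det = - (l * l) *
      ((A.updateRow a (Pi.single i 1)).updateCol a (Pi.single i 1)).det := by
  have e1 : u i * A.det = l * (A.updateRow a (Pi.single i 1)).det := by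
    have := congrArg (fun M => M.mulVec u i) (Matrix.adjugate_mul A)
    simp only [← Matrix.mulVec_mulVec, h1, Matrix.smul_mulVec, Matrix.one_mulVec,
      Pi.smul_apply, smul_eq_mul, Matrix.mulVec_single, Matrix.col_apply,
      Matrix.adjugate_apply] at this
    simp at this
    linear_combination -this
  have h3 : Matrix.vecMul u (A.updateRow a (Pi.single i 1)) = Pi.single a (-l) := by
    rw [← h2]
    ext j
    simp only [Matrix.vecMul, dotProduct]
    refine Finset.sum_congr rfl fun s _ => ?_
    by_cases hs : s = a
    · subst hs; simp [hua]
    · simp [hs]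
  have e2 : u i * (A.updateRow a (Pi.single i 1)).det = (-l) *
      ((A.updateRow a (Pi.single i 1)).updateCol a (Pi.single i 1)).det := by
    generalize A.updateRow a (Pi.single i 1) = C at h3
    have h4 : C.transpose.mulVec u = Pi.single a (-l) := by
      rw [Matrix.mulVec_transpose, h3]
    have := congrArg (fun M => M.mulVec u i) (Matrix.adjugate_mul C.transpose)
    simp only [← Matrix.mulVec_mulVec, h4, Matrix.smul_mulVec, Matrix.one_mulVec,
      Pi.smul_apply, smul_eq_mul, Matrix.mulVec_single, Matrix.col_apply] at this
    simp at this
    rw [Matrix.adjugate_apply, Matrix.updateRow_transpose, Matrix.det_transpose] at this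
    linear_combination -this
  linear_combination u i * e1 + l * e2

/-- In each slot the Gram determinant is a constant times the square of a linear form. -/
theorem gram_slot {F : Type} [Field F] {m ι : Type} [Fintype m] [Fintype ι] [DecidableEq ι]
    (heven : Even (Fintype.card ι))
    (B : Matrix m m F) (hB : ∀ i j, B j i = - B i j) (hd : ∀ i, B i i = 0)
    (X : Matrix ι m F) (a : ι) :
    ∃ (c : F) (w : m → F), ∀ x : m → F,
      (X.updateRow a x * B * (X.updateRow a x).transpose).det
        = c * ((x ⬝ᵥ w) * (x ⬝ᵥ w)) := by
  have hdet : (Matrix.of fun s t : {s : ι // s ≠ a} => X s ⬝ᵥ B.mulVec (X t)).det = 0 := by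
    apply odd_alt_det
    · have : Fintype.card {s : ι // s ≠ a} = Fintype.card ι - 1 := by
        simp [Fintype.card_subtype_compl]
      rw [this]
      have hp : 0 < Fintype.card ι := Fintype.card_pos_iff.mpr ⟨a⟩
      exact Nat.Even.sub_odd hp heven odd_one
    · intro i j; exact alt_skew B hB _ _
    · intro i; exact alt_self B hB hd _
  obtain ⟨u0, hu0, hu⟩ := Matrix.exists_mulVec_eq_zero_iff.mpr hdet
  obtain ⟨i, hi⟩ := Function.ne_iff.mp hu0
  let u : ι → F := fun s => if h : s ≠ a then u0 ⟨s, h⟩ else 0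
  have hua : u a = 0 := by simp [u]
  have hui : u i ≠ 0 := by
    have := i.2
    simpa [u, this] using hi
  let w0 : m → F := ∑ s, u s • X s
  have hw0 : ∀ x : m → F, ∑ s, u s • (X.updateRow a x) s = w0 := by
    intro x
    refine Finset.sum_congr rfl fun s _ => ?_
    by_cases hs : s = a
    · subst hs; simp [hua]
    · simp [hs]
  have horth : ∀ s, s ≠ a → X s ⬝ᵥ B.mulVec w0 = 0 := by
    intro s hs
    have := congrFun hu ⟨s, hs⟩
    simp only [Matrix.mulVec, dotProduct, Matrix.of_apply, Pi.zero_apply] at this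
    have h5 : X s ⬝ᵥ B.mulVec w0 = ∑ t, (X s ⬝ᵥ B.mulVec (X t)) * u t := by
      simp only [w0, Matrix.mulVec_sum, dotProduct_sum, Matrix.mulVec_smul, dotProduct_smul,
        smul_eq_mul]
      exact Finset.sum_congr rfl fun t _ => mul_comm _ _
    rw [h5, ← this]
    rw [← Fintype.sum_subtype_add_sum_subtype (fun t => t ≠ a)
      (fun t => (X s ⬝ᵥ B.mulVec (X t)) * u t)]
    have hz : ∑ t : {t // ¬ t ≠ a}, (X s ⬝ᵥ B.mulVec (X t)) * u t = 0 := by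
      refine Finset.sum_eq_zero fun t _ => ?_
      have ht : t.1 = a := not_not.mp t.2
      rw [ht, hua, mul_zero]
    rw [hz, add_zero]
    refine Finset.sum_congr rfl fun t _ => ?_
    have ht : u t = u0 t := by
      have := t.2
      simp [u, this]
    rw [ht]
    rfl
  have hmul : ∀ x, (X.updateRow a x * B * (X.updateRow a x).transpose).mulVec u
      = Pi.single a (x ⬝ᵥ B.mulVec w0) := by
    intro x
    have h6 : ∀ s, (X.updateRow a x * B * (X.updateRow a x).transpose).mulVec u s
      = (X.updateRow a x) s ⬝ᵥ B.mulVec w0 := by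
      intro s
      rw [← hw0 x]
      simp only [Matrix.mulVec_sum, dotProduct_sum, Matrix.mulVec_smul, dotProduct_smul,
        smul_eq_mul]
      rw [Matrix.mulVec, dotProduct]
      exact Finset.sum_congr rfl fun t _ => by rw [gram_apply, mul_comm]
    ext s
    rw [h6]
    by_cases hs : s = a
    · subst hs; simp
    · simp [hs, horth s hs]
  have hvec : ∀ x, Matrix.vecMul u (X.updateRow a x * B * (X.updateRow a x).transpose)
      = Pi.single a (-(x ⬝ᵥ B.mulVec w0)) := by
    intro x
    rw [Pi.single_neg, ← hmul x]
    ext s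
    simp only [Matrix.vecMul, Matrix.mulVec, dotProduct, Pi.neg_apply]
    rw [← Finset.sum_neg_distrib]
    refine Finset.sum_congr rfl fun t _ => ?_
    rw [gram_apply, gram_apply, alt_skew B hB]; ring
  let K : Matrix ι ι F := (((X * B * X.transpose).updateRow a (Pi.single i.1 1)).updateCol a
    (Pi.single i.1 1))
  refine ⟨-K.det / (u i * u i), B.mulVec w0, fun x => ?_⟩
  have := det_sq_aux _ a i.1 u _ hua (hmul x) (hvec x)
  have hK : (((X.updateRow a x * B * (X.updateRow a x).transpose).updateRow a
      (Pi.single i.1 1)).updateCol a (Pi.single i.1 1)) = K := by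
    ext s t
    simp only [K, Matrix.updateCol_apply, Matrix.updateRow_apply]
    split_ifs with h h' <;> try rfl
    rw [gram_apply, gram_apply, Matrix.updateRow_ne h', Matrix.updateRow_ne h]
  rw [hK] at this
  field_simp
  linear_combination this

section val
variable {F : Type} [Field F]

theorem slot_sum (v : F → WithTop ℤ)
    (hv0 : ∀ x, v x = ⊤ ↔ x = 0)
    (hvmul : ∀ x y, v (x * y) = v x + v y)
    (hvadd : ∀ x y, min (v x) (v y) ≤ v (x + y))
    {m : Type} (S : Finset m) (M : WithTop ℤ) (c : F) (w x : m → F)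
    (hx : ∀ j, 0 ≤ v (x j)) (hw : ∀ j, M ≤ v (c * (w j * w j))) :
    M ≤ v (c * ((∑ j ∈ S, x j * w j) * (∑ j ∈ S, x j * w j))) := by
  induction S using Finset.induction_on with
  | empty => simp [(hv0 0).mpr rfl]
  | insert a S ha ih =>
    rw [Finset.sum_insert ha]
    have h1 : M ≤ v (c * ((x a * w a) * (x a * w a))) := by
      have : c * ((x a * w a) * (x a * w a)) = (x a * x a) * (c * (w a * w a)) := by ring
      rw [this, hvmul, hvmul (x a)]
      calc M = 0 + M := by simp
        _ ≤ _ := add_le_add (add_nonneg (hx a) (hx a)) (hw a)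
    generalize x a * w a = p at *
    generalize ∑ j ∈ S, x j * w j = q at *
    have h := hvadd p q
    rw [hvmul, hvmul] at *
    rcases min_le_iff.mp h with h | h
    · exact h1.trans (by gcongr)
    · exact ih.trans (by gcongr)

theorem gram_val (v : F → WithTop ℤ)
    (hv0 : ∀ x, v x = ⊤ ↔ x = 0)
    (hvmul : ∀ x y, v (x * y) = v x + v y)
    (hvadd : ∀ x y, min (v x) (v y) ≤ v (x + y))
    {m ι : Type} [Fintype m] [DecidableEq m] [Fintype ι] [DecidableEq ι]
    (heven : Even (Fintype.card ι))
    (B : Matrix m m F) (hB : ∀ i j, B j i = - B i j) (hd : ∀ i, B i i = 0)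
    (M : WithTop ℤ) (hM : ∀ f : ι → m, M ≤ v (B.submatrix f f).det)
    (S : Finset ι) : ∀ (X : Matrix ι m F) (_ : ∀ s j, 0 ≤ v (X s j))
    (_ : ∀ s, s ∉ S → ∃ j, X s = Pi.single j 1),
    M ≤ v (X * B * X.transpose).det := by
  have h00 : (0 : WithTop ℤ) ≤ v 0 := by rw [(hv0 0).mpr rfl]; exact le_top
  have h01 : (0 : WithTop ℤ) ≤ v 1 := by
    have h := hvmul 1 1
    rw [mul_one] at h
    have hne : v 1 ≠ ⊤ := fun h => one_ne_zero ((hv0 1).mp h)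
    lift v 1 to ℤ using hne with z
    norm_cast at *
    omega
  induction S using Finset.induction_on with
  | empty =>
    intro X _ hX
    choose f hf using fun s => hX s (by simp)
    convert hM f using 3
    ext s t
    rw [gram_apply, hf, hf]
    simp
  | insert a S ha ih =>
    intro X hX hS
    obtain ⟨c, w, hc⟩ := gram_slot heven B hB hd X a
    have hXX : X = X.updateRow a (X a) := by simp
    rw [hXX, hc]
    apply slot_sum v hv0 hvmul hvadd _ _ _ _ _ (hX a)
    intro j
    have h := ih (X.updateRow a (Pi.single j 1)) ?_ ?_
    · rw [hc] at h
      simpa using h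
    · intro s t
      by_cases hs : s = a
      · subst hs
        by_cases ht : t = j
        · subst ht; simpa using h01
        · simpa [ht] using h00
      · simpa [hs] using hX s t
    · intro s hs
      by_cases hsa : s = a
      · subst hsa; exact ⟨j, by simp⟩
      · obtain ⟨j', hj'⟩ := hS s (by simp [hsa, hs])
        exact ⟨j', by rw [Matrix.updateRow_ne hsa, hj']⟩

theorem one_side (v : F → WithTop ℤ)
    (hv0 : ∀ x, v x = ⊤ ↔ x = 0)
    (hvmul : ∀ x y, v (x * y) = v x + v y)
    (hvadd : ∀ x y, min (v x) (v y) ≤ v (x + y))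
    (N k : ℕ) (B U : Matrix (Fin N) (Fin N) F)
    (hB : ∀ i j, B j i = - B i j) (hd : ∀ i, B i i = 0)
    (hU : ∀ i j, 0 ≤ v (U i j)) :
    (Finset.univ.filter fun f : Fin (2 * k) → Fin N => ∀ i j, i < j → f i < f j).inf
        (fun f => v ((B.submatrix f f).det))
      ≤ (Finset.univ.filter fun f : Fin (2 * k) → Fin N => ∀ i j, i < j → f i < f j).inf
        (fun f => v (((U * B * U.transpose).submatrix f f).det)) := by
  apply Finset.le_inf
  intro g _
  have := gram_val v hv0 hvmul hvadd (ι := Fin (2 * k)) (by simp) B hB hd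
    ((Finset.univ.filter fun f : Fin (2 * k) → Fin N => ∀ i j, i < j → f i < f j).inf
        (fun f => v ((B.submatrix f f).det))) ?_ Finset.univ (U.submatrix g id)
        (fun s j => hU _ _) (by simp)
  · convert this using 3
    ext s t
    rw [gram_apply, Matrix.submatrix_apply, gram_apply]
    rfl
  · intro f
    by_cases hf : Function.Injective f
    · have hdet : (B.submatrix f f).det
          = (B.submatrix (f ∘ Tuple.sort f) (f ∘ Tuple.sort f)).det := by
        rw [← Matrix.submatrix_submatrix, Matrix.det_submatrix_equiv_self]
      rw [hdet]
      apply Finset.inf_le (f := fun f => v ((B.submatrix f f).det))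
      simp only [Finset.mem_filter, Finset.mem_univ, true_and]
      exact fun i j hij => ((Tuple.monotone_sort f).strictMono_of_injective
        (hf.comp (Equiv.injective _))) hij
    · obtain ⟨i, j, hij, hne⟩ := Function.not_injective_iff.mp hf
      rw [Matrix.det_zero_of_row_eq hne (by ext t; simp [hij]), (hv0 0).mpr rfl]
      exact le_top

end val

/-- for a `2n × 2n` alternating matrix `B` over `F` and `U ∈ GL_{2n}(O)`, the
minimum of `v (det C_{I,I})` over principal `2k × 2k` submatrices (indexed by strictly
monotone `f : Fin 2k → Fin 2n`) is the same for `C = B` and `C = U·B·Uᵀ`. -/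
theorem stmt3 {F : Type} [Field F] (v : F → WithTop ℤ)
    (hv0 : ∀ x, v x = ⊤ ↔ x = 0)
    (hvmul : ∀ x y, v (x * y) = v x + v y)
    (hvadd : ∀ x y, min (v x) (v y) ≤ v (x + y))
    (π : F) (hπ : v π = 1)
    (O : Subring F) (hO : ∀ x, x ∈ O ↔ 0 ≤ v x)
    (n : ℕ) (hn : 1 ≤ n)
    (B : Matrix (Fin (2 * n)) (Fin (2 * n)) F)
    (hBalt : B.transpose = -B) (hBdiag : ∀ i, B i i = 0)
    (U : Matrix (Fin (2 * n)) (Fin (2 * n)) F) (hU : ∀ i j, U i j ∈ O)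
    (hUinv : ∃ V : Matrix (Fin (2 * n)) (Fin (2 * n)) F,
      (∀ i j, V i j ∈ O) ∧ U * V = 1 ∧ V * U = 1)
    (k : ℕ) (hk1 : 1 ≤ k) (hkn : k ≤ n) :
    (Finset.univ.filter fun f : Fin (2 * k) → Fin (2 * n) => ∀ i j, i < j → f i < f j).inf
        (fun f => v ((B.submatrix f f).det))
      = (Finset.univ.filter fun f : Fin (2 * k) → Fin (2 * n) => ∀ i j, i < j → f i < f j).inf
        (fun f => v (((U * B * U.transpose).submatrix f f).det)) := by
  have hB : ∀ i j, B j i = - B i j := fun i j => congrFun (congrFun hBalt i) j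
  obtain ⟨V, hV, hUV, hVU⟩ := hUinv
  apply le_antisymm
  · exact one_side v hv0 hvmul hvadd _ k B U hB hBdiag fun i j => (hO _).mp (hU i j)
  · have h := one_side v hv0 hvmul hvadd _ k (U * B * U.transpose) V
      (fun i j => by rw [gram_apply, gram_apply, alt_skew B hB])
      (fun i => by rw [gram_apply, alt_self B hB hBdiag]) fun i j => (hO _).mp (hV i j)
    have e : V * (U * B * U.transpose) * V.transpose = B := by
      calc V * (U * B * U.transpose) * V.transpose
          = (V * U) * B * (V * U).transpose := by
            rw [Matrix.transpose_mul]; simp only [Matrix.mul_assoc]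
        _ = B := by rw [hVU]; simp
    rw [e] at h
    exact h
end

section
/- Let q be a prime power, K a finite field with q² elements, and σ : K → K the map σ(x) = x^q (a ring automorphism of order 2). For n ≥ 1, let Her_n(K) be the set of n×n matrices A over K such that the transpose of the entrywise application of σ to A equals A. Then |Her_n(K)| = q^{n²}, and the number of invertible matrices in Her_n(K) equals ∏_{i=1}^{n} q^{i−1}(q^i + (−1)^i); equivalently, the proportion of matrices in Her_n(K) that are invertible is ∏_{i=1}^{n} (1 + (−q)^{−i}). -/
open scoped Classical

namespace HermCount
open Matrix

variable {K : Type} [Field K] [Fintype K] [StarRing K]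

/-- Hermitian bordered matrix. -/
def bord {ι : Type} (a : Matrix Unit Unit K) (w : Matrix Unit ι K) (B : Matrix ι ι K) :
    Matrix (Unit ⊕ ι) (Unit ⊕ ι) K := fromBlocks a w wᴴ B

/-- The number of Hermitian matrices with property `Q`. -/
noncomputable def cnt {ι : Type} (Q : Matrix ι ι K → Prop) : ℕ :=
  Nat.card {A : Matrix ι ι K // A.IsHermitian ∧ Q A}

lemma cnt_congr {ι κ : Type} (e : Matrix ι ι K ≃ Matrix κ κ K) (Q : Matrix ι ι K → Prop)
    (R : Matrix κ κ K → Prop) (h1 : ∀ A, A.IsHermitian ↔ (e A).IsHermitian)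
    (h2 : ∀ A, Q A ↔ R (e A)) : cnt Q = cnt R :=
  Nat.card_congr (Equiv.subtypeEquiv e fun A => by rw [← h1, ← h2])

lemma cnt_bord {ι : Type} [Fintype ι] [DecidableEq ι] (Q : Matrix (Unit ⊕ ι) (Unit ⊕ ι) K → Prop) :
    cnt Q = ∑ p : {a : Matrix Unit Unit K // a.IsHermitian} × Matrix Unit ι K,
      cnt fun B => Q (bord p.1.1 p.2 B) := by
  unfold cnt
  rw [← Nat.card_sigma]
  refine Nat.card_congr
    { toFun := fun A => ⟨(⟨A.1.toBlocks₁₁, ?_⟩, A.1.toBlocks₁₂), ⟨A.1.toBlocks₂₂, ?_, ?_⟩⟩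
      invFun := fun s => ⟨bord s.1.1.1 s.1.2 s.2.1, ?_, s.2.2.2⟩
      left_inv := ?_
      right_inv := ?_ }
  · have h := A.2.1
    rw [← fromBlocks_toBlocks A.1, isHermitian_fromBlocks_iff] at h
    exact h.1
  · have h := A.2.1
    rw [← fromBlocks_toBlocks A.1, isHermitian_fromBlocks_iff] at h
    exact h.2.2.2
  · have h := A.2.1
    rw [← fromBlocks_toBlocks A.1, isHermitian_fromBlocks_iff] at h
    have : bord A.1.toBlocks₁₁ A.1.toBlocks₁₂ A.1.toBlocks₂₂ = A.1 := by
      rw [bord, h.2.1, fromBlocks_toBlocks]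
    simpa [this] using A.2.2
  · exact IsHermitian.fromBlocks s.1.1.2 rfl s.2.2.1
  · intro A
    have h := A.2.1
    rw [← fromBlocks_toBlocks A.1, isHermitian_fromBlocks_iff] at h
    have : bord A.1.toBlocks₁₁ A.1.toBlocks₁₂ A.1.toBlocks₂₂ = A.1 := by
      rw [bord, h.2.1, fromBlocks_toBlocks]
    exact Subtype.ext this
  · rintro ⟨⟨⟨a, ha⟩, w⟩, ⟨B, hB⟩⟩
    rfl

lemma cnt_reindex {ι κ : Type} [Fintype ι] [DecidableEq ι] [Fintype κ] [DecidableEq κ] (e : ι ≃ κ) :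
    cnt (fun A : Matrix ι ι K => A.det ≠ 0) = cnt (fun A : Matrix κ κ K => A.det ≠ 0) := by
  refine cnt_congr (Matrix.reindex e e) _ _ (fun A => ?_) (fun A => ?_)
  · exact (isHermitian_submatrix_equiv e.symm).symm
  · simp [det_submatrix_equiv_self]

lemma cnt_reindex_true {ι κ : Type} (e : ι ≃ κ) :
    cnt (fun _ : Matrix ι ι K => True) = cnt (fun _ : Matrix κ κ K => True) := by
  refine cnt_congr (Matrix.reindex e e) _ _ (fun A => ?_) (fun A => Iff.rfl)
  exact (isHermitian_submatrix_equiv e.symm).symm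

/-- Nonzero corner. -/
lemma cnt_corner {ι : Type} [Fintype ι] [DecidableEq ι] (a : Matrix Unit Unit K) (ha : a.IsHermitian)
    (ha0 : a ≠ 0) (w : Matrix Unit ι K) :
    cnt (fun B => (bord a w B).det ≠ 0) = cnt (fun B : Matrix ι ι K => B.det ≠ 0) := by
  have hdet : a.det ≠ 0 := by
    intro h
    apply ha0
    ext i j
    simpa using h
  have hs : (wᴴ * a⁻¹ * w).IsHermitian := isHermitian_conjTranspose_mul_mul _ ha.inv
  refine cnt_congr (Equiv.subRight (wᴴ * a⁻¹ * w)) _ _ (fun A => ?_) (fun A => ?_)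
  · constructor
    · intro h
      exact h.sub hs
    · intro h
      have := h.add hs
      simpa using this
  · letI := invertibleOfIsUnitDet a (isUnit_iff_ne_zero.2 hdet)
    rw [bord, det_fromBlocks₁₁, invOf_eq_nonsing_inv]
    exact ⟨fun h => (mul_ne_zero_iff.1 h).2, fun h => mul_ne_zero hdet h⟩

lemma cnt_zero {ι : Type} [Fintype ι] [DecidableEq ι] :
    cnt (fun B : Matrix ι ι K => (bord 0 0 B).det ≠ 0) = 0 := by
  unfold cnt
  have : IsEmpty {B : Matrix ι ι K // B.IsHermitian ∧ (bord 0 0 B).det ≠ 0} := by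
    refine ⟨fun B => B.2.2 ?_⟩
    apply det_eq_zero_of_row_eq_zero (Sum.inl ())
    rintro (j | j) <;> simp [bord]
  exact Nat.card_of_isEmpty

variable (K) in
/-- First basis row. -/
def erow (κ : Type) : Matrix Unit (Unit ⊕ κ) K := fromCols 1 0

lemma exists_P {κ : Type} [Fintype κ] [DecidableEq κ] (w : Matrix Unit (Unit ⊕ κ) K) (hw : w ≠ 0) :
    ∃ P : Matrix (Unit ⊕ κ) (Unit ⊕ κ) K, P.det ≠ 0 ∧ erow K κ * P = w := by
  obtain ⟨j, hj⟩ : ∃ j, w () j ≠ 0 := by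
    by_contra! h
    exact hw (by ext i j; exact h j)
  refine ⟨((1 : Matrix (Unit ⊕ κ) (Unit ⊕ κ) K).updateRow j (w ())).submatrix
    (Equiv.swap (Sum.inl ()) j) id, ?_, ?_⟩
  · rw [det_permute, ← cramer_transpose_apply]
    refine mul_ne_zero ?_ (by simpa using hj)
    rcases Int.units_eq_one_or (Equiv.Perm.sign (Equiv.swap (Sum.inl ()) j)) with h | h <;>
      rw [h] <;> simp
  · ext i k
    rw [mul_apply, Fintype.sum_sum_type]
    simp [erow]

lemma cnt_row {κ : Type} [Fintype κ] [DecidableEq κ] (w : Matrix Unit (Unit ⊕ κ) K) (hw : w ≠ 0) :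
    cnt (fun B : Matrix (Unit ⊕ κ) (Unit ⊕ κ) K => (bord 0 w B).det ≠ 0) =
    cnt (fun B : Matrix (Unit ⊕ κ) (Unit ⊕ κ) K => (bord 0 (erow K κ) B).det ≠ 0) := by
  obtain ⟨P, hP, rfl⟩ := exists_P w hw
  have hu : IsUnit P.det := isUnit_iff_ne_zero.2 hP
  have h1 : P * P⁻¹ = 1 := mul_nonsing_inv _ hu
  have h2 : P⁻¹ * P = 1 := nonsing_inv_mul _ hu
  have h3 : Pᴴ * P⁻¹ᴴ = 1 := by rw [← conjTranspose_mul, h2, conjTranspose_one]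
  have h4 : P⁻¹ᴴ * Pᴴ = 1 := by rw [← conjTranspose_mul, h1, conjTranspose_one]
  symm
  have hl : ∀ B, P⁻¹ᴴ * (Pᴴ * B * P) * P⁻¹ = B := fun B => by
    rw [Matrix.mul_assoc, Matrix.mul_assoc (Pᴴ * B), h1, Matrix.mul_one, ← Matrix.mul_assoc, h4,
      Matrix.one_mul]
  have hr : ∀ B, Pᴴ * (P⁻¹ᴴ * B * P⁻¹) * P = B := fun B => by
    rw [Matrix.mul_assoc, Matrix.mul_assoc (P⁻¹ᴴ * B), h2, Matrix.mul_one, ← Matrix.mul_assoc, h3,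
      Matrix.one_mul]
  refine cnt_congr ⟨fun B => Pᴴ * B * P, fun B => P⁻¹ᴴ * B * P⁻¹, hl, hr⟩ _ _
    (fun A => ?_) (fun A => ?_)
  · constructor
    · intro h
      exact isHermitian_conjTranspose_mul_mul _ h
    · intro h
      have := isHermitian_conjTranspose_mul_mul P⁻¹ h
      simpa only [Equiv.coe_fn_mk, hl] using this
  · have key : bord 0 (erow K κ * P) (Pᴴ * A * P) =
        fromBlocks 1 0 0 Pᴴ * bord 0 (erow K κ) A * fromBlocks 1 0 0 P := by
      simp [bord, fromBlocks_multiply, conjTranspose_mul]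
    have hP' : Pᴴ.det ≠ 0 := by rw [det_conjTranspose]; simpa using hP
    simp only [Equiv.coe_fn_mk, key, det_mul, det_fromBlocks_zero₂₁, det_one, one_mul]
    simp [hP, hP']

lemma det_ebord {κ : Type} [Fintype κ] [DecidableEq κ] (a : Matrix Unit Unit K) (w : Matrix Unit κ K)
    (C : Matrix κ κ K) : (bord 0 (erow K κ) (bord a w C)).det ≠ 0 ↔ C.det ≠ 0 := by
  have key : (bord 0 (erow K κ) (bord a w C)).submatrix
      (Equiv.swap (Sum.inl ()) (Sum.inr (Sum.inl ()))) id =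
      fromBlocks 1 (fromCols a w) 0 (fromBlocks 1 0 wᴴ C) := by
    ext i j
    rcases i with i | i | i <;> rcases j with j | j | j <;>
      simp [bord, erow, Equiv.swap_apply_def, conjTranspose_apply]
  have h := congrArg det key
  rw [det_permute, det_fromBlocks_zero₂₁, det_fromBlocks_zero₁₂, det_one, one_mul, one_mul] at h
  rw [← h]
  rcases Int.units_eq_one_or
    (Equiv.Perm.sign (Equiv.swap (Sum.inl ()) (Sum.inr (Sum.inl ())) :
      Equiv.Perm (Unit ⊕ (Unit ⊕ κ)))) with h | h <;> simp [h]

lemma card_herm1 (q : ℕ) (hfix : Nat.card {x : K // star x = x} = q)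
    : Fintype.card {a : Matrix Unit Unit K // a.IsHermitian} = q := by
  rw [← Nat.card_eq_fintype_card, ← hfix]
  refine Nat.card_congr
    ⟨fun a => ⟨a.1 () (), a.2.apply () ()⟩, fun x => ⟨fun _ _ => x.1, ?_⟩, ?_, ?_⟩
  · ext i j
    exact x.2
  · intro a
    rfl
  · intro a
    rfl

lemma card_row (q : ℕ) (hK : Fintype.card K = q ^ 2)
    (ι : Type) [Fintype ι] [DecidableEq ι] :
    Fintype.card (Matrix Unit ι K) = q ^ (2 * Fintype.card ι) := by
  rw [← Nat.card_eq_fintype_card]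
  simp [Matrix, Nat.card_eq_fintype_card, hK, pow_mul]

lemma cnt_true_succ (q : ℕ) (hK : Fintype.card K = q ^ 2) (hfix : Nat.card {x : K // star x = x} = q)
    (ι : Type) [Fintype ι] [DecidableEq ι] :
    cnt (fun _ : Matrix (Unit ⊕ ι) (Unit ⊕ ι) K => True) =
      q * q ^ (2 * Fintype.card ι) * cnt (fun _ : Matrix ι ι K => True) := by
  rw [cnt_bord]
  simp only [Finset.sum_const, Finset.card_univ, Fintype.card_prod, card_herm1 q hfix,
    card_row q hK, smul_eq_mul]

lemma cnt_true (q : ℕ) (hK : Fintype.card K = q ^ 2) (hfix : Nat.card {x : K // star x = x} = q)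
    (n : ℕ) : cnt (fun _ : Matrix (Fin n) (Fin n) K => True) = q ^ (n ^ 2) := by
  induction n with
  | zero =>
    unfold cnt
    have : Unique {A : Matrix (Fin 0) (Fin 0) K // A.IsHermitian ∧ True} :=
      { default := ⟨1, isHermitian_one, trivial⟩, uniq := fun a => Subsingleton.elim _ _ }
    rw [Nat.card_unique]
    simp
  | succ n ih =>
    rw [cnt_reindex_true (Fintype.equivOfCardEq (by simp [add_comm]) : Fin (n+1) ≃ Unit ⊕ Fin n),
      cnt_true_succ q hK hfix, ih, Fintype.card_fin]
    ring

lemma cnt_erow (q : ℕ) (hK : Fintype.card K = q ^ 2) (hfix : Nat.card {x : K // star x = x} = q)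
    (κ : Type) [Fintype κ] [DecidableEq κ] :
    cnt (fun B : Matrix (Unit ⊕ κ) (Unit ⊕ κ) K => (bord 0 (erow K κ) B).det ≠ 0) =
      q * q ^ (2 * Fintype.card κ) * cnt (fun B : Matrix κ κ K => B.det ≠ 0) := by
  rw [cnt_bord]
  simp only [det_ebord]
  simp only [Finset.sum_const, Finset.card_univ, Fintype.card_prod, card_herm1 q hfix,
    card_row q hK, smul_eq_mul]

lemma sum_ite_zero {α : Type} [Fintype α] [DecidableEq α] (z : α) (c d : ℤ) :
    ∑ a : α, (if a = z then c else d) = c + (Fintype.card α - 1) * d := by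
  have : ∀ a : α, (if a = z then c else d) = d + (if a = z then c - d else 0) := by
    intro a; split_ifs <;> ring
  simp only [this, Finset.sum_add_distrib, Finset.sum_ite_eq', Finset.sum_const, Finset.mem_univ]
  simp
  ring

lemma cnt_succ (q : ℕ) (hK : Fintype.card K = q ^ 2) (hfix : Nat.card {x : K // star x = x} = q)
    (ι : Type) [Fintype ι] [DecidableEq ι] (c : ℕ)
    (hc : ∀ w : Matrix Unit ι K, w ≠ 0 →
      cnt (fun B : Matrix ι ι K => (bord 0 w B).det ≠ 0) = c) :
    (cnt (fun A : Matrix (Unit ⊕ ι) (Unit ⊕ ι) K => A.det ≠ 0) : ℤ) =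
      ((q : ℤ) ^ (2 * Fintype.card ι) - 1) * c +
      (q - 1) * (q ^ (2 * Fintype.card ι) * cnt (fun A : Matrix ι ι K => A.det ≠ 0)) := by
  rw [cnt_bord, Fintype.sum_prod_type]
  push_cast
  have h : ∀ a : {a : Matrix Unit Unit K // a.IsHermitian},
      ∑ w : Matrix Unit ι K, (cnt (fun B => (bord a.1 w B).det ≠ 0) : ℤ) =
      if a = ⟨0, isHermitian_zero⟩ then ((q : ℤ) ^ (2 * Fintype.card ι) - 1) * c
      else (q ^ (2 * Fintype.card ι) * cnt (fun A : Matrix ι ι K => A.det ≠ 0)) := by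
    intro a
    split_ifs with ha
    · subst ha
      have : ∀ w : Matrix Unit ι K, (cnt (fun B => (bord 0 w B).det ≠ 0) : ℤ) =
          if w = 0 then 0 else (c : ℤ) := by
        intro w
        split_ifs with hw
        · subst hw
          rw [cnt_zero]; rfl
        · rw [hc w hw]
      simp only [this]
      rw [sum_ite_zero, card_row q hK]
      push_cast
      ring
    · have ha' : a.1 ≠ 0 := fun h => ha (Subtype.ext h)
      simp only [cnt_corner a.1 a.2 ha', Finset.sum_const, Finset.card_univ, card_row q hK]
      simp
  simp only [h]
  rw [sum_ite_zero, card_herm1 q hfix]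

lemma cnt_det (q : ℕ) (hK : Fintype.card K = q ^ 2) (hfix : Nat.card {x : K // star x = x} = q)
    (n : ℕ) : (cnt (fun A : Matrix (Fin n) (Fin n) K => A.det ≠ 0) : ℤ) =
    ∏ i ∈ Finset.range n, ((q : ℤ) ^ i * ((q : ℤ) ^ (i + 1) + (-1) ^ (i + 1))) := by
  have h0 : cnt (fun A : Matrix (Fin 0) (Fin 0) K => A.det ≠ 0) = 1 := by
    unfold cnt
    have : Unique {A : Matrix (Fin 0) (Fin 0) K // A.IsHermitian ∧ A.det ≠ 0} :=
      { default := ⟨1, isHermitian_one, by simp⟩, uniq := fun a => Subsingleton.elim _ _ }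
    rw [Nat.card_unique]
  induction n using Nat.twoStepInduction with
  | zero => rw [h0]; simp
  | one =>
    rw [cnt_reindex (Fintype.equivOfCardEq (by simp) : Fin 1 ≃ Unit ⊕ Fin 0),
      cnt_succ q hK hfix (Fin 0) 0 (fun w hw => (hw (by ext i j; exact j.elim0)).elim), h0]
    simp
    ring
  | more n ih1 ih2 =>
    rw [cnt_reindex (Fintype.equivOfCardEq (by simp; omega) :
        Fin (n + 2) ≃ Unit ⊕ (Unit ⊕ Fin n)),
      cnt_succ q hK hfix (Unit ⊕ Fin n) _
        (fun w hw => (cnt_row w hw).trans (cnt_erow q hK hfix (Fin n))),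
      ← cnt_reindex (Fintype.equivOfCardEq (by simp [add_comm]) : Fin (n + 1) ≃ Unit ⊕ Fin n)]
    push_cast
    rw [ih2, ih1, Finset.prod_range_succ _ (n + 1), Finset.prod_range_succ _ n]
    simp only [Fintype.card_sum, Fintype.card_unit, Fintype.card_fin]
    have hs : ((-1 : ℤ) ^ n) * (-1) ^ n = 1 := by rw [← mul_pow]; simp
    generalize ∏ i ∈ Finset.range n, ((q : ℤ) ^ i * ((q : ℤ) ^ (i + 1) + (-1) ^ (i + 1))) = R
    linear_combination R * (q : ℤ) * ((q : ℤ) ^ n) ^ 2 * hs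

end HermCount

lemma card_fix (q : ℕ) (hq : 2 ≤ q) {K : Type} [Field K] [Fintype K]
    (hcard : Fintype.card K = q ^ 2) : Nat.card {x : K // x ^ q = x} = q := by
  have h := IsCyclic.card_powMonoidHom_ker (G := Kˣ) (q - 1)
  have hg : (Nat.card Kˣ).gcd (q - 1) = q - 1 := by
    rw [Nat.card_units, Nat.card_eq_fintype_card, hcard]
    apply Nat.gcd_eq_right
    exact ⟨q + 1, by rw [mul_comm, ← Nat.sq_sub_sq]⟩
  rw [hg] at h
  have e : {x : K // x ^ q = x} ≃ Option (powMonoidHom (q - 1) : Kˣ →* Kˣ).ker :=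
    { toFun := fun x => if hx : x.1 = 0 then none else some ⟨Units.mk0 x.1 hx, by
        rw [MonoidHom.mem_ker]
        ext
        have := x.2
        have h2 : x.1 ^ (q - 1) * x.1 = 1 * x.1 := by
          rw [← pow_succ, Nat.sub_add_cancel (by omega), this, one_mul]
        simpa using mul_right_cancel₀ hx h2⟩
      invFun := fun o => o.elim ⟨0, zero_pow (by omega)⟩ fun u => ⟨u.1, by
        have := u.2
        rw [MonoidHom.mem_ker] at this
        have h3 := congrArg (Units.val) this
        simp at h3
        calc (u.1 : K) ^ q = (u.1 : K) ^ (q - 1 + 1) := by rw [Nat.sub_add_cancel (by omega)]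
          _ = _ := by rw [pow_succ, h3, one_mul]⟩
      left_inv := by
        intro x
        by_cases hx : x.1 = 0
        · simp [hx]
          exact Subtype.ext hx.symm
        · simp [hx]
      right_inv := by
        rintro (_ | u)
        · simp
        · simp }
  rw [Nat.card_congr e, Finite.card_option, h]
  omega


/-- for a finite field `K` with `q²` elements (`q` a prime power) and the
order-2 automorphism `σ : x ↦ x^q`, the number of `σ`-Hermitian `n × n` matrices over `K`
is `q^{n²}`, and the number of invertible ones is `∏_{i=1}^{n} q^{i−1}(qⁱ + (−1)ⁱ)`
(equivalently, the proportion of Hermitian matrices that are invertible is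
`∏_{i=1}^{n} (1 + (−q)^{−i})`). -/
theorem stmt8 (q : ℕ) (hq : IsPrimePow q) {K : Type} [Field K] [Fintype K]
    (hcard : Fintype.card K = q ^ 2) (n : ℕ) (hn : 1 ≤ n) :
    Nat.card {A : Matrix (Fin n) (Fin n) K // (A.map fun x => x ^ q).transpose = A}
      = q ^ (n ^ 2) ∧
    (Nat.card {A : Matrix (Fin n) (Fin n) K //
        (A.map fun x => x ^ q).transpose = A ∧ A.det ≠ 0} : ℤ)
      = ∏ i ∈ Finset.range n, ((q : ℤ) ^ i * ((q : ℤ) ^ (i + 1) + (-1) ^ (i + 1))) := by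
  have h2 : 2 ≤ q := hq.two_le
  have hadd : ∀ x y : K, (x + y) ^ q = x ^ q + y ^ q := by
    obtain ⟨p, k, hp, hk, rfl⟩ := hq
    haveI : Fact p.Prime := ⟨hp.nat_prime⟩
    haveI : CharP K p := charP_of_card_eq_prime_pow (f := k * 2) (by rw [hcard, pow_mul])
    intro x y
    exact add_pow_char_pow x y p k
  letI : StarRing K :=
    { star := fun x => x ^ q
      star_involutive := fun x => by
        change (x ^ q) ^ q = x
        rw [← pow_mul, ← sq, ← hcard, FiniteField.pow_card]
      star_mul := fun x y => by
        change (x * y) ^ q = y ^ q * x ^ q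
        rw [mul_pow, mul_comm]
      star_add := hadd }
  have hfix : Nat.card {x : K // star x = x} = q := card_fix q h2 hcard
  constructor
  · rw [← HermCount.cnt_true q hcard hfix n]
    exact Nat.card_congr (Equiv.subtypeEquivRight fun A => by
      rw [and_true]; exact Iff.rfl)
  · rw [← HermCount.cnt_det q hcard hfix n]
    rfl
end

section
/- Let n ≥ 1, J ≥ 1, and λ ∈ Sig_n^+. If m_0(λ) + J − n < 0, then Q_{λ/0[n]}(x, xt, …, xt^{J−1}; t) = 0; and if m_0(λ) + J − n ≥ 0, then the following identity holds in ℤ[t][x]: (t;t)_{m_0(λ)+J−n} · Q_{λ/0[n]}(x, xt, …, xt^{J−1}; t) = x^{|λ|} · t^{n(λ)} · (t;t)_J, where Q_{λ/0[n]}(x, xt, …, xt^{J−1}; t) denotes the result of substituting x_i = x·t^{i−1} into Q_{λ/0[n]}(x_1,…,x_J;t), and m_0(λ) counts the zero parts among the n parts of λ. -/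
open scoped Classical

noncomputable section

/-- Sum of the parts of an integer tuple. -/
def sumz {p : ℕ} (l : Fin p → ℤ) : ℤ := ∑ i, l i

/-- `mcount l c = m_c(l)`, the number of parts of `l` equal to `c`. -/
def mcount {p : ℕ} (l : Fin p → ℤ) (c : ℤ) : ℕ := (Finset.univ.filter fun j => l j = c).card

/-- `l` is a signature: its parts are weakly decreasing. -/
def IsSig {p : ℕ} (l : Fin p → ℤ) : Prop := ∀ i j : Fin p, i ≤ j → l j ≤ l i

/-- `μ ≺_P l`: `l i ≥ μ i ≥ l (i+1)` for all `i`. -/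
def interP {m : ℕ} (μ : Fin m → ℤ) (l : Fin (m + 1) → ℤ) : Prop :=
  ∀ i : Fin m, μ i ≤ l i.castSucc ∧ l i.succ ≤ μ i

/-- `ν ≺_Q l`: `l i ≥ ν i` for all `i`, and `ν i ≥ l (i+1)`. -/
def interQ {n : ℕ} (ν l : Fin n → ℤ) : Prop :=
  (∀ i, ν i ≤ l i) ∧ ∀ i j : Fin n, (j : ℕ) = (i : ℕ) + 1 → l j ≤ ν i

/-- `ψ_{l/μ}(t) = ∏_{i : m_i(μ) = m_i(l) + 1} (1 − t^{m_i(μ)})`. -/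
def psiHL {K : Type} [Field K] {p : ℕ} (t : K) (l : Fin (p + 1) → ℤ) (μ : Fin p → ℤ) : K :=
  ∏ᶠ c : ℤ, if mcount μ c = mcount l c + 1 then 1 - t ^ mcount μ c else 1

/-- `φ_{l/ν}(t) = ∏_{i : m_i(l) = m_i(ν) + 1} (1 − t^{m_i(l)})`. -/
def phiHL {K : Type} [Field K] {p : ℕ} (t : K) (l ν : Fin p → ℤ) : K :=
  ∏ᶠ c : ℤ, if mcount l c = mcount ν c + 1 then 1 - t ^ mcount l c else 1

/-- Skew Hall–Littlewood polynomial `P_{l/μ}(x₁,…,x_k;t)`, via the branching rule, as a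
function of `x : Fin k → K`. -/
def HLP {K : Type} [Field K] {m : ℕ} (t : K) :
    (k : ℕ) → (Fin m → ℤ) → (Fin (m + k) → ℤ) → (Fin k → K) → K
  | 0, μ, l, _ => if μ = l then 1 else 0
  | k + 1, μ, l, x =>
    ∑ᶠ ν : Fin (m + k) → ℤ,
      if interP ν l then
        psiHL t l ν * x (Fin.last k) ^ (sumz l - sumz ν) * HLP t k μ ν fun i => x i.castSucc
      else 0

/-- Skew Hall–Littlewood polynomial `Q_{l/ν}(x₁,…,x_k;t)` (`ν` and `l` both of length `n`),
via the branching rule, as a function of `x : Fin k → K`. -/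
def HLQ {K : Type} [Field K] {n : ℕ} (t : K) :
    (k : ℕ) → (Fin n → ℤ) → (Fin n → ℤ) → (Fin k → K) → K
  | 0, ν, l, _ => if ν = l then 1 else 0
  | k + 1, ν, l, x =>
    ∑ᶠ κ : Fin n → ℤ,
      if interQ κ l then
        phiHL t l κ * x (Fin.last k) ^ (sumz l - sumz κ) * HLQ t k ν κ fun i => x i.castSucc
      else 0

/-- The (non-skew) Hall–Littlewood polynomial `P_l(x₁,…,x_n;t) = P_{l/∅}(x₁,…,x_n;t)`. -/
def HLPfull {K : Type} [Field K] {n : ℕ} (t : K) (l : Fin n → ℤ) (x : Fin n → K) : K :=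
  HLP t n (fun i : Fin 0 => 0) (fun i => l (Fin.cast (Nat.zero_add n) i)) x

/-- `poch t m = (t;t)_m = ∏_{j=1}^m (1 − t^j)`. -/
def poch {K : Type} [Field K] (t : K) (m : ℕ) : K := ∏ j ∈ Finset.range m, (1 - t ^ (j + 1))


/-- Nonnegative-exponent version of `zpow_add`. -/
lemma aux_zpow_add {K : Type} [Field K] (x : K) {a b : ℤ} (ha : 0 ≤ a) (hb : 0 ≤ b) :
    x ^ (a + b) = x ^ a * x ^ b := by
  lift a to ℕ using ha
  lift b to ℕ using hb
  rw [← Nat.cast_add, zpow_natCast, zpow_natCast, zpow_natCast, pow_add]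

lemma aux_zpow_sum {K : Type} [Field K] (x : K) {n : ℕ} (f : Fin n → ℤ) (hf : ∀ i, 0 ≤ f i) :
    x ^ (∑ i, f i) = ∏ i, x ^ (f i) := by
  lift f to Fin n → ℕ using hf
  rw [← Nat.cast_sum, zpow_natCast, ← Finset.prod_pow_eq_pow_sum]
  simp

lemma mcount_sum {p : ℕ} (l : Fin p → ℤ) (c : ℤ) :
    mcount l c = ∑ i, if l i = c then 1 else 0 := by
  unfold mcount
  rw [Finset.card_filter]

lemma mcount_snoc {p : ℕ} (l : Fin p → ℤ) (c d : ℤ) :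
    mcount (Fin.snoc l c : Fin (p + 1) → ℤ) d = mcount l d + if c = d then 1 else 0 := by
  rw [mcount_sum, mcount_sum, Fin.sum_univ_castSucc]
  simp

lemma phi_eq_prod {K : Type} [Field K] {p : ℕ} (t : K) (l ν : Fin p → ℤ) (S : Finset ℤ)
    (hS : ∀ i, l i ∈ S) :
    phiHL t l ν = ∏ c ∈ S, if mcount l c = mcount ν c + 1 then 1 - t ^ mcount l c else 1 := by
  unfold phiHL
  apply finprod_eq_prod_of_mulSupport_subset
  intro c hc
  rw [Function.mem_mulSupport] at hc
  split_ifs at hc with h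
  · have : 0 < mcount l c := by omega
    unfold mcount at this
    rw [Finset.card_pos] at this
    obtain ⟨i, hi⟩ := this
    rw [Finset.mem_filter] at hi
    rw [← hi.2]
    exact hS i
  · exact absurd rfl hc

lemma phi_snoc {K : Type} [Field K] {p : ℕ} (t : K) (l ν : Fin p → ℤ) (c x : ℤ)
    (hx : x ≤ c) (hl : ∀ i, c ≤ l i) (hm : mcount l c ≤ mcount ν c) :
    phiHL t (Fin.snoc l c : Fin (p + 1) → ℤ) (Fin.snoc ν x : Fin (p + 1) → ℤ) =
      phiHL t l ν * if x = c then 1 else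
        if mcount ν c = mcount l c then 1 - t ^ (mcount l c + 1) else 1 := by
  set S : Finset ℤ := insert c (Finset.univ.image l) with hS
  rw [phi_eq_prod t _ _ S, phi_eq_prod t l ν S]
  · have : (if x = c then (1 : K) else
        if mcount ν c = mcount l c then 1 - t ^ (mcount l c + 1) else 1) =
        ∏ d ∈ S, if d = c then (if x = c then (1 : K) else
        if mcount ν c = mcount l c then 1 - t ^ (mcount l c + 1) else 1) else 1 := by
      rw [Finset.prod_ite_eq' S c]
      simp [hS]
    rw [this, ← Finset.prod_mul_distrib]
    apply Finset.prod_congr rfl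
    intro d hd
    rw [mcount_snoc, mcount_snoc]
    by_cases hdc : d = c
    · subst hdc
      by_cases hxd : x = d
      · subst hxd
        have h1 : ¬ (mcount l x = mcount ν x + 1) := by omega
        simp [h1]
      · have h1 : ¬ (mcount l d = mcount ν d + 1) := by omega
        simp only [hxd, h1, if_true, if_false, add_zero, one_mul]
        by_cases h2 : mcount ν d = mcount l d
        · simp [h2]
        · have : ¬ (mcount l d = mcount ν d) := by omega
          simp [h2, this]
    · have hcd : c ≠ d := fun h => hdc h.symm
      have hdge : c ≤ d := by
        rw [hS, Finset.mem_insert, Finset.mem_image] at hd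
        rcases hd with h | ⟨i, _, h⟩
        · omega
        · rw [← h]; exact hl i
      have hxd : x ≠ d := by omega
      simp [hdc, hcd, hxd]
  · intro i
    simp [hS]
  · intro i
    refine Fin.lastCases ?_ (fun j => ?_) i
    · simp [hS]
    · simp [hS]

lemma tele {K : Type} [Field K] (f w : K) (b c : ℤ) (h : b < c) :
    ∑ x ∈ Finset.Icc b c, (if x = c then 1 else f) * w ^ (c - x).toNat *
      (if x = b then 1 else 1 - w) = (1 - w) + f * w := by
  obtain ⟨m, rfl⟩ : ∃ m : ℕ, c = b + (m + 1 : ℕ) := ⟨(c - b - 1).toNat, by omega⟩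
  have : ∑ x ∈ Finset.Icc b (b + (m + 1 : ℕ)),
      (if x = b + (m + 1 : ℕ) then 1 else f) * w ^ (b + (m + 1 : ℕ) - x).toNat *
      (if x = b then 1 else 1 - w) =
      ∑ j ∈ Finset.range (m + 2), (if j = 0 then 1 else f) * w ^ j *
      (if j = m + 1 then 1 else 1 - w) := by
    refine Finset.sum_bij' (fun x _ => (b + (m + 1 : ℕ) - x).toNat)
      (fun j _ => b + (m + 1 : ℕ) - j) ?_ ?_ ?_ ?_ ?_
    · intro x hx
      rw [Finset.mem_Icc] at hx
      rw [Finset.mem_range]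
      omega
    · intro j hj
      rw [Finset.mem_range] at hj
      rw [Finset.mem_Icc]
      omega
    · intro x hx
      rw [Finset.mem_Icc] at hx
      omega
    · intro x hx
      omega
    · intro x hx
      rw [Finset.mem_Icc] at hx
      have h1 : (x = b + (m + 1 : ℕ)) ↔ ((b + (m + 1 : ℕ) - x).toNat = 0) := by omega
      have h2 : (x = b) ↔ ((b + (m + 1 : ℕ) - x).toNat = m + 1) := by omega
      simp only [h1, h2]
  rw [this, Finset.sum_range_succ, Finset.sum_range_succ']
  have h3 : ∑ k ∈ Finset.range m, (if k + 1 = 0 then 1 else f) * w ^ (k + 1) *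
      (if k + 1 = m + 1 then 1 else 1 - w) = f * w * ((1 - w) * ∑ k ∈ Finset.range m, w ^ k) := by
    rw [Finset.mul_sum, Finset.mul_sum]
    apply Finset.sum_congr rfl
    intro k hk
    rw [Finset.mem_range] at hk
    rw [if_neg (by omega), if_neg (by omega)]
    ring
  rw [h3, mul_neg_geom_sum]
  simp
  ring

/-- The finite set of `κ ≺_Q l` with all parts at least `b`. -/
def Tset {p : ℕ} (l : Fin p → ℤ) (b : ℤ) : Finset (Fin p → ℤ) :=
  (Fintype.piFinset fun i => Finset.Icc b (l i)).filter fun κ => interQ κ l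

lemma mem_Tset {p : ℕ} (l : Fin p → ℤ) (b : ℤ) (κ : Fin p → ℤ) :
    κ ∈ Tset l b ↔ interQ κ l ∧ ∀ i, b ≤ κ i := by
  unfold Tset
  rw [Finset.mem_filter, Fintype.mem_piFinset]
  simp only [Finset.mem_Icc]
  constructor
  · rintro ⟨h1, h2⟩
    exact ⟨h2, fun i => (h1 i).1⟩
  · rintro ⟨h1, h2⟩
    exact ⟨fun i => ⟨h2 i, h1.1 i⟩, h1⟩

lemma mem_Tset_snoc {p : ℕ} (l : Fin p → ℤ) (c b : ℤ) (hl : ∀ i, c ≤ l i) (hb : b ≤ c)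
    (κ : Fin p → ℤ) (x : ℤ) :
    (Fin.snoc κ x : Fin (p + 1) → ℤ) ∈ Tset (Fin.snoc l c : Fin (p + 1) → ℤ) b ↔
      κ ∈ Tset l c ∧ x ∈ Finset.Icc b c := by
  rw [mem_Tset, mem_Tset, Finset.mem_Icc]
  constructor
  · rintro ⟨⟨h1, h2⟩, h3⟩
    refine ⟨⟨⟨fun i => by simpa using h1 i.castSucc, fun i j hij => ?_⟩, fun i => ?_⟩, ?_, ?_⟩
    · simpa using h2 i.castSucc j.castSucc (by simpa using hij)
    · by_cases hi : (i : ℕ) + 1 = p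
      · simpa using h2 i.castSucc (Fin.last p) (by simpa using hi.symm)
      · have := h2 i.castSucc (Fin.castSucc ⟨i + 1, by omega⟩) (by simp)
        simp only [Fin.snoc_castSucc] at this
        exact (hl _).trans this
    · simpa using h3 (Fin.last p)
    · simpa using h1 (Fin.last p)
  · rintro ⟨⟨⟨h1, h2⟩, h3⟩, h4, h5⟩
    refine ⟨⟨fun i => ?_, fun i j hij => ?_⟩, fun i => ?_⟩
    · refine Fin.lastCases ?_ (fun j => ?_) i
      · simpa using h5
      · simpa using h1 j
    · revert hij
      refine Fin.lastCases ?_ (fun i' => ?_) i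
      · intro hij
        have := j.2
        simp at hij
        omega
      · refine Fin.lastCases ?_ (fun j' => ?_) j
        · intro _
          simpa using h3 i'
        · intro hij
          simpa using h2 i' j' (by simpa using hij)
    · refine Fin.lastCases ?_ (fun j => ?_) i
      · simpa using h4
      · simpa using hb.trans (h3 j)

lemma sum_Tset_snoc {K : Type} [Field K] {p : ℕ} (l : Fin p → ℤ) (c b : ℤ)
    (hl : ∀ i, c ≤ l i) (hb : b ≤ c) (F : (Fin (p + 1) → ℤ) → K) :
    ∑ κ ∈ Tset (Fin.snoc l c : Fin (p + 1) → ℤ) b, F κ =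
      ∑ κ ∈ Tset l c, ∑ x ∈ Finset.Icc b c, F (Fin.snoc κ x : Fin (p + 1) → ℤ) := by
  rw [← Finset.sum_product']
  refine Finset.sum_bij' (fun κ _ => ((Fin.init κ : Fin p → ℤ), κ (Fin.last p)))
    (fun q _ => (Fin.snoc q.1 q.2 : Fin (p + 1) → ℤ)) ?_ ?_ ?_ ?_ ?_
  · intro κ hκ
    rw [Finset.mem_product]
    rw [← mem_Tset_snoc l c b hl hb]
    simpa using hκ
  · intro q hq
    rw [Finset.mem_product] at hq
    rw [mem_Tset_snoc l c b hl hb]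
    exact hq
  · intro κ _
    simp
  · intro q _
    simp
  · intro κ _
    simp

lemma mcount_le_of_T {p : ℕ} {l κ : Fin p → ℤ} {b : ℤ} (h : κ ∈ Tset l b) :
    mcount l b ≤ mcount κ b := by
  rw [mem_Tset] at h
  unfold mcount
  apply Finset.card_le_card
  intro i hi
  rw [Finset.mem_filter] at hi ⊢
  have h1 := h.1.1 i
  have h2 := h.2 i
  exact ⟨hi.1, by omega⟩

lemma mcount_T_le {p : ℕ} {l κ : Fin p → ℤ} {b : ℤ} (h : κ ∈ Tset l b) (hl : ∀ i, b ≤ l i) :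
    mcount κ b ≤ mcount l b + 1 := by
  rw [mem_Tset] at h
  cases p with
  | zero => simp [mcount]
  | succ m =>
    rw [mcount_sum, mcount_sum, Fin.sum_univ_castSucc, Fin.sum_univ_succ]
    have h1 : ∑ i : Fin m, (if κ i.castSucc = b then 1 else 0) ≤
        ∑ i : Fin m, (if l i.succ = b then 1 else 0) := by
      apply Finset.sum_le_sum
      intro i _
      have h2 := h.1.2 i.castSucc i.succ (by simp)
      have h3 := hl i.succ
      split_ifs <;> omega
    have h4 : (if κ (Fin.last m) = b then 1 else 0) ≤ 1 := by split_ifs <;> omega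
    omega

lemma mcount_eq_zero {p : ℕ} {l : Fin p → ℤ} {b : ℤ} (h : ∀ i, b < l i) : mcount l b = 0 := by
  unfold mcount
  rw [Finset.card_eq_zero, Finset.filter_eq_empty_iff]
  intro i _
  have := h i
  omega

lemma core {K : Type} [Field K] (t : K) (J k : ℕ) : ∀ (l : Fin k → ℤ) (b : ℤ), IsSig l →
    (∀ i, b ≤ l i) → k ≤ J + 1 + mcount l b →
    ∑ κ ∈ Tset l b, phiHL t l κ * (∏ i : Fin k, (t ^ (J - (i : ℕ))) ^ (l i - κ i).toNat) *
      (if mcount κ b = mcount l b then 1 - t ^ (J + 1 + mcount l b - k) else 1)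
      = 1 - t ^ (J + 1) := by
  induction k with
  | zero =>
    intro l b _ _ _
    have hT : Tset l b = {l} := by
      ext κ
      rw [mem_Tset, Finset.mem_singleton]
      constructor
      · intro _
        exact Subsingleton.elim _ _
      · intro _
        exact ⟨⟨fun i => i.elim0, fun i => i.elim0⟩, fun i => i.elim0⟩
    rw [hT, Finset.sum_singleton, phi_eq_prod t l l ∅ (fun i => i.elim0)]
    simp [mcount]
  | succ k ih =>
    intro l' b hsig hb hk
    obtain ⟨l, c, rfl⟩ : ∃ (l : Fin k → ℤ) (c : ℤ), l' = (Fin.snoc l c : Fin (k + 1) → ℤ) :=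
      ⟨Fin.init l', l' (Fin.last k), by simp⟩
    have hl : ∀ i, c ≤ l i := fun i => by
      simpa using hsig i.castSucc (Fin.last k) (Fin.le_last _)
    have hbc : b ≤ c := by simpa using hb (Fin.last k)
    have hsl : IsSig l := fun i j hij => by
      simpa using hsig i.castSucc j.castSucc (by simpa using hij)
    rw [mcount_snoc] at hk
    have hmb : b < c → mcount l b = 0 := fun h => mcount_eq_zero fun i => h.trans_le (hl i)
    have hk' : k ≤ J + 1 + mcount l c := by
      by_cases h : c = b
      · subst h
        simp at hk
        omega
      · have := hmb (by omega)
        simp [h] at hk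
        omega
    rw [sum_Tset_snoc l c b hl hbc, ← ih l c hsl hl hk']
    apply Finset.sum_congr rfl
    intro κ hκ
    have hm := mcount_le_of_T hκ
    have hκ' := (mem_Tset _ _ _).1 hκ
    set P := ∏ i : Fin k, (t ^ (J - (i : ℕ))) ^ (l i - κ i).toNat with hP
    by_cases h : b = c
    · subst h
      rw [Finset.Icc_self, Finset.sum_singleton, phi_snoc t l κ b b le_rfl hl hm,
        Fin.prod_univ_castSucc, mcount_snoc, mcount_snoc]
      have : J + 1 + (mcount l b + 1) - (k + 1) = J + 1 + mcount l b - k := by omega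
      simp [this, ← hP]
    · have hlt : b < c := by omega
      have h0 := hmb hlt
      have h0' : mcount κ b = 0 := mcount_eq_zero fun i => hlt.trans_le (hκ'.2 i)
      have hcb : ¬ c = b := by omega
      rw [h0] at hk
      simp only [hcb, if_false] at hk
      set f : K := if mcount κ c = mcount l c then 1 - t ^ (mcount l c + 1) else 1 with hf
      have : ∀ x ∈ Finset.Icc b c,
          phiHL t (Fin.snoc l c : Fin (k + 1) → ℤ) (Fin.snoc κ x : Fin (k + 1) → ℤ) *
          (∏ i : Fin (k + 1), (t ^ (J - (i : ℕ))) ^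
            ((Fin.snoc l c : Fin (k + 1) → ℤ) i - (Fin.snoc κ x : Fin (k + 1) → ℤ) i).toNat) *
          (if mcount (Fin.snoc κ x : Fin (k + 1) → ℤ) b =
              mcount (Fin.snoc l c : Fin (k + 1) → ℤ) b then
            1 - t ^ (J + 1 + mcount (Fin.snoc l c : Fin (k + 1) → ℤ) b - (k + 1)) else 1) =
          phiHL t l κ * P * ((if x = c then 1 else f) * (t ^ (J - k)) ^ (c - x).toNat *
            (if x = b then 1 else 1 - t ^ (J - k))) := by
        intro x hx
        rw [Finset.mem_Icc] at hx
        rw [phi_snoc t l κ c x hx.2 hl hm, Fin.prod_univ_castSucc, mcount_snoc, mcount_snoc,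
          h0, h0']
        have e : J + 1 + (0 + 0) - (k + 1) = J - k := by omega
        simp only [hcb, if_false, e, Fin.snoc_castSucc, Fin.snoc_last, Fin.val_castSucc,
          Fin.val_last, ← hP, ← hf]
        by_cases hxb : x = b
        · simp [hxb]
          ring
        · simp [hxb]
          ring
      rw [Finset.sum_congr rfl this, ← Finset.mul_sum, tele _ _ _ _ hlt]
      congr 1
      rw [hf]
      split_ifs with h1
      · have e : J + 1 + mcount l c - k = (J - k) + (mcount l c + 1) := by omega
        rw [e, pow_add]
        ring
      · ring

lemma HLQ_neg {K : Type} [Field K] (t : K) {n : ℕ} (k : ℕ) : ∀ (l : Fin n → ℤ) (x : Fin k → K),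
    (∃ i, l i < 0) → HLQ t k (fun _ => 0) l x = 0 := by
  induction k with
  | zero =>
    rintro l x ⟨i, hi⟩
    rw [HLQ, if_neg]
    rintro rfl
    exact lt_irrefl _ hi
  | succ k ih =>
    rintro l x ⟨i, hi⟩
    rw [HLQ]
    have : ∀ κ : Fin n → ℤ, (if interQ κ l then
        phiHL t l κ * x (Fin.last k) ^ (sumz l - sumz κ) *
          HLQ t k (fun _ => 0) κ fun i => x i.castSucc
      else 0) = 0 := by
      intro κ
      split_ifs with h
      · rw [ih κ _ ⟨i, (h.1 i).trans_lt hi⟩, mul_zero]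
      · rfl
    simp only [this, finsum_zero]

/-- Falling product `∏_{i<ℓ} (1 - t^{J-i})` (zero when `ℓ > J`). -/
def Fall {K : Type} [Field K] (t : K) (J ℓ : ℕ) : K := ∏ i ∈ Finset.range ℓ, (1 - t ^ (J - i))

lemma Fall_zero {K : Type} [Field K] (t : K) (J ℓ : ℕ) (h : J < ℓ) : Fall t J ℓ = 0 := by
  unfold Fall
  apply Finset.prod_eq_zero (Finset.mem_range.2 h)
  simp

lemma Fall_succ {K : Type} [Field K] (t : K) (J ℓ : ℕ) :
    Fall t (J + 1) (ℓ + 1) = (1 - t ^ (J + 1)) * Fall t J ℓ := by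
  unfold Fall
  rw [Finset.prod_range_succ', mul_comm]
  simp

lemma Fall_poch {K : Type} [Field K] (t : K) (J ℓ : ℕ) (h : ℓ ≤ J) :
    poch t (J - ℓ) * Fall t J ℓ = poch t J := by
  induction ℓ with
  | zero => simp [Fall]
  | succ ℓ ih =>
    rw [← ih (by omega)]
    unfold Fall poch
    have e : J - ℓ = (J - (ℓ + 1)) + 1 := by omega
    rw [Finset.prod_range_succ, e, Finset.prod_range_succ]
    have e : J - (ℓ + 1) + 1 = J - ℓ := by omega
    rw [e]
    ring

lemma mcount_le {p : ℕ} (l : Fin p → ℤ) (c : ℤ) : mcount l c ≤ p := by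
  unfold mcount
  exact (Finset.card_le_univ _).trans (by simp)

lemma mcount_full {p : ℕ} (l : Fin p → ℤ) (c : ℤ) (h : p ≤ mcount l c) (i : Fin p) :
    l i = c := by
  have h1 : (Finset.univ.filter fun j => l j = c) = Finset.univ := by
    apply Finset.eq_univ_of_card
    have := mcount_le l c
    unfold mcount at *
    simp
    omega
  have : i ∈ (Finset.univ.filter fun j => l j = c) := by rw [h1]; simp
  simpa using this

lemma lt_len {p : ℕ} (l : Fin p → ℤ) (hsig : IsSig l) (hpos : ∀ i, 0 ≤ l i) (i : Fin p)
    (h : l i ≠ 0) : (i : ℕ) + 1 + mcount l 0 ≤ p := by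
  have h1 : (Finset.univ.filter fun j => l j = 0) ⊆ Finset.Ioi i := by
    intro j hj
    rw [Finset.mem_filter] at hj
    rw [Finset.mem_Ioi]
    by_contra hc
    have h2 := hsig j i (not_lt.1 hc)
    have h3 := hpos i
    omega
  have h2 := Finset.card_le_card h1
  rw [Fin.card_Ioi] at h2
  unfold mcount
  have := i.2
  omega

lemma expo {K : Type} [Field K] (t : K) {n : ℕ} (J : ℕ) (l κ : Fin n → ℤ)
    (h0 : ∀ i, 0 ≤ κ i) (h1 : ∀ i, κ i ≤ l i) (h2 : ∀ i : Fin n, (i : ℕ) ≤ J ∨ l i = 0) :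
    (t ^ J) ^ (sumz l - sumz κ) * t ^ (∑ i : Fin n, (i : ℤ) * κ i) =
      t ^ (∑ i : Fin n, (i : ℤ) * l i) *
        ∏ i : Fin n, (t ^ (J - (i : ℕ))) ^ (l i - κ i).toNat := by
  unfold sumz
  rw [← Finset.sum_sub_distrib, aux_zpow_sum _ _ (fun i => sub_nonneg.2 (h1 i)),
    aux_zpow_sum _ _ (fun i => mul_nonneg (Int.natCast_nonneg _) (h0 i)),
    aux_zpow_sum _ _ (fun i => mul_nonneg (Int.natCast_nonneg _) ((h0 i).trans (h1 i))),
    ← Finset.prod_mul_distrib, ← Finset.prod_mul_distrib]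
  apply Finset.prod_congr rfl
  intro i _
  have a0 := h0 i
  have a1 := h1 i
  have a2 := h2 i
  obtain ⟨k, hk⟩ := Int.eq_ofNat_of_zero_le a0
  obtain ⟨d, hd⟩ := Int.eq_ofNat_of_zero_le (sub_nonneg.2 a1)
  have hl : l i = ((k + d : ℕ) : ℤ) := by push_cast; omega
  rw [hd, hk, hl, Int.toNat_natCast, ← Nat.cast_mul, ← Nat.cast_mul]
  simp only [zpow_natCast]
  rw [← pow_mul, ← pow_mul, ← pow_add, ← pow_add]
  congr 1
  rcases a2 with h | h
  · obtain ⟨e, rfl⟩ := Nat.exists_eq_add_of_le h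
    rw [Nat.add_sub_cancel_left]
    ring
  · have : k = 0 ∧ d = 0 := by omega
    rw [this.1, this.2]
    simp

lemma main_formula {K : Type} [Field K] (t xx : K) (n J : ℕ) : ∀ (l : Fin n → ℤ), IsSig l →
    (∀ i, 0 ≤ l i) → HLQ t J (fun _ => 0) l (fun i => xx * t ^ (i : ℕ)) =
      xx ^ sumz l * t ^ (∑ i : Fin n, (i : ℤ) * l i) * Fall t J (n - mcount l 0) := by
  induction J with
  | zero =>
    intro l hsig hpos
    rw [HLQ]
    split_ifs with h
    · subst h
      simp [sumz, mcount, Fall]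
    · rw [Fall_zero, mul_zero]
      by_contra hc
      apply h
      funext i
      exact (mcount_full l 0 (by omega) i).symm
  | succ J ih =>
    intro l hsig hpos
    rw [HLQ]
    have hsupp : ∑ᶠ κ : Fin n → ℤ, (if interQ κ l then
        phiHL t l κ * (xx * t ^ ((Fin.last J : Fin (J + 1)) : ℕ)) ^ (sumz l - sumz κ) *
          HLQ t J (fun _ => 0) κ (fun i => xx * t ^ ((i.castSucc : Fin (J + 1)) : ℕ))
        else 0) = ∑ κ ∈ Tset l 0, phiHL t l κ * (xx * t ^ J) ^ (sumz l - sumz κ) *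
          (xx ^ sumz κ * t ^ (∑ i : Fin n, (i : ℤ) * κ i) * Fall t J (n - mcount κ 0)) := by
      rw [finsum_eq_sum_of_support_subset (s := Tset l 0)]
      · apply Finset.sum_congr rfl
        intro κ hκ
        rw [mem_Tset] at hκ
        rw [if_pos hκ.1]
        have hs : IsSig κ := by
          intro i j hij
          rcases hij.eq_or_lt with h | h
          · rw [h]
          · have h' : (i : ℕ) < j := h
            have h1 := hκ.1.2 i ⟨i + 1, by omega⟩ rfl
            have h2 := hsig ⟨i + 1, by omega⟩ j (by rw [Fin.le_def]; exact h')
            have h3 := hκ.1.1 j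
            omega
        rw [← ih κ hs hκ.2]
        simp
      · intro κ hκ
        rw [Function.mem_support] at hκ
        rw [Finset.mem_coe, mem_Tset]
        split_ifs at hκ with h
        · refine ⟨h, ?_⟩
          by_contra hc
          push Not at hc
          rw [HLQ_neg t J κ _ hc, mul_zero] at hκ
          exact hκ rfl
        · exact absurd rfl hκ
    rw [hsupp]
    have hxx : ∀ κ ∈ Tset l 0, (xx * t ^ J) ^ (sumz l - sumz κ) * xx ^ sumz κ =
        xx ^ sumz l * (t ^ J) ^ (sumz l - sumz κ) := by
      intro κ hκ
      rw [mem_Tset] at hκ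
      have h1 : 0 ≤ sumz κ := Finset.sum_nonneg fun i _ => hκ.2 i
      have h2 : sumz κ ≤ sumz l := Finset.sum_le_sum fun i _ => hκ.1.1 i
      have h3 : xx ^ sumz l = xx ^ (sumz l - sumz κ) * xx ^ sumz κ := by
        rw [← aux_zpow_add xx (sub_nonneg.2 h2) h1, sub_add_cancel]
      rw [mul_zpow, h3]
      ring
    rcases Nat.eq_zero_or_pos (n - mcount l 0) with hz | hz
    · have hl0 : l = fun _ => 0 := funext fun i => mcount_full l 0 (by omega) i
      have hT : Tset l 0 = {l} := by
        ext κ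
        rw [mem_Tset, Finset.mem_singleton]
        constructor
        · rintro ⟨h1, h2⟩
          funext i
          have a1 := h1.1 i
          have a2 := h2 i
          have a3 := congrFun hl0 i
          omega
        · rintro rfl
          exact ⟨⟨fun i => le_rfl, fun i j _ => hsig i j (by rw [Fin.le_def]; omega)⟩, hpos⟩
      have hphi : phiHL t l l = 1 := by
        unfold phiHL
        simp
      rw [hT, Finset.sum_singleton, hphi, hz]
      simp [Fall]
    · obtain ⟨m, hm⟩ : ∃ m, n - mcount l 0 = m + 1 := ⟨n - mcount l 0 - 1, by omega⟩
      rw [hm, Fall_succ]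
      have hFall : ∀ κ ∈ Tset l 0, Fall t J (n - mcount κ 0) = Fall t J m *
          (if mcount κ 0 = mcount l 0 then 1 - t ^ (J + 1 + mcount l 0 - n) else 1) := by
        intro κ hκ
        have h1 := mcount_le_of_T hκ
        have h2 := mcount_T_le hκ hpos
        split_ifs with h
        · rw [h, hm, Fall, Fall, Finset.prod_range_succ]
          have : J - m = J + 1 + mcount l 0 - n := by omega
          rw [this]
        · have : n - mcount κ 0 = m := by omega
          rw [this, mul_one]
      by_cases hJ : J < m
      · rw [Fall_zero t J m hJ, mul_zero, mul_zero]
        apply Finset.sum_eq_zero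
        intro κ hκ
        rw [hFall κ hκ, Fall_zero t J m hJ]
        simp
      · rw [← core t J n l 0 hsig hpos (by omega), Finset.sum_mul, Finset.mul_sum]
        apply Finset.sum_congr rfl
        intro κ hκ
        have hκ' := (mem_Tset _ _ _).1 hκ
        have he := expo t J l κ hκ'.2 hκ'.1.1 (fun i => by
          by_cases hi : l i = 0
          · exact Or.inr hi
          · left
            have := lt_len l hsig hpos i hi
            omega)
        rw [hFall κ hκ]
        have hx := hxx κ hκ
        generalize (if mcount κ 0 = mcount l 0 then 1 - t ^ (J + 1 + mcount l 0 - n) else 1) = g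
        calc phiHL t l κ * (xx * t ^ J) ^ (sumz l - sumz κ) *
              (xx ^ sumz κ * t ^ (∑ i : Fin n, (i : ℤ) * κ i) * (Fall t J m * g))
            = phiHL t l κ * ((xx * t ^ J) ^ (sumz l - sumz κ) * xx ^ sumz κ) *
              (t ^ (∑ i : Fin n, (i : ℤ) * κ i) * (Fall t J m * g)) := by ring
          _ = phiHL t l κ * xx ^ sumz l * ((t ^ J) ^ (sumz l - sumz κ) *
              t ^ (∑ i : Fin n, (i : ℤ) * κ i)) * (Fall t J m * g) := by rw [hx]; ring
          _ = _ := by rw [he]; ring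

/-- principal specialization of `Q`: for `λ ∈ Sig_n⁺` and `J ≥ 1`,
`Q_{λ/0[n]}(x, xt, …, xt^{J−1}; t)` vanishes if `m₀(λ) + J − n < 0`, and otherwise
`(t;t)_{m₀(λ)+J−n} · Q_{λ/0[n]}(x, xt, …, xt^{J−1}; t) = x^{|λ|} t^{n(λ)} (t;t)_J`,
as identities in `ℤ[t][x]` (formalized as holding over every field). -/
theorem stmt12 (n J : ℕ) (hn : 1 ≤ n) (hJ : 1 ≤ J)
    (l : Fin n → ℤ) (hsig : IsSig l) (hpos : ∀ i, 0 ≤ l i)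
    (K : Type) [Field K] (t xx : K) :
    ((mcount l 0 + J : ℤ) < (n : ℤ) →
      HLQ t J (fun _ => 0) l (fun i => xx * t ^ (i : ℕ)) = 0) ∧
    ((n : ℤ) ≤ (mcount l 0 + J : ℤ) →
      poch t (mcount l 0 + J - n) * HLQ t J (fun _ => 0) l (fun i => xx * t ^ (i : ℕ))
        = xx ^ sumz l * t ^ (∑ i : Fin n, (i : ℤ) * l i) * poch t J) := by
  rw [main_formula t xx n J l hsig hpos]
  have hle := mcount_le l 0
  constructor
  · intro h
    rw [Fall_zero _ _ _ (by omega), mul_zero]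
  · intro h
    have e : mcount l 0 + J - n = J - (n - mcount l 0) := by omega
    rw [e, ← Fall_poch t J (n - mcount l 0) (by omega)]
    ring

end
end

section
/- Fix n ≥ 1 and ν, λ ∈ Sig_n. For each μ ∈ Sig_n^+, let (c_{ν,μ}^κ(t))_{κ ∈ Sig_n} be the unique finitely supported family of polynomials in ℤ[t] such that P_ν(x_1,…,x_n;t) · P_μ(x_1,…,x_n;t) = ∑_{κ ∈ Sig_n} c_{ν,μ}^κ(t) · P_κ(x_1,…,x_n;t) as Laurent polynomials. Then for every m ≥ 1, ∑_{μ ∈ Sig_n^+} c_{ν,μ}^λ(t) · Q_{μ/0[n]}(x_1,…,x_m;t) = Q_{λ/ν}(x_1,…,x_m;t), where only finitely many summands are nonzero (c_{ν,μ}^λ = 0 unless |μ| = |λ| − |ν|). -/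
open scoped Classical

noncomputable section

open PowerSeries in
def wt {K : Type} [Field K] (α β : K) (N M N' M' : ℕ) (x y : Bool) : K :=
  if M' ≤ N' + y.toNat ∧ N' + y.toNat ≤ M' + 1 then
    (if x = false ∧ y = true then α else 1) * (if N + x.toNat = M + 1 ∧ N' + y.toNat = M' then β else 1)
  else 0

def wL {K : Type} [Field K] (t : K) (N M : ℕ → ℕ) (j : ℕ) (x y : Bool) : K :=
  wt (1 - t ^ (N (j+1) - N j + 1)) (1 - t ^ (M (j+1) - M j)) (N j) (M j) (N (j+1)) (M (j+1)) x y

def wR {K : Type} [Field K] (t : K) (N M : ℕ → ℕ) (j : ℕ) (x y : Bool) : K :=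
  wt (1 - t ^ (M (j+1) - M j)) (1 - t ^ (N (j+1) - N j + 1)) (N j) (M j) (N (j+1)) (M (j+1)) x y

def tv {K : Type} [Field K] (w : ℕ → Bool → Bool → K) (v0 v1 : PowerSeries K) :
    ℕ → Bool → PowerSeries K
  | 0, y => cond y v1 v0
  | j + 1, y => PowerSeries.X ^ y.toNat *
      (PowerSeries.C (w j false y) * tv w v0 v1 j false + PowerSeries.C (w j true y) * tv w v0 v1 j true)

theorem tv_inter {K : Type} [Field K] (t : K) (N M : ℕ → ℕ) (hN : Monotone N) (hM : Monotone M)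
    (hN0 : N 0 = 0) (hM0 : M 0 = 0) (U R : ℕ → Bool → PowerSeries K)
    (hU : U = tv (wL t N M) (1 - PowerSeries.X) (PowerSeries.C (1 - t) * PowerSeries.X))
    (hR : R = tv (wR t N M) 1 0) (j : ℕ) :
    (∀ y : Bool, ¬ (M j ≤ N j + y.toNat ∧ N j + y.toNat ≤ M j + 1) → U j y = 0 ∧ R j y = 0) ∧
    (N j = M j → U j false = (1 - PowerSeries.X) * R j false + PowerSeries.C (1 - t) * R j true ∧
      U j true = PowerSeries.X * PowerSeries.C (1 - t) * R j false
        + PowerSeries.C t * (1 - PowerSeries.X) * R j true) ∧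
    (N j ≠ M j → ∀ y, U j y = (1 - PowerSeries.C t * PowerSeries.X) * R j y) := by
  induction j with
  | zero =>
    refine ⟨?_, ?_, ?_⟩
    · intro y hy; exfalso; apply hy; cases y <;> simp [hN0, hM0]
    · intro _; subst hU hR; simp [tv]; ring
    · intro h; simp [hN0, hM0] at h
  | succ j ih =>
    have hUs : ∀ y, U (j+1) y = PowerSeries.X ^ y.toNat *
      (PowerSeries.C (wL t N M j false y) * U j false + PowerSeries.C (wL t N M j true y) * U j true) := by
      intro y; subst hU; rfl
    have hRs : ∀ y, R (j+1) y = PowerSeries.X ^ y.toNat *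
      (PowerSeries.C (wR t N M j false y) * R j false + PowerSeries.C (wR t N M j true y) * R j true) := by
      intro y; subst hR; rfl
    have h1 := hN (Nat.le_succ j)
    have h2 := hM (Nat.le_succ j)
    simp only [hUs, hRs, wL, wR]
    clear hUs hRs hU hR
    simp only [Nat.succ_eq_add_one] at h1 h2
    obtain ⟨ih1, ih2, ih3⟩ := ih
    generalize N (j+1) = n' at *
    generalize M (j+1) = m' at *
    generalize N j = n at *
    generalize M j = m at *
    generalize U j = u at *
    generalize R j = r at *
    obtain ⟨p, rfl⟩ := Nat.exists_eq_add_of_le h1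
    obtain ⟨q, rfl⟩ := Nat.exists_eq_add_of_le h2
    simp only [Nat.add_sub_cancel_left]
    refine ⟨?_, ?_, ?_⟩
    · intro y hy
      simp [wt, hy]
    · intro hd
      by_cases c0 : n = m
      · have hpq : p = q := by omega
        subst hpq; subst c0
        obtain ⟨e0, e1⟩ := ih2 rfl
        rw [e0, e1]
        constructor <;> simp [wt, pow_succ] <;> ring
      · have e := ih3 c0
        rw [e, e]
        by_cases c1 : n = m + 1
        · subst c1
          have hpq : q = p + 1 := by omega
          subst hpq
          have z := (ih1 true (by simp)).2
          rw [z]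
          constructor
          · simp [wt, show m + 1 + p = m + (p + 1) by omega]; ring
          · simp [wt, show m + 1 + p = m + (p + 1) by omega]; ring
        · by_cases c2 : m = n + 1
          · subst c2
            have hpq : p = q + 1 := by omega
            subst hpq
            have z := (ih1 false (by simp)).2
            rw [z]
            constructor
            · simp [wt, show n + 1 + q = n + (q + 1) by omega]; ring
            · simp [wt, show n + 1 + q = n + (q + 1) by omega]; ring
          · have z := (ih1 true (by simp; omega)).2
            have z' := (ih1 false (by simp; omega)).2
            simp [z, z']
    · intro hd y
      by_cases v : (m + q ≤ n + p + y.toNat ∧ n + p + y.toNat ≤ m + q + 1)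
      swap
      · simp [wt, v]
      by_cases c0 : n = m
      · subst c0
        obtain ⟨e0, e1⟩ := ih2 rfl
        rw [e0, e1]
        cases y
        · simp at v
          have : p = q + 1 := by omega
          subst this
          simp [wt, ← add_assoc]; ring
        · simp at v
          have : q = p + 1 := by omega
          subst this
          simp [wt, add_assoc]; ring
      · have e := ih3 c0
        rw [e, e]
        by_cases c1 : n = m + 1
        · subst c1
          have z := (ih1 true (by simp)).2
          rw [z]
          simp only [wt, v]
          cases y
          · simp at v
            have : p = q := by omega
            subst this
            simp
          · simp at v
            have : q = p + 2 := by omega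
            subst this
            rw [show m + 1 + p + Bool.toNat true = m + (p + 2) by simp; omega]; simp; ring
        · by_cases c2 : m = n + 1
          · subst c2
            have z := (ih1 false (by simp)).2
            rw [z]
            simp only [wt, v]
            cases y
            · simp at v
              have : p = q + 2 := by omega
              subst this
              simp
            · simp at v
              have : q = p := by omega
              subst this
              simp [add_assoc]; ring
          · have z := (ih1 true (by simp; omega)).2
            have z' := (ih1 false (by simp; omega)).2
            simp [z, z']

theorem tv_add {K : Type} [Field K] (w : ℕ → Bool → Bool → K) (a b v0 v1 v0' v1' : PowerSeries K) (j : ℕ) (y) :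
    tv w (a * v0 + b * v0') (a * v1 + b * v1') j y = a * tv w v0 v1 j y + b * tv w v0' v1' j y := by
  induction j generalizing y with
  | zero => cases y <;> simp [tv]
  | succ j ih => simp only [tv, ih]; ring

/-- the error term is divisible by a high power -/
theorem tv_err {K : Type} [Field K] (t : K) (N M : ℕ → ℕ) (hM : Monotone M)
    (v : PowerSeries K) (hv : PowerSeries.X ∣ v) (r : ℕ) (hr : ∀ j ≤ r, N j = 0) (j : ℕ) (hj : j ≤ r) :
    tv (wL t N M) 0 v j false = 0 ∧ PowerSeries.X ^ (j + 1) ∣ tv (wL t N M) 0 v j true := by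
  induction j with
  | zero => simpa [tv] using hv
  | succ j ih =>
    obtain ⟨i1, i2⟩ := ih (by omega)
    have n1 := hr (j+1) hj
    have n0 := hr j (by omega)
    have h2 := hM (Nat.le_succ j)
    simp only [Nat.succ_eq_add_one] at h2
    constructor
    · have : wL t N M j true false = 0 := by
        simp only [wL, wt, n1, n0]
        by_cases h : M (j+1) = 0
        · have h' : M j = 0 := by omega
          simp [h, h']
        · have : ¬ (M (j+1) ≤ 0) := by omega
          simp [this]
      simp [tv, i1, this]
    · simp only [tv, i1]
      simp
      rw [pow_succ' _ (j+1)]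
      exact mul_dvd_mul_left _ (Dvd.dvd.mul_left i2 _)

theorem tv_dvd {K : Type} [Field K] (w : ℕ → Bool → Bool → K) (v0 v1 D : PowerSeries K) (r : ℕ)
    (h : ∀ y, D ∣ tv w v0 v1 r y) (k : ℕ) : ∀ y, D ∣ tv w v0 v1 (r + k) y := by
  induction k with
  | zero => simpa using h
  | succ k ih =>
    intro y
    rw [← add_assoc]
    simp only [tv]
    exact Dvd.dvd.mul_left (dvd_add (Dvd.dvd.mul_left (ih _) _) (Dvd.dvd.mul_left (ih _) _)) _

def hh {K : Type} [Field K] (t : K) (k : ℕ) : K := if k = 0 then 1 else 1 - t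

theorem tv_coeff {K : Type} [Field K] (t : K) (N M : ℕ → ℕ) (hN : Monotone N) (hM : Monotone M)
    (hN0 : N 0 = 0) (hM0 : M 0 = 0) (r J : ℕ) (hr : ∀ j ≤ r, N j = 0) (hrJ : r ≤ J)
    (hJ : N J = M J + 1) :
    PowerSeries.coeff r (tv (wL t N M) 1 0 J false) =
     ∑ ks ∈ Finset.HasAntidiagonal.antidiagonal r, hh t ks.1 * PowerSeries.coeff ks.2 (tv (wR t N M) 1 0 J false) := by
  have h1 := (tv_inter t N M hN hM hN0 hM0 _ _ rfl rfl J).2.2 (by omega) false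
  have h2 := tv_add (wL t N M) (1 - PowerSeries.X) 1 1 0 0 (PowerSeries.C (1 - t) * PowerSeries.X) J false
  simp only [mul_one, mul_zero, add_zero, zero_add, one_mul] at h2
  rw [h2] at h1
  have h3 : PowerSeries.X ^ (r+1) ∣ tv (wL t N M) 0 (PowerSeries.C (1 - t) * PowerSeries.X) J false := by
    have e := tv_err t N M hM (PowerSeries.C (1 - t) * PowerSeries.X) (Dvd.intro_left _ rfl) r hr r le_rfl
    obtain ⟨k, rfl⟩ := Nat.exists_eq_add_of_le hrJ
    apply tv_dvd
    intro y
    cases y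
    · rw [e.1]; exact dvd_zero _
    · exact e.2
  have hH : (1 - PowerSeries.X) * PowerSeries.mk (hh t) = 1 - PowerSeries.C t * PowerSeries.X := by
    ext k
    rw [sub_mul, one_mul]
    cases k with
    | zero => simp [hh]
    | succ k =>
      rw [map_sub, map_sub, PowerSeries.coeff_succ_X_mul, PowerSeries.coeff_succ_mul_X]
      cases k with
      | zero => simp [hh]
      | succ k => simp [hh, PowerSeries.coeff_one, PowerSeries.coeff_C]
  have h4 : PowerSeries.X ^ (r+1) ∣ tv (wL t N M) 1 0 J false - PowerSeries.mk (hh t) * tv (wR t N M) 1 0 J false := by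
    have hu : IsUnit (1 - PowerSeries.X : PowerSeries K) := by
      rw [PowerSeries.isUnit_iff_constantCoeff]; simp
    rw [← hu.dvd_mul_left]
    rw [mul_sub, ← mul_assoc, hH, ← h1]
    simpa using h3
  rw [PowerSeries.X_pow_dvd_iff] at h4
  have := h4 r (by omega)
  rw [map_sub, sub_eq_zero] at this
  rw [this, PowerSeries.coeff_mul]
  simp

def st (S : Finset ℕ) : ℕ → Bool
  | 0 => false
  | i + 1 => decide (i ∈ S)

theorem tv_path {K : Type} [Field K] (w : ℕ → Bool → Bool → K) (j : ℕ) (y : Bool) :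
    tv w 1 0 j y = ∑ S ∈ (Finset.range j).powerset, if st S j = y then
      PowerSeries.C (∏ i ∈ Finset.range j, w i (st S i) (st S (i+1))) * PowerSeries.X ^ S.card else 0 := by
  induction j generalizing y with
  | zero => cases y <;> simp [tv, st]
  | succ j ih =>
    rw [Finset.range_add_one, Finset.sum_powerset_insert Finset.notMem_range_self]
    have e1 : ∀ S ∈ (Finset.range j).powerset, st S (j+1) = false := by
      intro S hS
      have : j ∉ S := fun h => by simpa using (Finset.mem_powerset.1 hS) h
      simp [st, this]
    have e2 : ∀ S ∈ (Finset.range j).powerset, st (insert j S) (j+1) = true := by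
      intro S hS; simp [st]
    have e3 : ∀ S : Finset ℕ, ∀ i ≤ j, st (insert j S) i = st S i := by
      intro S i hi
      cases i with
      | zero => rfl
      | succ i =>
        have : i ≠ j := by omega
        simp [st, this]
    simp only [tv, ih, Finset.mul_sum, ← Finset.sum_add_distrib]
    apply Finset.sum_congr rfl
    intro S hS
    rw [e1 S hS, e2 S hS]
    rw [Finset.prod_insert Finset.notMem_range_self, Finset.prod_insert Finset.notMem_range_self]
    have hjS : j ∉ S := fun h => by simpa using (Finset.mem_powerset.1 hS) h
    rw [Finset.card_insert_of_notMem hjS]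
    have e4 : ∏ i ∈ Finset.range j, w i (st (insert j S) i) (st (insert j S) (i+1))
       = ∏ i ∈ Finset.range j, w i (st S i) (st S (i+1)) := by
      apply Finset.prod_congr rfl
      intro i hi
      have := Finset.mem_range.1 hi
      rw [e3 S i (by omega), e3 S (i+1) (by omega)]
    rw [e4, e3 S j le_rfl, e1 S hS, e2 S hS]
    cases y <;> cases h : st S j <;> simp [pow_succ] <;> ring

theorem tv_path_coeff {K : Type} [Field K] (w : ℕ → Bool → Bool → K) (j : ℕ) (r : ℕ)
    (h : tv w 1 0 j true = 0) :
    PowerSeries.coeff r (tv w 1 0 j false) = ∑ S ∈ (Finset.range j).powerset, if S.card = r then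
      ∏ i ∈ Finset.range j, w i (st S i) (st S (i+1)) else 0 := by
  have : tv w 1 0 j false = tv w 1 0 j false + tv w 1 0 j true := by rw [h, add_zero]
  rw [this, tv_path, tv_path, ← Finset.sum_add_distrib, map_sum]
  apply Finset.sum_congr rfl
  intro S hS
  cases h : st S j <;> simp only [if_true, reduceCtorEq, if_false, add_zero, zero_add, PowerSeries.coeff_C_mul, PowerSeries.coeff_X_pow] <;> simp [eq_comm]

def ht (B : ℤ) {p : ℕ} (l : Fin p → ℤ) (j : ℕ) : ℕ := (Finset.univ.filter fun i => B - j < l i).card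

def Box (p : ℕ) (A B : ℤ) : Finset (Fin p → ℤ) := Fintype.piFinset fun _ => Finset.Icc A B

theorem mem_Box {p : ℕ} {A B : ℤ} {l : Fin p → ℤ} : l ∈ Box p A B ↔ ∀ i, A ≤ l i ∧ l i ≤ B := by
  simp [Box, Fintype.mem_piFinset]

theorem ht_mono (B : ℤ) {p : ℕ} (l : Fin p → ℤ) : Monotone (ht B l) := by
  intro a b h
  apply Finset.card_le_card
  intro i
  simp only [Finset.mem_filter, Finset.mem_univ, true_and]
  omega

theorem ht_zero {A B : ℤ} {p : ℕ} {l : Fin p → ℤ} (h : l ∈ Box p A B) : ht B l 0 = 0 := by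
  rw [mem_Box] at h
  rw [ht, Finset.card_eq_zero, Finset.filter_eq_empty_iff]
  intro i _
  have := h i
  push_cast
  omega

theorem ht_top {A B : ℤ} {p : ℕ} {l : Fin p → ℤ} (h : l ∈ Box p A B) {J : ℕ} (hJ : (J : ℤ) = B - A + 1) :
    ht B l J = p := by
  rw [mem_Box] at h
  rw [ht, Finset.filter_true_of_mem]
  · simp
  · intro i _
    have := h i
    omega

theorem ht_le (B : ℤ) {p : ℕ} (l : Fin p → ℤ) (j : ℕ) : ht B l j ≤ p := by
  have := Finset.card_filter_le (Finset.univ : Finset (Fin p)) (fun i => B - j < l i)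
  simpa [ht] using this

theorem ht_succ (B : ℤ) {p : ℕ} (l : Fin p → ℤ) (j : ℕ) :
    ht B l (j + 1) = ht B l j + mcount l (B - j) := by
  rw [ht, ht, mcount, ← Finset.card_union_of_disjoint]
  · congr 1
    ext i
    simp only [Finset.mem_filter, Finset.mem_univ, true_and, Finset.mem_union]
    push_cast
    omega
  · rw [Finset.disjoint_filter]
    intro i _
    omega

theorem ht_iff (B : ℤ) {p : ℕ} {l : Fin p → ℤ} (hl : IsSig l) (i : Fin p) (j : ℕ) :
    (i : ℕ) < ht B l j ↔ B - j < l i := by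
  constructor
  · intro h
    by_contra hc
    have : ht B l j ≤ (Finset.Iio i).card := by
      apply Finset.card_le_card
      intro k
      simp only [Finset.mem_filter, Finset.mem_univ, true_and, Finset.mem_Iio]
      intro hk
      by_contra hik
      have := hl i k (not_lt.1 hik)
      omega
    rw [Fin.card_Iio] at this
    omega
  · intro h
    have : (Finset.Iic i).card ≤ ht B l j := by
      apply Finset.card_le_card
      intro k
      simp only [Finset.mem_filter, Finset.mem_univ, true_and, Finset.mem_Iic]
      intro hk
      have := hl k i hk
      omega
    rw [Fin.card_Iic] at this
    omega

def inter {p q : ℕ} (μ : Fin p → ℤ) (l : Fin q → ℤ) : Prop :=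
  (∀ (i : Fin p) (j : Fin q), (i : ℕ) = j → μ i ≤ l j) ∧ (∀ (i : Fin p) (j : Fin q), (j : ℕ) = i + 1 → l j ≤ μ i)

theorem interQ_iff {n : ℕ} (ν l : Fin n → ℤ) : interQ ν l ↔ inter ν l := by
  unfold interQ inter
  refine and_congr ⟨?_, ?_⟩ Iff.rfl
  · intro h i j hij
    rw [← Fin.ext hij]; exact h i
  · intro h i; exact h i i rfl

theorem interP_iff {n : ℕ} (ν : Fin n → ℤ) (l : Fin (n+1) → ℤ) : interP ν l ↔ inter ν l := by
  unfold interP inter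
  constructor
  · intro h
    constructor
    · intro i j hij
      have : j = i.castSucc := Fin.ext (by simp [hij])
      rw [this]; exact (h i).1
    · intro i j hij
      have : j = i.succ := Fin.ext (by simp [hij])
      rw [this]; exact (h i).2
  · intro h i
    exact ⟨h.1 i _ rfl, h.2 i _ rfl⟩

theorem isSig_of_succ {p : ℕ} {l : Fin p → ℤ} (h : ∀ i j : Fin p, (j : ℕ) = i + 1 → l j ≤ l i) : IsSig l := by
  have : ∀ (d : ℕ) (i j : Fin p), (j : ℕ) = i + d → l j ≤ l i := by
    intro d
    induction d with
    | zero => intro i j hij; rw [Fin.ext hij]; 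
    | succ d ih =>
      intro i j hij
      have hj := j.2
      have a := ih i ⟨i + d, by omega⟩ rfl
      have b := h ⟨i + d, by omega⟩ j (by simp; omega)
      omega
  intro i j hij
  exact this (j - i) i j (by have : (i : ℕ) ≤ j := hij; omega)

theorem inter_sig_right {p q : ℕ} {μ : Fin p → ℤ} {l : Fin q → ℤ} (hq : q ≤ p + 1) (h : inter μ l) : IsSig l := by
  apply isSig_of_succ
  intro i j hij
  have := j.2
  have a := h.1 ⟨i, by omega⟩ i rfl
  have b := h.2 ⟨i, by omega⟩ j hij
  omega

theorem inter_sig_left {p q : ℕ} {μ : Fin p → ℤ} {l : Fin q → ℤ} (hq : p ≤ q) (h : inter μ l) : IsSig μ := by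
  apply isSig_of_succ
  intro i j hij
  have := j.2
  have a := h.1 j ⟨j, by omega⟩ rfl
  have b := h.2 i ⟨j, by omega⟩ hij
  omega

theorem inter_ht {p q : ℕ} {μ : Fin p → ℤ} {l : Fin q → ℤ} {A B : ℤ} {J : ℕ} (hJ : (J : ℤ) = B - A + 1)
    (hpq : p ≤ q) (hqp : q ≤ p + 1) (hμ : IsSig μ) (hl : IsSig l) (bμ : μ ∈ Box p A B) (bl : l ∈ Box q A B) :
    inter μ l ↔ ∀ j ≤ J, ht B μ j ≤ ht B l j ∧ ht B l j ≤ ht B μ j + 1 := by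
  rw [mem_Box] at bμ bl
  constructor
  · intro h j hj
    constructor
    · by_contra hc
      have h1 := ht_le B μ j
      have h2 := h.1 ⟨ht B l j, by omega⟩ ⟨ht B l j, by omega⟩ rfl
      have h3 := (ht_iff B hμ ⟨ht B l j, by omega⟩ j).1 (by simp; omega)
      have h4 := (ht_iff B hl ⟨ht B l j, by omega⟩ j).2 (by omega)
      simp at h4
    · by_contra hc
      have h1 := ht_le B l j
      have h2 := h.2 ⟨ht B μ j, by omega⟩ ⟨ht B μ j + 1, by omega⟩ rfl
      have h3 := (ht_iff B hl ⟨ht B μ j + 1, by omega⟩ j).1 (by simp; omega)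
      have h4 := (ht_iff B hμ ⟨ht B μ j, by omega⟩ j).2 (by omega)
      simp at h4
  · intro h
    constructor
    · intro i k hik
      have b1 := bμ i
      have h1 := h (B - μ i + 1).toNat (by omega)
      have h2 := (ht_iff B hμ i (B - μ i + 1).toNat).2 (by omega)
      have h3 := (ht_iff B hl k (B - μ i + 1).toNat).1 (by omega)
      omega
    · intro i k hik
      have b1 := bl k
      have h1 := h (B - l k + 1).toNat (by omega)
      have h2 := (ht_iff B hl k (B - l k + 1).toNat).2 (by omega)
      have h3 := (ht_iff B hμ i (B - l k + 1).toNat).1 (by omega)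
      omega

theorem ht_inj {p : ℕ} {μ : Fin p → ℤ} {l : Fin p → ℤ} {A B : ℤ} {J : ℕ} (hJ : (J : ℤ) = B - A + 1)
    (hμ : IsSig μ) (hl : IsSig l) (bμ : μ ∈ Box p A B) (bl : l ∈ Box p A B)
    (h : ∀ j ≤ J, ht B μ j = ht B l j) : μ = l := by
  rw [mem_Box] at bμ bl
  funext i
  have b1 := bμ i
  have b2 := bl i
  have h1 := h (B - μ i + 1).toNat (by omega)
  have h2 := (ht_iff B hμ i (B - μ i + 1).toNat).2 (by omega)
  have h3 := (ht_iff B hl i (B - μ i + 1).toNat).1 (by omega)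
  have h1 := h (B - l i + 1).toNat (by omega)
  have h2 := (ht_iff B hl i (B - l i + 1).toNat).2 (by omega)
  have h3 := (ht_iff B hμ i (B - l i + 1).toNat).1 (by omega)
  omega

theorem ht_exists {p : ℕ} {A B : ℤ} {J : ℕ} (hJ : (J : ℤ) = B - A + 1) (h : ℕ → ℕ)
    (hm : ∀ j < J, h j ≤ h (j+1)) (h0 : h 0 = 0) (hp : h J = p) :
    ∃ l : Fin p → ℤ, IsSig l ∧ l ∈ Box p A B ∧ ∀ j ≤ J, ht B l j = h j := by
  have hm' : ∀ a b, a ≤ b → b ≤ J → h a ≤ h b := by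
    intro a b hab
    induction b, hab using Nat.le_induction with
    | base => intro _; exact le_rfl
    | succ b hab ih => intro hb; exact (ih (by omega)).trans (hm b (by omega))
  have ex : ∀ i : Fin p, ∃ j, (i : ℕ) < h j := fun i => ⟨J, by rw [hp]; exact i.2⟩
  have key : ∀ (i : Fin p) (j : ℕ), j ≤ J → (Nat.find (ex i) ≤ j ↔ (i : ℕ) < h j) := by
    intro i j hj
    constructor
    · intro hf
      exact (Nat.find_spec (ex i)).trans_le (hm' _ _ hf hj)
    · intro hf; exact Nat.find_min' _ hf
  refine ⟨fun i => B + 1 - Nat.find (ex i), ?_, ?_, ?_⟩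
  · intro i k hik
    have : Nat.find (ex i) ≤ Nat.find (ex k) := by
      apply Nat.find_min'
      have : (i : ℕ) ≤ k := hik
      exact this.trans_lt (Nat.find_spec (ex k))
    simp only
    omega
  · rw [mem_Box]
    intro i
    have h1 : Nat.find (ex i) ≤ J := (key i J le_rfl).2 (by rw [hp]; exact i.2)
    have h2 : Nat.find (ex i) ≠ 0 := by
      intro h
      have := (key i 0 (by omega)).1 (by omega)
      omega
    omega
  · intro j hj
    have : h j ≤ p := hp ▸ hm' j J hj le_rfl
    rw [ht]
    have e : (Finset.univ.filter fun i : Fin p => B - (j:ℤ) < B + 1 - (Nat.find (ex i) : ℤ))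
       = Finset.univ.filter fun i : Fin p => (i : ℕ) < h j := by
      ext i
      simp only [Finset.mem_filter, Finset.mem_univ, true_and]
      rw [← key i j hj]
      omega
    rw [e, Fin.card_filter_val_lt]
    omega

theorem ht_sum {p : ℕ} {l : Fin p → ℤ} {A B : ℤ} {J : ℕ} (hJ : (J : ℤ) = B - A + 1)
    (bl : l ∈ Box p A B) : ∑ j ∈ Finset.range J, (ht B l (j + 1) : ℤ) = sumz l - p * (A - 1) := by
  rw [mem_Box] at bl
  have : ∀ j, (ht B l (j+1) : ℤ) = ∑ i, if B - ((j + 1 : ℕ) : ℤ) < l i then 1 else 0 := by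
    intro j
    rw [ht, Finset.card_filter]
    push_cast
    rfl
  simp only [this]
  rw [Finset.sum_comm]
  have e : ∀ i, ∑ j ∈ Finset.range J, (if B - ((j + 1 : ℕ) : ℤ) < l i then (1 : ℤ) else 0) = l i - (A - 1) := by
    intro i
    rw [← Finset.sum_filter]
    have : (Finset.range J).filter (fun j => B - ((j + 1 : ℕ) : ℤ) < l i) = Finset.Ico (B - l i).toNat J := by
      ext j
      simp only [Finset.mem_filter, Finset.mem_range, Finset.mem_Ico]
      push_cast
      omega
    rw [this]
    simp
    have := bl i
    omega
  simp only [e, Finset.sum_sub_distrib, sumz]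
  simp
  ring

def genw {K : Type} [Field K] {p q : ℕ} (t : K) (l : Fin p → ℤ) (ν : Fin q → ℤ) : K :=
  ∏ᶠ c : ℤ, if mcount l c = mcount ν c + 1 then 1 - t ^ mcount l c else 1

theorem phi_genw {K : Type} [Field K] {p : ℕ} (t : K) (l ν : Fin p → ℤ) : phiHL t l ν = genw t l ν := rfl
theorem psi_genw {K : Type} [Field K] {p : ℕ} (t : K) (l : Fin (p+1) → ℤ) (ν : Fin p → ℤ) :
  psiHL t l ν = genw t ν l := rfl

theorem genw_ht {K : Type} [Field K] {p q : ℕ} (t : K) {l : Fin p → ℤ} (ν : Fin q → ℤ)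
    {A B : ℤ} {J : ℕ} (hJ : (J : ℤ) = B - A + 1) (bl : l ∈ Box p A B) :
    genw t l ν = ∏ j ∈ Finset.range J,
      if ht B l (j+1) + ht B ν j = ht B l j + ht B ν (j+1) + 1 then 1 - t ^ (ht B l (j+1) - ht B l j) else 1 := by
  rw [mem_Box] at bl
  rw [genw, finprod_eq_prod_of_mulSupport_subset (s := (Finset.range J).image (fun j : ℕ => B - (j : ℤ)))]
  · rw [Finset.prod_image]
    · apply Finset.prod_congr rfl
      intro j _
      rw [ht_succ, ht_succ]
      congr 1
      · apply propext
        constructor <;> intro h <;> omega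
      · rw [Nat.add_sub_cancel_left]
    · intro a _ b _ h
      simp only at h
      omega
  · intro c hc
    rw [Function.mem_mulSupport] at hc
    have : mcount l c ≠ 0 := by
      intro h
      apply hc
      simp [h]
    rw [mcount, Finset.card_ne_zero] at this
    obtain ⟨i, hi⟩ := this
    simp only [Finset.mem_filter, Finset.mem_univ, true_and] at hi
    have := bl i
    simp only [Finset.coe_image, Set.mem_image, Finset.coe_range, Set.mem_Iio]
    exact ⟨(B - c).toNat, by omega, by omega⟩

theorem st_sum (S : Finset ℕ) (J : ℕ) (hS : S ⊆ Finset.range J) :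
    ∑ j ∈ Finset.range J, ((st S (j+1)).toNat : ℤ) = S.card := by
  have : ∀ j, ((st S (j+1)).toNat : ℤ) = if j ∈ S then 1 else 0 := by
    intro j
    by_cases h : j ∈ S <;> simp [st, h]
  simp only [this]
  rw [← Finset.sum_filter, Finset.filter_mem_eq_inter, Finset.inter_eq_right.2 hS]
  simp

theorem wL_ne {K : Type} [Field K] (t : K) (N M : ℕ → ℕ) (hN : Monotone N) (hM : Monotone M) (j : ℕ) (x y : Bool)
    (hv : M j ≤ N j + x.toNat ∧ N j + x.toNat ≤ M j + 1) (h : wL t N M j x y ≠ 0) :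
    (M (j+1) ≤ N (j+1) + y.toNat ∧ N (j+1) + y.toNat ≤ M (j+1) + 1) ∧ N j + x.toNat ≤ N (j+1) + y.toNat := by
  have h1 := hN (Nat.le_succ j)
  have h2 := hM (Nat.le_succ j)
  simp only [Nat.succ_eq_add_one] at h1 h2
  by_cases v : (M (j+1) ≤ N (j+1) + y.toNat ∧ N (j+1) + y.toNat ≤ M (j+1) + 1)
  · refine ⟨v, ?_⟩
    by_contra hc
    apply h
    cases x <;> cases y <;> simp only [Bool.toNat_false, Bool.toNat_true] at * <;> try omega
    have e1 : N (j+1) = N j := by omega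
    have e2 : M (j+1) = M j := by omega
    have e3 : N j = M j := by omega
    simp [wL, wt, e1, e2, e3]
  · exact absurd (by simp [wL, wt, v]) h

theorem wR_ne {K : Type} [Field K] (t : K) (N M : ℕ → ℕ) (hM : Monotone M) (j : ℕ) (x y : Bool)
    (h : wR t N M j x y ≠ 0) :
    (M (j+1) ≤ N (j+1) + y.toNat ∧ N (j+1) + y.toNat ≤ M (j+1) + 1) ∧ M j + y.toNat ≤ M (j+1) + x.toNat := by
  have h2 := hM (Nat.le_succ j)
  simp only [Nat.succ_eq_add_one] at h2
  by_cases v : (M (j+1) ≤ N (j+1) + y.toNat ∧ N (j+1) + y.toNat ≤ M (j+1) + 1)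
  · refine ⟨v, ?_⟩
    by_contra hc
    apply h
    cases x <;> cases y <;> simp only [Bool.toNat_false, Bool.toNat_true] at * <;> try omega
    have e2 : M (j+1) = M j := by omega
    simp [wR, wt, e2]
  · exact absurd (by simp [wR, wt, v]) h

theorem prodL {K : Type} [Field K] (t : K) {n : ℕ} {μ : Fin n → ℤ} {ν l : Fin (n+1) → ℤ}
    {A B : ℤ} {J : ℕ} (hJ : (J : ℤ) = B - A + 1) (bμ : μ ∈ Box n A B) 
    (bl : l ∈ Box (n+1) A B) (S : Finset ℕ)
    (hS : ∀ j ≤ J, ht B l j = ht B ν j + (st S j).toNat)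
    (hv : ∀ j ≤ J, ht B μ j ≤ ht B l j ∧ ht B l j ≤ ht B μ j + 1) :
    phiHL t l ν * psiHL t l μ = ∏ i ∈ Finset.range J, wL t (ht B ν) (ht B μ) i (st S i) (st S (i+1)) := by
  rw [phi_genw, psi_genw, genw_ht t ν hJ bl, genw_ht t l hJ bμ, ← Finset.prod_mul_distrib]
  apply Finset.prod_congr rfl
  intro i hi
  rw [Finset.mem_range] at hi
  have a1 := hS i (by omega)
  have a2 := hS (i+1) (by omega)
  have v1 := hv i (by omega)
  have v2 := hv (i+1) (by omega)
  have m1 := ht_mono B ν (Nat.le_succ i)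
  rw [wL, wt]
  rw [a1] at v1 ⊢
  rw [a2] at v2 ⊢
  rw [if_pos v2]
  simp only [Nat.succ_eq_add_one] at m1
  congr 1
  · by_cases h : st S i = false ∧ st S (i+1) = true
    · rw [if_pos h, h.1, h.2]
      simp only [Bool.toNat_false, Bool.toNat_true]
      rw [if_pos (by omega)]
      congr 2
      omega
    · rw [if_neg h, if_neg]
      revert h
      cases st S i <;> cases st S (i+1) <;> simp <;> omega
  · congr 1
    apply propext
    constructor <;> intro h <;> omega

theorem prodR {K : Type} [Field K] (t : K) {n : ℕ} {μ l : Fin n → ℤ} {ν : Fin (n+1) → ℤ}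
    {A B : ℤ} {J : ℕ} (hJ : (J : ℤ) = B - A + 1) (bμ : μ ∈ Box n A B) 
    (bl : l ∈ Box n A B) (S : Finset ℕ)
    (hS : ∀ j ≤ J, ht B μ j = ht B l j + (st S j).toNat)
    (hv : ∀ j ≤ J, ht B l j ≤ ht B ν j ∧ ht B ν j ≤ ht B l j + 1) :
    phiHL t μ l * psiHL t ν l = ∏ i ∈ Finset.range J, wR t (ht B ν) (ht B μ) i (st S i) (st S (i+1)) := by
  rw [phi_genw, psi_genw, genw_ht t l hJ bμ, genw_ht t ν hJ bl, ← Finset.prod_mul_distrib]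
  apply Finset.prod_congr rfl
  intro i hi
  rw [Finset.mem_range] at hi
  have a1 := hS i (by omega)
  have a2 := hS (i+1) (by omega)
  have v1 := hv i (by omega)
  have v2 := hv (i+1) (by omega)
  have m1 := ht_mono B ν (Nat.le_succ i)
  simp only [Nat.succ_eq_add_one] at m1
  have vv : ht B μ (i + 1) ≤ ht B ν (i + 1) + (st S (i + 1)).toNat ∧
          ht B ν (i + 1) + (st S (i + 1)).toNat ≤ ht B μ (i + 1) + 1 := by omega
  rw [wR, wt]
  rw [if_pos vv]
  congr 1
  · congr 1
    apply propext
    rw [a1, a2]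
    cases st S i <;> cases st S (i+1) <;> simp <;> omega
  · by_cases h : ht B ν i + (st S i).toNat = ht B μ i + 1 ∧ ht B ν (i + 1) + (st S (i + 1)).toNat = ht B μ (i + 1)
    · rw [if_pos h, if_pos (by omega)]
      congr 2
      omega
    · rw [if_neg h, if_neg]
      omega

def Sof (J : ℕ) (h N : ℕ → ℕ) : Finset ℕ := (Finset.range J).filter fun j => h (j+1) = N (j+1) + 1

theorem Sof_st (J : ℕ) (h N : ℕ → ℕ) (h0 : h 0 = N 0) (hv : ∀ j ≤ J, N j ≤ h j ∧ h j ≤ N j + 1) (j : ℕ) (hj : j ≤ J) :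
    h j = N j + (st (Sof J h N) j).toNat := by
  cases j with
  | zero => simp [st, h0]
  | succ j =>
    have := hv (j+1) hj
    by_cases e : h (j+1) = N (j+1) + 1
    · have : j ∈ Sof J h N := by simp [Sof, e]; omega
      simp [st, this, e]
    · have : j ∉ Sof J h N := by simp [Sof, e]
      simp [st, this]; omega

theorem Sof_eq (J : ℕ) (h N : ℕ → ℕ) (S : Finset ℕ) (hS : S ⊆ Finset.range J)
    (e : ∀ j ≤ J, h j = N j + (st S j).toNat) : Sof J h N = S := by
  ext j
  simp only [Sof, Finset.mem_filter, Finset.mem_range]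
  constructor
  · rintro ⟨h1, h2⟩
    have := e (j+1) (by omega)
    by_contra hc
    simp [st, hc] at this
    omega
  · intro hj
    have h1 := Finset.mem_range.1 (hS hj)
    refine ⟨h1, ?_⟩
    have := e (j+1) (by omega)
    simpa [st, hj] using this

theorem sum_card {p : ℕ} {l ν : Fin p → ℤ} {A B : ℤ} {J : ℕ} (hJ : (J : ℤ) = B - A + 1)
    (bl : l ∈ Box p A B) (bν : ν ∈ Box p A B) (S : Finset ℕ) (hS : S ⊆ Finset.range J)
    (h : ∀ j ≤ J, ht B l j = ht B ν j + (st S j).toNat) : sumz l = sumz ν + S.card := by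
  have a := ht_sum hJ bl
  have b := ht_sum hJ bν
  have c := st_sum S J hS
  have : ∑ j ∈ Finset.range J, (ht B l (j + 1) : ℤ) = ∑ j ∈ Finset.range J, (ht B ν (j + 1) : ℤ)
     + ∑ j ∈ Finset.range J, ((st S (j+1)).toNat : ℤ) := by
    rw [← Finset.sum_add_distrib]
    apply Finset.sum_congr rfl
    intro j hj
    rw [h (j+1) (by have := Finset.mem_range.1 hj; omega)]
    push_cast; rfl
  linarith

theorem bijL {K : Type} [Field K] (t : K) {n : ℕ} {μ : Fin n → ℤ} {ν : Fin (n+1) → ℤ}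
    {A B : ℤ} {J : ℕ} (hJ : (J : ℤ) = B - A + 1) (bμ : μ ∈ Box n A B) (bν : ν ∈ Box (n+1) A B)
    (sμ : IsSig μ) (sν : IsSig ν) (r : ℕ) :
    (∑ l ∈ Box (n+1) A B, if interQ ν l ∧ interP μ l ∧ sumz l = sumz ν + r then phiHL t l ν * psiHL t l μ else 0)
     = ∑ S ∈ (Finset.range J).powerset, if S.card = r then
      ∏ i ∈ Finset.range J, wL t (ht B ν) (ht B μ) i (st S i) (st S (i+1)) else 0 := by
  -- facts for valid l
  have F : ∀ l ∈ Box (n+1) A B, interQ ν l → interP μ l → IsSig l ∧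
      (∀ j ≤ J, ht B l j = ht B ν j + (st (Sof J (ht B l) (ht B ν)) j).toNat) ∧
      (∀ j ≤ J, ht B μ j ≤ ht B l j ∧ ht B l j ≤ ht B μ j + 1) := by
    intro l bl h1 h2
    rw [interQ_iff] at h1
    rw [interP_iff] at h2
    have sl : IsSig l := inter_sig_right (by omega) h1
    refine ⟨sl, ?_, (inter_ht hJ (by omega) (by omega) sμ sl bμ bl).1 h2⟩
    exact Sof_st J _ _ (by rw [ht_zero bl, ht_zero bν]) ((inter_ht hJ (by omega) (by omega) sν sl bν bl).1 h1)
  have sub : ∀ h N, Sof J h N ⊆ Finset.range J := fun h N => Finset.filter_subset _ _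
  have val : ∀ l ∈ Box (n+1) A B, interQ ν l → interP μ l →
      (if interQ ν l ∧ interP μ l ∧ sumz l = sumz ν + r then phiHL t l ν * psiHL t l μ else 0) =
      if (Sof J (ht B l) (ht B ν)).card = r then
      ∏ i ∈ Finset.range J, wL t (ht B ν) (ht B μ) i (st (Sof J (ht B l) (ht B ν)) i) (st (Sof J (ht B l) (ht B ν)) (i+1)) else 0 := by
    intro l bl h1 h2
    obtain ⟨sl, e, v⟩ := F l bl h1 h2
    rw [prodL t hJ bμ bl _ e v]
    have := sum_card hJ bl bν _ (sub _ _) e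
    congr 1
    apply propext
    constructor
    · rintro ⟨_, _, h⟩; omega
    · intro h; exact ⟨h1, h2, by omega⟩
  have ne : ∀ l, (if interQ ν l ∧ interP μ l ∧ sumz l = sumz ν + r then phiHL t l ν * psiHL t l μ else 0) ≠ 0 →
      interQ ν l ∧ interP μ l := by
    intro l h
    by_contra hc
    apply h
    rw [if_neg]
    tauto
  apply Finset.sum_bij_ne_zero (fun l _ _ => Sof J (ht B l) (ht B ν))
  · intro l _ _
    exact Finset.mem_powerset.2 (sub _ _)
  · intro l bl hl l' bl' hl' heq
    obtain ⟨sl, e, v⟩ := F l bl (ne l hl).1 (ne l hl).2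
    obtain ⟨sl', e', v'⟩ := F l' bl' (ne l' hl').1 (ne l' hl').2
    apply ht_inj hJ sl sl' bl bl'
    intro j hj
    rw [e j hj, e' j hj, heq]
  · intro S hS hne
    rw [Finset.mem_powerset] at hS
    have hne' : ∏ i ∈ Finset.range J, wL t (ht B ν) (ht B μ) i (st S i) (st S (i+1)) ≠ 0 := by
      intro h; apply hne; rw [h]; simp
    rw [Finset.prod_ne_zero_iff] at hne'
    have V : ∀ j ≤ J, ht B μ j ≤ ht B ν j + (st S j).toNat ∧ ht B ν j + (st S j).toNat ≤ ht B μ j + 1 := by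
      intro j
      induction j with
      | zero => intro _; simp [ht_zero bμ, ht_zero bν, st]
      | succ j ih =>
        intro hj
        exact (wL_ne t _ _ (ht_mono B ν) (ht_mono B μ) j _ _ (ih (by omega)) (hne' j (Finset.mem_range.2 (by omega)))).1
    have Mo : ∀ j < J, ht B ν j + (st S j).toNat ≤ ht B ν (j+1) + (st S (j+1)).toNat := by
      intro j hj
      exact (wL_ne t _ _ (ht_mono B ν) (ht_mono B μ) j _ _ (V j (by omega)) (hne' j (Finset.mem_range.2 (by omega)))).2
    obtain ⟨l, sl, bl, hl⟩ := ht_exists (p := n+1) hJ (fun j => ht B ν j + (st S j).toNat) Mo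
      (by simp [ht_zero bν, st]) (by have := V J le_rfl; rw [ht_top bμ hJ, ht_top bν hJ] at this; simp only [ht_top bν hJ]; omega)
    have i1 : interQ ν l := by
      rw [interQ_iff, inter_ht hJ (by omega) (by omega) sν sl bν bl]
      intro j hj
      rw [hl j hj]
      have := Bool.toNat_le (st S j)
      omega
    have i2 : interP μ l := by
      rw [interP_iff, inter_ht hJ (by omega) (by omega) sμ sl bμ bl]
      intro j hj
      rw [hl j hj]
      exact V j hj
    have eS : Sof J (ht B l) (ht B ν) = S := Sof_eq J _ _ S hS hl
    refine ⟨l, bl, ?_, eS⟩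
    rw [val l bl i1 i2, eS]
    exact hne
  · intro l bl hl
    exact val l bl (ne l hl).1 (ne l hl).2

theorem bijR {K : Type} [Field K] (t : K) {n : ℕ} {μ : Fin n → ℤ} {ν : Fin (n+1) → ℤ}
    {A B : ℤ} {J : ℕ} (hJ : (J : ℤ) = B - A + 1) (bμ : μ ∈ Box n A B) (bν : ν ∈ Box (n+1) A B)
    (sμ : IsSig μ) (sν : IsSig ν) (r : ℕ) :
    (∑ l ∈ Box n A B, if interP l ν ∧ interQ l μ ∧ sumz μ = sumz l + r then phiHL t μ l * psiHL t ν l else 0)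
     = ∑ S ∈ (Finset.range J).powerset, if S.card = r then
      ∏ i ∈ Finset.range J, wR t (ht B ν) (ht B μ) i (st S i) (st S (i+1)) else 0 := by
  have F : ∀ l ∈ Box n A B, interP l ν → interQ l μ → IsSig l ∧
      (∀ j ≤ J, ht B μ j = ht B l j + (st (Sof J (ht B μ) (ht B l)) j).toNat) ∧
      (∀ j ≤ J, ht B l j ≤ ht B ν j ∧ ht B ν j ≤ ht B l j + 1) := by
    intro l bl h1 h2
    rw [interP_iff] at h1
    rw [interQ_iff] at h2
    have sl : IsSig l := inter_sig_left (by omega) h1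
    refine ⟨sl, ?_, (inter_ht hJ (by omega) (by omega) sl sν bl bν).1 h1⟩
    exact Sof_st J _ _ (by rw [ht_zero bl, ht_zero bμ]) ((inter_ht hJ (by omega) (by omega) sl sμ bl bμ).1 h2)
  have sub : ∀ h N, Sof J h N ⊆ Finset.range J := fun h N => Finset.filter_subset _ _
  have val : ∀ l ∈ Box n A B, interP l ν → interQ l μ →
      (if interP l ν ∧ interQ l μ ∧ sumz μ = sumz l + r then phiHL t μ l * psiHL t ν l else 0) =
      if (Sof J (ht B μ) (ht B l)).card = r then
      ∏ i ∈ Finset.range J, wR t (ht B ν) (ht B μ) i (st (Sof J (ht B μ) (ht B l)) i) (st (Sof J (ht B μ) (ht B l)) (i+1)) else 0 := by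
    intro l bl h1 h2
    obtain ⟨sl, e, v⟩ := F l bl h1 h2
    rw [prodR t hJ bμ bl _ e v]
    have := sum_card hJ bμ bl _ (sub _ _) e
    congr 1
    apply propext
    constructor
    · rintro ⟨_, _, h⟩; omega
    · intro h; exact ⟨h1, h2, by omega⟩
  have ne : ∀ l, (if interP l ν ∧ interQ l μ ∧ sumz μ = sumz l + r then phiHL t μ l * psiHL t ν l else 0) ≠ 0 →
      interP l ν ∧ interQ l μ := by
    intro l h
    by_contra hc
    apply h
    rw [if_neg]
    tauto
  apply Finset.sum_bij_ne_zero (fun l _ _ => Sof J (ht B μ) (ht B l))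
  · intro l _ _
    exact Finset.mem_powerset.2 (sub _ _)
  · intro l bl hl l' bl' hl' heq
    obtain ⟨sl, e, v⟩ := F l bl (ne l hl).1 (ne l hl).2
    obtain ⟨sl', e', v'⟩ := F l' bl' (ne l' hl').1 (ne l' hl').2
    apply ht_inj hJ sl sl' bl bl'
    intro j hj
    have a := e j hj
    have b := e' j hj
    rw [heq] at a
    omega
  · intro S hS hne
    rw [Finset.mem_powerset] at hS
    have hne' : ∏ i ∈ Finset.range J, wR t (ht B ν) (ht B μ) i (st S i) (st S (i+1)) ≠ 0 := by
      intro h; apply hne; rw [h]; simp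
    rw [Finset.prod_ne_zero_iff] at hne'
    have Mo : ∀ j < J, ht B μ j + (st S (j+1)).toNat ≤ ht B μ (j+1) + (st S j).toNat := by
      intro j hj
      exact (wR_ne t _ _ (ht_mono B μ) j _ _ (hne' j (Finset.mem_range.2 (by omega)))).2
    have V : ∀ j ≤ J, (ht B μ j ≤ ht B ν j + (st S j).toNat ∧ ht B ν j + (st S j).toNat ≤ ht B μ j + 1) ∧
        (st S j).toNat ≤ ht B μ j := by
      intro j
      induction j with
      | zero => intro _; simp [ht_zero bμ, ht_zero bν, st]
      | succ j ih =>
        intro hj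
        refine ⟨(wR_ne t _ _ (ht_mono B μ) j _ _ (hne' j (Finset.mem_range.2 (by omega)))).1, ?_⟩
        have := ih (by omega)
        have := Mo j (by omega)
        omega
    obtain ⟨l, sl, bl, hl⟩ := ht_exists (p := n) hJ (fun j => ht B μ j - (st S j).toNat) 
      (by intro j hj; have a := V j (by omega); have b := V (j+1) (by omega); have c := Mo j hj; omega)
      (by simp [ht_zero bμ]) (by have := V J le_rfl; rw [ht_top bμ hJ, ht_top bν hJ] at this; simp only [ht_top bμ hJ]; omega)
    have hl' : ∀ j ≤ J, ht B μ j = ht B l j + (st S j).toNat := by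
      intro j hj
      have a := V j hj
      have b := hl j hj
      omega
    have i1 : interQ l μ := by
      rw [interQ_iff, inter_ht hJ (by omega) (by omega) sl sμ bl bμ]
      intro j hj
      have := hl' j hj
      have := Bool.toNat_le (st S j)
      omega
    have i2 : interP l ν := by
      rw [interP_iff, inter_ht hJ (by omega) (by omega) sl sν bl bν]
      intro j hj
      have := hl' j hj
      have := V j hj
      omega
    have eS : Sof J (ht B μ) (ht B l) = S := Sof_eq J _ _ S hS hl'
    refine ⟨l, bl, ?_, eS⟩
    rw [val l bl i2 i1, eS]
    exact hne
  · intro l bl hl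
    exact val l bl (ne l hl).1 (ne l hl).2

theorem local_id {K : Type} [Field K] (t : K) {n : ℕ} {μ : Fin n → ℤ} {ν : Fin (n+1) → ℤ}
    {A B : ℤ} (bμ : μ ∈ Box n A B) (bν : ν ∈ Box (n+1) A B)
    (sμ : IsSig μ) (sν : IsSig ν) (r : ℕ) (hr : ∀ i, ν i + r ≤ B) :
    (∑ l ∈ Box (n+1) A B, if interQ ν l ∧ interP μ l ∧ sumz l = sumz ν + r then phiHL t l ν * psiHL t l μ else 0)
     = ∑ ks ∈ Finset.HasAntidiagonal.antidiagonal r, hh t ks.1 *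
       ∑ l ∈ Box n A B, if interP l ν ∧ interQ l μ ∧ sumz μ = sumz l + ks.2 then phiHL t μ l * psiHL t ν l else 0 := by
  have h0 := mem_Box.1 bν 0
  have h1 := hr 0
  have hJ : ((B - A + 1).toNat : ℤ) = B - A + 1 := by omega
  generalize (B - A + 1).toNat = J at hJ
  rw [bijL t hJ bμ bν sμ sν r]
  simp only [bijR t hJ bμ bν sμ sν]
  have hJ1 : ht B ν J = ht B μ J + 1 := by rw [ht_top bμ hJ, ht_top bν hJ]
  have zL : tv (wL t (ht B ν) (ht B μ)) 1 0 J true = 0 := by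
    cases J with
    | zero => simp [tv]
    | succ J =>
      have : ∀ x, wL t (ht B ν) (ht B μ) J x true = 0 := by
        intro x
        rw [wL, wt, if_neg]
        simp only [Bool.toNat_true]
        omega
      simp [tv, this]
  have zR : tv (wR t (ht B ν) (ht B μ)) 1 0 J true = 0 := by
    cases J with
    | zero => simp [tv]
    | succ J =>
      have : ∀ x, wR t (ht B ν) (ht B μ) J x true = 0 := by
        intro x
        rw [wR, wt, if_neg]
        simp only [Bool.toNat_true]
        omega
      simp [tv, this]
  rw [← tv_path_coeff _ J r zL]
  simp only [← tv_path_coeff _ J _ zR]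
  apply tv_coeff t _ _ (ht_mono B ν) (ht_mono B μ) (ht_zero bν) (ht_zero bμ) r J _ (by omega) hJ1
  intro j hj
  rw [ht, Finset.card_eq_zero, Finset.filter_eq_empty_iff]
  intro i _
  have := hr i
  omega

def PP {K : Type} [Field K] (t : K) : (k : ℕ) → (Fin k → ℤ) → (Fin k → K) → K
  | 0, _, _ => 1
  | k + 1, l, x =>
    ∑ᶠ ν : Fin k → ℤ,
      if interP ν l then
        psiHL t l ν * x (Fin.last k) ^ (sumz l - sumz ν) * PP t k ν fun i => x i.castSucc
      else 0

theorem finsum_castP {K : Type} [Field K] (t : K) {j k : ℕ} (h : j = k) (l : Fin (j+1) → ℤ) (z : K)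
    (G : (Fin j → ℤ) → K) :
    (∑ᶠ ν : Fin j → ℤ, if interP ν l then psiHL t l ν * z ^ (sumz l - sumz ν) * G ν else 0) =
    ∑ᶠ ν : Fin k → ℤ, if interP ν (fun i : Fin (k+1) => l (Fin.cast (by rw [h]) i)) then
      psiHL t (fun i : Fin (k+1) => l (Fin.cast (by rw [h]) i)) ν *
        z ^ (sumz (fun i : Fin (k+1) => l (Fin.cast (by rw [h]) i)) - sumz ν) *
        G (fun i => ν (Fin.cast h i)) else 0 := by
  subst h
  rfl

theorem HLP_PP {K : Type} [Field K] (t : K) (e : Fin 0 → ℤ) (k : ℕ) (l : Fin (0 + k) → ℤ) (x : Fin k → K) :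
    HLP t k e l x = PP t k (fun i => l (Fin.cast (Nat.zero_add k).symm i)) x := by
  induction k with
  | zero =>
    simp only [HLP, PP]
    rw [if_pos]
    funext i
    exact i.elim0
  | succ k ih =>
    simp only [HLP, PP]
    have := finsum_castP t (Nat.zero_add k) l (x (Fin.last k)) (fun ν => HLP t k e ν fun i => x i.castSucc)
    refine this.trans ?_
    simp only [ih]
    rfl

theorem HLPfull_PP {K : Type} [Field K] (t : K) {n : ℕ} (l : Fin n → ℤ) (x : Fin n → K) :
    HLPfull t l x = PP t n l x := by
  rw [HLPfull, HLP_PP]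
  rfl

theorem interP_box {n : ℕ} {A B : ℤ} {ν : Fin n → ℤ} {l : Fin (n+1) → ℤ} (bl : l ∈ Box (n+1) A B) (h : interP ν l) :
    ν ∈ Box n A B := by
  rw [mem_Box] at *
  intro i
  have a := h i
  have b := bl i.castSucc
  have c := bl i.succ
  omega

theorem PP_box {K : Type} [Field K] (t : K) {k : ℕ} {A B : ℤ} {l : Fin (k+1) → ℤ} (bl : l ∈ Box (k+1) A B)
    (x : Fin (k+1) → K) : PP t (k+1) l x = ∑ ν ∈ Box k A B, if interP ν l then
        psiHL t l ν * x (Fin.last k) ^ (sumz l - sumz ν) * PP t k ν fun i => x i.castSucc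
      else 0 := by
  simp only [PP]
  apply finsum_eq_sum_of_support_subset
  intro ν hν
  rw [Function.mem_support] at hν
  by_contra hc
  apply hν
  rw [if_neg]
  intro h
  exact hc (interP_box bl h)

theorem mcount_zero_fin (l : Fin 0 → ℤ) (c : ℤ) : mcount l c = 0 := by
  simp [mcount]

theorem pieri {K : Type} [Field K] (t : K) (n : ℕ) : ∃ g : ℕ → (Fin n → K) → K,
    ∀ (r : ℕ) (x : Fin n → K), (∀ i, x i ≠ 0) → ∀ (ν : Fin n → ℤ) (A B : ℤ), IsSig ν → ν ∈ Box n A B →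
      (∀ i, ν i + r ≤ B) →
      PP t n ν x * g r x = ∑ l ∈ Box n A B, if interQ ν l ∧ sumz l = sumz ν + r then phiHL t l ν * PP t n l x else 0 := by
  induction n with
  | zero =>
    refine ⟨fun r _ => if r = 0 then 1 else 0, ?_⟩
    intro r x hx ν A B sν bν hr
    rw [Finset.sum_eq_single ν]
    · have : interQ ν ν := ⟨fun i => le_rfl, fun i => i.elim0⟩
      have e : phiHL t ν ν = 1 := by simp [phiHL]
      by_cases h : r = 0 <;> simp [this, e, h]
    · intro b _ hb
      exact absurd (Subsingleton.elim _ _) hb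
    · intro h; exact absurd bν h
  | succ n ih =>
    obtain ⟨g, hg⟩ := ih
    refine ⟨fun r x => ∑ ks ∈ Finset.HasAntidiagonal.antidiagonal r,
      hh t ks.1 * x (Fin.last n) ^ ks.1 * g ks.2 (fun i => x i.castSucc), ?_⟩
    intro r x hx ν A B sν bν hr
    have hz := hx (Fin.last n)
    simp only
    rw [PP_box t bν]
    generalize hxx : (fun i : Fin n => x i.castSucc) = x'
    have hx' : ∀ i, x' i ≠ 0 := by
      intro i
      rw [← hxx]
      exact hx _
    generalize hzz : x (Fin.last n) = z at *
    -- common middle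
    trans ∑ μ ∈ Box n A B, z ^ (sumz ν + r - sumz μ) * PP t n μ x' *
      ∑ l ∈ Box (n+1) A B, if interQ ν l ∧ interP μ l ∧ sumz l = sumz ν + r then phiHL t l ν * psiHL t l μ else 0
    · have e1 : ∀ μ ∈ Box n A B, (z ^ (sumz ν + r - sumz μ) * PP t n μ x' *
        ∑ l ∈ Box (n+1) A B, if interQ ν l ∧ interP μ l ∧ sumz l = sumz ν + r then phiHL t l ν * psiHL t l μ else 0)
        = z ^ (sumz ν + r - sumz μ) * PP t n μ x' * ∑ ks ∈ Finset.HasAntidiagonal.antidiagonal r, hh t ks.1 *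
       ∑ l ∈ Box n A B, if interP l ν ∧ interQ l μ ∧ sumz μ = sumz l + ks.2 then phiHL t μ l * psiHL t ν l else 0 := by
        intro μ bμ
        by_cases sμ : IsSig μ
        · rw [local_id t bμ bν sμ sν r hr]
        · congr 1
          rw [Finset.sum_eq_zero, Finset.sum_eq_zero]
          · intro ks _
            rw [Finset.sum_eq_zero, mul_zero]
            intro l _
            rw [if_neg]
            rintro ⟨_, h, _⟩
            exact sμ (inter_sig_right (by omega) ((interQ_iff _ _).1 h))
          · intro l _
            rw [if_neg]
            rintro ⟨_, h, _⟩
            exact sμ (inter_sig_left (by omega) ((interP_iff _ _).1 h))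
      rw [Finset.sum_congr rfl e1]
      simp only [Finset.mul_sum, Finset.sum_mul]
      rw [Finset.sum_comm (s := Box n A B) (t := Finset.HasAntidiagonal.antidiagonal r)]
      apply Finset.sum_congr rfl
      rintro ⟨k, s⟩ hks
      rw [Finset.HasAntidiagonal.mem_antidiagonal] at hks
      simp only at hks ⊢
      rw [Finset.sum_comm (s := Box n A B) (t := Box n A B)]
      apply Finset.sum_congr rfl
      intro ρ bρ
      by_cases hρ : interP ρ ν
      · have sρ : IsSig ρ := inter_sig_left (by omega) ((interP_iff _ _).1 hρ)
        have hb : ∀ i, ρ i + s ≤ B := by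
          intro i
          have a := (hρ i).1
          have b := hr i.castSucc
          omega
        rw [if_pos hρ]
        have := hg s x' hx' ρ A B sρ bρ hb
        calc psiHL t ν ρ * z ^ (sumz ν - sumz ρ) * PP t n ρ x' * (hh t k * z ^ k * g s x')
            = psiHL t ν ρ * z ^ (sumz ν - sumz ρ) * (hh t k * z ^ k) * (PP t n ρ x' * g s x') := by ring
          _ = _ := by
            rw [this, Finset.mul_sum]
            apply Finset.sum_congr rfl
            intro μ bμ
            by_cases h : interQ ρ μ ∧ sumz μ = sumz ρ + s
            · rw [if_pos h, if_pos ⟨hρ, h⟩]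
              have : sumz ν + r - sumz μ = (sumz ν - sumz ρ) + (k : ℤ) := by
                rw [h.2, ← hks]; push_cast; ring
              rw [this, zpow_add₀ hz, zpow_natCast]
              ring
            · rw [if_neg h, if_neg (fun h' => h h'.2)]
              ring
      · rw [if_neg hρ, zero_mul]
        symm
        apply Finset.sum_eq_zero
        intro μ _
        rw [if_neg (fun h => hρ h.1)]
        ring
    · simp only [Finset.mul_sum]
      rw [Finset.sum_comm]
      apply Finset.sum_congr rfl
      intro l bl
      by_cases h : interQ ν l ∧ sumz l = sumz ν + r
      · rw [if_pos h, PP_box t bl, Finset.mul_sum]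
        apply Finset.sum_congr rfl
        intro μ bμ
        by_cases h2 : interP μ l
        · rw [if_pos ⟨h.1, h2, h.2⟩, if_pos h2, hzz, h.2, hxx]
          ring
        · rw [if_neg (fun h' => h2 h'.2.1), if_neg h2]
          ring
      · rw [if_neg h]
        apply Finset.sum_eq_zero
        intro μ _
        rw [if_neg (fun h' => h ⟨h'.1, h'.2.2⟩)]
        ring

theorem laurent {K : Type} [Field K] [Infinite K] {ι : Type} (s : Finset ι) (b : ι → K) (e : ι → ℤ)
    (h : ∀ z : K, z ≠ 0 → ∑ i ∈ s, b i * z ^ (e i) = 0) (d : ℤ) :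
    (∑ i ∈ s, if e i = d then b i else 0) = 0 := by
  obtain ⟨M, hM⟩ : ∃ M : ℕ, ∀ i ∈ s, 0 ≤ e i + M := by
    refine ⟨∑ i ∈ s, (e i).natAbs, ?_⟩
    intro i hi
    have := Finset.single_le_sum (f := fun i => (e i).natAbs) (fun _ _ => Nat.zero_le _) hi
    omega
  let p : Polynomial K := ∑ i ∈ s, Polynomial.C (b i) * Polynomial.X ^ (e i + M).toNat
  have hp : p * Polynomial.X = 0 := by
    apply Polynomial.funext
    intro z
    by_cases hz : z = 0
    · simp [hz]
    · have : Polynomial.eval z p = z ^ M * ∑ i ∈ s, b i * z ^ (e i) := by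
        simp only [p, Polynomial.eval_finsetSum, Finset.mul_sum]
        apply Finset.sum_congr rfl
        intro i hi
        simp only [Polynomial.eval_mul, Polynomial.eval_C, Polynomial.eval_pow, Polynomial.eval_X]
        rw [← zpow_natCast, Int.toNat_of_nonneg (hM i hi), zpow_add₀ hz, zpow_natCast]
        ring
      rw [Polynomial.eval_mul, this, h z hz]
      simp
  have hp0 : p = 0 := by
    rcases mul_eq_zero.1 hp with h | h
    · exact h
    · exact absurd h Polynomial.X_ne_zero
  by_cases hd : 0 ≤ d + M
  · have := congrArg (fun q => Polynomial.coeff q (d + M).toNat) hp0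
    simp only [p, Polynomial.finsetSum_coeff, Polynomial.coeff_C_mul, Polynomial.coeff_X_pow,
      Polynomial.coeff_zero] at this
    refine Eq.trans ?_ this
    apply Finset.sum_congr rfl
    intro i hi
    have := hM i hi
    by_cases hh : e i = d
    · simp [hh]
    · rw [if_neg hh, if_neg, mul_zero]
      omega
  · apply Finset.sum_eq_zero
    intro i hi
    have := hM i hi
    rw [if_neg]
    omega

theorem exists_box {n : ℕ} (S : Finset (Fin n → ℤ)) : ∃ C : ℤ, 0 ≤ C ∧ ∀ κ ∈ S, κ ∈ Box n (-C) C := by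
  refine ⟨∑ κ ∈ S, ∑ i, |κ i|, Finset.sum_nonneg fun _ _ => Finset.sum_nonneg fun _ _ => abs_nonneg _, ?_⟩
  intro κ hκ
  rw [mem_Box]
  intro i
  have a : |κ i| ≤ ∑ i, |κ i| := Finset.single_le_sum (f := fun i => |κ i|) (fun _ _ => abs_nonneg _) (Finset.mem_univ i)
  have b : ∑ i, |κ i| ≤ ∑ κ ∈ S, ∑ i, |κ i| :=
    Finset.single_le_sum (f := fun κ : Fin n → ℤ => ∑ i, |κ i|) (fun _ _ => Finset.sum_nonneg fun _ _ => abs_nonneg _) hκ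
  have := abs_le.1 (a.trans b)
  exact this

theorem interP_sum {n : ℕ} {ν : Fin n → ℤ} {κ : Fin (n+1) → ℤ} (h : interP ν κ) :
    κ (Fin.last n) ≤ sumz κ - sumz ν ∧ (sumz κ - sumz ν = κ (Fin.last n) → ν = fun i => κ i.castSucc) := by
  have e : sumz κ - sumz ν = ∑ i : Fin n, (κ i.castSucc - ν i) + κ (Fin.last n) := by
    rw [sumz, sumz, Fin.sum_univ_castSucc, Finset.sum_sub_distrib]; ring
  have nn : ∀ i ∈ (Finset.univ : Finset (Fin n)), 0 ≤ κ i.castSucc - ν i := fun i _ => by have := (h i).1; omega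
  have := Finset.sum_nonneg nn
  refine ⟨by omega, ?_⟩
  intro h'
  have z : ∑ i : Fin n, (κ i.castSucc - ν i) = 0 := by omega
  rw [Finset.sum_eq_zero_iff_of_nonneg nn] at z
  funext i
  have := z i (Finset.mem_univ _)
  omega

theorem psi_init {K : Type} [Field K] (t : K) {n : ℕ} (κ : Fin (n+1) → ℤ) :
    psiHL t κ (fun i => κ i.castSucc) = 1 := by
  rw [psiHL]
  apply finprod_eq_one_of_forall_eq_one
  intro c
  rw [if_neg]
  have : mcount (fun i : Fin n => κ i.castSucc) c ≤ mcount κ c := by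
    apply Finset.card_le_card_of_injOn Fin.castSucc
    · intro i hi
      simpa using hi
    · intro a _ b _ h
      exact Fin.castSucc_injective _ h
  omega

theorem interP_init {n : ℕ} {κ : Fin (n+1) → ℤ} (h : IsSig κ) : interP (fun i => κ i.castSucc) κ := by
  intro i
  exact ⟨le_rfl, h _ _ (Fin.castSucc_lt_succ).le⟩

theorem linindep {K : Type} [Field K] [Infinite K] (t : K) (n : ℕ) (S : Finset (Fin n → ℤ)) (hS : ∀ κ ∈ S, IsSig κ)
    (a : (Fin n → ℤ) → K) (h : ∀ x : Fin n → K, (∀ i, x i ≠ 0) → ∑ κ ∈ S, a κ * PP t n κ x = 0) :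
    ∀ κ ∈ S, a κ = 0 := by
  induction n with
  | zero =>
    intro κ hκ
    have := h (fun _ => 1) (fun i => i.elim0)
    rw [Finset.sum_eq_single κ] at this
    · simpa [PP] using this
    · intro b _ hb; exact absurd (Subsingleton.elim _ _) hb
    · intro h; exact absurd hκ h
  | succ n ih =>
    by_contra hc
    push Not at hc
    have ne : (S.filter fun κ => a κ ≠ 0).Nonempty := by
      obtain ⟨κ, h1, h2⟩ := hc
      exact ⟨κ, by simp [h1, h2]⟩
    obtain ⟨κ0, hκ0, hmin⟩ := Finset.exists_min_image _ (fun κ => κ (Fin.last n)) ne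
    rw [Finset.mem_filter] at hκ0
    obtain ⟨C, -, hC⟩ := exists_box S
    set d := κ0 (Fin.last n) with hd
    have key : ∀ x' : Fin n → K, (∀ i, x' i ≠ 0) →
        ∑ κ ∈ S.filter (fun κ => κ (Fin.last n) = d), a κ * PP t n (fun i => κ i.castSucc) x' = 0 := by
      intro x' hx'
      have L := laurent (S ×ˢ Box n (-C) C)
        (fun q => if interP q.2 q.1 then a q.1 * (psiHL t q.1 q.2 * PP t n q.2 x') else 0)
        (fun q => sumz q.1 - sumz q.2) (by
          intro z hz
          have := h (Fin.snoc x' z) (by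
            intro i
            refine Fin.lastCases ?_ (fun i => ?_) i
            · simpa using hz
            · simpa using hx' i)
          refine Eq.trans ?_ this
          rw [Finset.sum_product]
          apply Finset.sum_congr rfl
          intro κ hκ
          rw [PP_box t (hC κ hκ), Finset.mul_sum]
          apply Finset.sum_congr rfl
          intro ν _
          simp only [Fin.snoc_last, Fin.snoc_castSucc]
          by_cases hi : interP ν κ
          · rw [if_pos hi, if_pos hi]; ring
          · rw [if_neg hi, if_neg hi]; ring) d
      rw [Finset.sum_product] at L
      refine Eq.trans ?_ L
      rw [Finset.sum_filter]
      apply Finset.sum_congr rfl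
      intro κ hκ
      simp only
      by_cases ha : a κ = 0
      · simp [ha]
      have hge : d ≤ κ (Fin.last n) := hmin κ (by simp [hκ, ha])
      by_cases hk : κ (Fin.last n) = d
      · rw [if_pos hk, Finset.sum_eq_single (fun i => κ i.castSucc)]
        · have hi := interP_init (hS κ hκ)
          rw [if_pos, if_pos hi, psi_init, one_mul]
          rw [sumz, sumz, Fin.sum_univ_castSucc, hk]; ring
        · intro ν _ hν
          by_cases hi : interP ν κ
          · rw [if_neg]
            intro hh
            exact hν ((interP_sum hi).2 (by rw [hk]; exact hh))
          · rw [if_neg hi]; simp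
        · intro hb
          exact absurd (interP_box (hC κ hκ) (interP_init (hS κ hκ))) hb
      · rw [if_neg hk]
        symm
        apply Finset.sum_eq_zero
        intro ν _
        by_cases hi : interP ν κ
        · rw [if_neg]
          have := (interP_sum hi).1
          omega
        · rw [if_neg hi]; simp
    have inj : Set.InjOn (fun (κ : Fin (n+1) → ℤ) => (fun i : Fin n => κ i.castSucc))
        (S.filter (fun κ => κ (Fin.last n) = d) : Finset (Fin (n+1) → ℤ)) := by
      intro κ hκ κ' hκ' heq
      simp only [Finset.coe_filter, Set.mem_ofPred_eq] at hκ hκ'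
      funext i
      refine Fin.lastCases ?_ (fun i => ?_) i
      · rw [hκ.2, hκ'.2]
      · exact congrFun heq i
    have snoc_eq : ∀ κ : Fin (n+1) → ℤ, κ (Fin.last n) = d → (Fin.snoc (fun i : Fin n => κ i.castSucc) d : Fin (n+1) → ℤ) = κ := by
      intro κ hκ
      funext i
      refine Fin.lastCases ?_ (fun i => ?_) i
      · simp [hκ]
      · simp
    have := ih ((S.filter (fun κ => κ (Fin.last n) = d)).image (fun κ => fun i : Fin n => κ i.castSucc)) (by
        intro ν hν
        rw [Finset.mem_image] at hν
        obtain ⟨κ, hκ, rfl⟩ := hν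
        rw [Finset.mem_filter] at hκ
        intro i j hij
        exact hS κ hκ.1 _ _ (by simpa using hij))
      (fun ν => a (Fin.snoc ν d : Fin (n+1) → ℤ)) (by
        intro x' hx'
        rw [Finset.sum_image inj, ← key x' hx']
        apply Finset.sum_congr rfl
        intro κ hκ
        rw [snoc_eq κ (Finset.mem_filter.1 hκ).2])
      (fun i => κ0 i.castSucc) (Finset.mem_image.2 ⟨κ0, by simp [hκ0.1, hd], rfl⟩)
    rw [snoc_eq κ0 hd.symm] at this
    exact hκ0.2 this

theorem PP_homog {K : Type} [Field K] (t z : K) (hz : z ≠ 0) (n : ℕ) (κ : Fin n → ℤ) (x : Fin n → K) :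
    PP t n κ (fun i => z * x i) = z ^ (sumz κ) * PP t n κ x := by
  induction n with
  | zero => simp [PP, sumz]
  | succ n ih =>
    obtain ⟨C, -, hC⟩ := exists_box {κ}
    have b := hC κ (by simp)
    rw [PP_box t b, PP_box t b, Finset.mul_sum]
    apply Finset.sum_congr rfl
    intro ν _
    by_cases h : interP ν κ
    · rw [if_pos h, if_pos h, ih ν (fun i => x i.castSucc), mul_zpow]
      have : z ^ (sumz κ) = z ^ (sumz κ - sumz ν) * z ^ (sumz ν) := by
        rw [← zpow_add₀ hz]; congr 1; ring
      rw [this]; ring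
    · rw [if_neg h, if_neg h, mul_zero]

theorem PP_zero {K : Type} [Field K] (t : K) (n : ℕ) (x : Fin n → K) : PP t n (fun _ => 0) x = 1 := by
  induction n with
  | zero => simp [PP]
  | succ n ih =>
    have b : (fun _ => 0 : Fin (n+1) → ℤ) ∈ Box (n+1) 0 0 := by simp [mem_Box]
    rw [PP_box t b, Finset.sum_eq_single (fun _ => 0)]
    · rw [if_pos (interP_init (κ := fun _ => 0) (fun _ _ _ => le_rfl)), psi_init t (fun _ => 0), ih]
      simp [sumz]
    · intro ν bν hν
      exfalso
      apply hν
      rw [mem_Box] at bν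
      funext i
      have := bν i
      omega
    · intro h
      exact absurd (by simp [mem_Box]) h

theorem exists_of_finsum_ne {K ι : Type} [Field K] {f : ι → K} (h : (∑ᶠ i, f i) ≠ 0) : ∃ i, f i ≠ 0 := by
  by_contra hc
  push Not at hc
  exact h (finsum_eq_zero_of_forall_eq_zero hc)

theorem HLQ_ne {K : Type} [Field K] (t : K) {n : ℕ} (k : ℕ) (ν κ : Fin n → ℤ) (y : Fin k → K)
    (h : HLQ t k ν κ y ≠ 0) : (∀ i, ν i ≤ κ i) ∧ (IsSig ν → IsSig κ) := by
  cases k with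
  | zero =>
    simp only [HLQ] at h
    have : ν = κ := by
      by_contra hc
      exact h (if_neg hc)
    subst this
    exact ⟨fun _ => le_rfl, id⟩
  | succ k =>
    induction k generalizing κ with
    | zero =>
      simp only [HLQ] at h
      obtain ⟨ρ, hρ⟩ := exists_of_finsum_ne h
      have hi : interQ ρ κ := by
        by_contra hc
        exact hρ (if_neg hc)
      have : ν = ρ := by
        by_contra hc
        apply hρ
        simp [hc]
      subst this
      exact ⟨hi.1, fun _ => inter_sig_right (by omega) ((interQ_iff _ _).1 hi)⟩
    | succ k ih =>
      rw [HLQ] at h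
      obtain ⟨ρ, hρ⟩ := exists_of_finsum_ne h
      have hi : interQ ρ κ := by
        by_contra hc
        exact hρ (if_neg hc)
      have h2 : HLQ t (k+1) ν ρ (fun i => y i.castSucc) ≠ 0 := by
        intro hc
        apply hρ
        rw [hc]
        simp
      exact ⟨fun i => ((ih ρ _ h2).1 i).trans (hi.1 i),
        fun _ => inter_sig_right (by omega) ((interQ_iff _ _).1 hi)⟩

theorem HLQ_box {K : Type} [Field K] (t : K) {n m : ℕ} {A B : ℤ} {ν l : Fin n → ℤ} (bν : ν ∈ Box n A B)
    (bl : l ∈ Box n A B) (y : Fin (m+1) → K) :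
    HLQ t (m+1) ν l y = ∑ κ ∈ Box n A B, if interQ κ l then
        phiHL t l κ * y (Fin.last m) ^ (sumz l - sumz κ) * HLQ t m ν κ fun i => y i.castSucc
      else 0 := by
  simp only [HLQ]
  apply finsum_eq_sum_of_support_subset
  intro κ hκ
  rw [Function.mem_support] at hκ
  have hi : interQ κ l := by
    by_contra hc
    exact hκ (if_neg hc)
  have h2 : HLQ t m ν κ (fun i => y i.castSucc) ≠ 0 := by
    intro hc
    apply hκ
    rw [hc]
    simp
  have := (HLQ_ne t m ν κ _ h2).1
  rw [Finset.mem_coe, mem_Box]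
  rw [mem_Box] at bν bl
  intro i
  exact ⟨(bν i).1.trans (this i), (hi.1 i).trans (bl i).2⟩

theorem sumz_le {n : ℕ} {ν κ : Fin n → ℤ} (h : ∀ i, ν i ≤ κ i) (i : Fin n) :
    κ i - ν i ≤ sumz κ - sumz ν := by
  rw [sumz, sumz, ← Finset.sum_sub_distrib]
  exact Finset.single_le_sum (f := fun i => κ i - ν i) (fun j _ => by have := h j; omega) (Finset.mem_univ i)

theorem sumz_mono {n : ℕ} {ν κ : Fin n → ℤ} (h : ∀ i, ν i ≤ κ i) : sumz ν ≤ sumz κ :=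
  Finset.sum_le_sum fun i _ => h i

theorem qchain {K : Type} [Field K] (t : K) (n m : ℕ) (y : Fin m → K) : ∃ G : ℕ → (Fin n → K) → K,
    ∀ (s : ℕ) (x : Fin n → K), (∀ i, x i ≠ 0) → ∀ (ν : Fin n → ℤ) (A B : ℤ), IsSig ν → ν ∈ Box n A B →
      (∀ i, ν i + s ≤ B) →
      PP t n ν x * G s x = ∑ l ∈ Box n A B, if sumz l = sumz ν + s then HLQ t m ν l y * PP t n l x else 0 := by
  induction m with
  | zero =>
    refine ⟨fun s _ => if s = 0 then 1 else 0, ?_⟩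
    intro s x hx ν A B sν bν hs
    simp only [HLQ]
    rw [Finset.sum_eq_single ν]
    · by_cases h : s = 0 <;> simp [h]
    · intro l _ hl
      rw [if_neg (Ne.symm hl)]
      simp
    · intro h; exact absurd bν h
  | succ m ih =>
    obtain ⟨G, hG⟩ := ih (fun i => y i.castSucc)
    obtain ⟨g, hg⟩ := pieri t n
    refine ⟨fun s x => ∑ ks ∈ Finset.HasAntidiagonal.antidiagonal s,
      y (Fin.last m) ^ ks.1 * g ks.1 x * G ks.2 x, ?_⟩
    intro s x hx ν A B sν bν hs
    have e1 : ∀ ks ∈ Finset.HasAntidiagonal.antidiagonal s,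
        PP t n ν x * (y (Fin.last m) ^ ks.1 * g ks.1 x * G ks.2 x) =
        ∑ l ∈ Box n A B, ∑ κ ∈ Box n A B, if interQ κ l ∧ sumz l = sumz κ + ks.1 ∧ sumz κ = sumz ν + ks.2 then
          y (Fin.last m) ^ ks.1 * HLQ t m ν κ (fun i => y i.castSucc) * phiHL t l κ * PP t n l x else 0 := by
      rintro ⟨k, s'⟩ hks
      rw [Finset.HasAntidiagonal.mem_antidiagonal] at hks
      simp only at hks ⊢
      calc PP t n ν x * (y (Fin.last m) ^ k * g k x * G s' x)
          = y (Fin.last m) ^ k * g k x * (PP t n ν x * G s' x) := by ring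
        _ = _ := by
          rw [hG s' x hx ν A B sν bν (fun i => by have := hs i; omega), Finset.mul_sum, Finset.sum_comm]
          apply Finset.sum_congr rfl
          intro κ bκ
          by_cases h0 : HLQ t m ν κ (fun i => y i.castSucc) = 0
          · simp [h0]
          by_cases h1 : sumz κ = sumz ν + s'
          · have hn := HLQ_ne t m ν κ _ h0
            rw [if_pos h1]
            have := hg k x hx κ A B (hn.2 sν) bκ (by
              intro i
              have a := sumz_le hn.1 i
              have b := hs i
              omega)
            calc y (Fin.last m) ^ k * g k x * (HLQ t m ν κ (fun i => y i.castSucc) * PP t n κ x)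
                = y (Fin.last m) ^ k * HLQ t m ν κ (fun i => y i.castSucc) * (PP t n κ x * g k x) := by ring
              _ = _ := by
                rw [this, Finset.mul_sum]
                apply Finset.sum_congr rfl
                intro l _
                by_cases h2 : interQ κ l ∧ sumz l = sumz κ + k
                · rw [if_pos h2, if_pos ⟨h2.1, h2.2, h1⟩]; ring
                · rw [if_neg h2, if_neg (fun h => h2 ⟨h.1, h.2.1⟩), mul_zero]
          · rw [if_neg h1, mul_zero]
            symm
            apply Finset.sum_eq_zero
            intro l _
            rw [if_neg (fun h => h1 h.2.2)]
    simp only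
    rw [Finset.mul_sum, Finset.sum_congr rfl e1, Finset.sum_comm]
    apply Finset.sum_congr rfl
    intro l bl
    rw [Finset.sum_comm, HLQ_box t bν bl, Finset.sum_mul]
    have e2 : (if sumz l = sumz ν + s then ∑ κ ∈ Box n A B, (if interQ κ l then
        phiHL t l κ * y (Fin.last m) ^ (sumz l - sumz κ) * HLQ t m ν κ fun i => y i.castSucc
      else 0) * PP t n l x else 0) = ∑ κ ∈ Box n A B, if sumz l = sumz ν + s then (if interQ κ l then
        phiHL t l κ * y (Fin.last m) ^ (sumz l - sumz κ) * HLQ t m ν κ fun i => y i.castSucc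
      else 0) * PP t n l x else 0 := by
      split_ifs
      · rfl
      · simp
    rw [e2]
    apply Finset.sum_congr rfl
    intro κ bκ
    by_cases h0 : HLQ t m ν κ (fun i => y i.castSucc) = 0
    · simp [h0]
    by_cases hi : interQ κ l
    · have a := sumz_mono hi.1
      have b := sumz_mono (HLQ_ne t m ν κ _ h0).1
      by_cases hs' : sumz l = sumz ν + s
      · rw [if_pos hs', if_pos hi, Finset.sum_eq_single ((sumz l - sumz κ).toNat, (sumz κ - sumz ν).toNat)]
        · simp only
          rw [if_pos ⟨hi, by omega, by omega⟩]
          have : y (Fin.last m) ^ (sumz l - sumz κ) = y (Fin.last m) ^ (sumz l - sumz κ).toNat := by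
            rw [← zpow_natCast, Int.toNat_of_nonneg (by omega)]
          rw [this]; ring
        · rintro ⟨k, s'⟩ _ hne
          rw [if_neg]
          rintro ⟨_, h1, h2⟩
          apply hne
          simp only at h1 h2
          ext <;> simp only <;> omega
        · intro hc
          exfalso
          apply hc
          rw [Finset.HasAntidiagonal.mem_antidiagonal]
          simp only
          omega
      · rw [if_neg hs']
        apply Finset.sum_eq_zero
        rintro ⟨k, s'⟩ hks
        rw [Finset.HasAntidiagonal.mem_antidiagonal] at hks
        rw [if_neg]
        rintro ⟨_, h1, h2⟩
        simp only at h1 h2 hks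
        omega
    · rw [if_neg hi, zero_mul, ite_self]
      apply Finset.sum_eq_zero
      intro ks _
      rw [if_neg (fun h => hi h.1)]

theorem homog {L : Type} [Field L] [Infinite L] (t : L) {n : ℕ} (ν μ : Fin n → ℤ) (a : (Fin n → ℤ) → L)
    (hfin : {κ | a κ ≠ 0}.Finite) (hsupp : ∀ κ, a κ ≠ 0 → IsSig κ)
    (hexp : ∀ x : Fin n → L, (∀ i, x i ≠ 0) → PP t n ν x * PP t n μ x = ∑ᶠ κ, a κ * PP t n κ x)
    (κ : Fin n → ℤ) (hκ : a κ ≠ 0) : sumz κ = sumz ν + sumz μ := by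
  have hsum : ∀ x : Fin n → L, (∀ i, x i ≠ 0) → PP t n ν x * PP t n μ x = ∑ κ ∈ hfin.toFinset, a κ * PP t n κ x := by
    intro x hx
    rw [hexp x hx]
    apply finsum_eq_sum_of_support_subset
    intro κ hκ
    rw [Function.mem_support] at hκ
    rw [Finset.mem_coe, Set.Finite.mem_toFinset]
    exact left_ne_zero_of_mul hκ
  have key : ∀ z : L, z ≠ 0 → z ^ sumz κ = z ^ (sumz ν + sumz μ) := by
    intro z hz
    have := linindep t n hfin.toFinset (fun κ h => hsupp κ ((Set.Finite.mem_toFinset _).1 h))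
      (fun κ => a κ * (z ^ sumz κ - z ^ (sumz ν + sumz μ))) (by
        intro x hx
        have e1 := hsum x hx
        have e2 := hsum (fun i => z * x i) (fun i => mul_ne_zero hz (hx i))
        simp only [PP_homog t z hz] at e2
        have e3 : ∑ κ ∈ hfin.toFinset, a κ * (z ^ sumz κ - z ^ (sumz ν + sumz μ)) * PP t n κ x =
          ∑ κ ∈ hfin.toFinset, a κ * (z ^ sumz κ * PP t n κ x) -
            z ^ (sumz ν + sumz μ) * ∑ κ ∈ hfin.toFinset, a κ * PP t n κ x := by
          rw [Finset.mul_sum, ← Finset.sum_sub_distrib]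
          apply Finset.sum_congr rfl
          intro κ _
          ring
        rw [e3, ← e1, ← e2, zpow_add₀ hz]
        ring) κ ((Set.Finite.mem_toFinset _).2 hκ)
    rcases mul_eq_zero.1 this with h | h
    · exact absurd h hκ
    · exact sub_eq_zero.1 h
  by_contra hne
  have := laurent (Finset.univ : Finset Bool) (fun b => if b then (1 : L) else -1)
    (fun b => if b then sumz κ else sumz ν + sumz μ) (by
      intro z hz
      simp [key z hz]) (sumz ν + sumz μ)
  simp [hne] at this

theorem main_inf {L : Type} [Field L] [Infinite L] (t : L) {n m : ℕ} (ν l : Fin n → ℤ) (hν : IsSig ν) (hl : IsSig l)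
    (a : (Fin n → ℤ) → (Fin n → ℤ) → L)
    (hfin : ∀ μ, {κ | a μ κ ≠ 0}.Finite) (hsupp : ∀ μ κ, a μ κ ≠ 0 → IsSig κ)
    (hexp : ∀ μ : Fin n → ℤ, IsSig μ → (∀ i, 0 ≤ μ i) →
      ∀ x : Fin n → L, (∀ i, x i ≠ 0) → PP t n ν x * PP t n μ x = ∑ᶠ κ, a μ κ * PP t n κ x)
    (y : Fin m → L) :
    (∑ᶠ μ : Fin n → ℤ, if IsSig μ ∧ ∀ i, 0 ≤ μ i then a μ l * HLQ t m (fun _ => 0) μ y else 0)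
      = HLQ t m ν l y := by
  have hom : ∀ μ, IsSig μ → (∀ i, 0 ≤ μ i) → ∀ κ, a μ κ ≠ 0 → sumz κ = sumz ν + sumz μ :=
    fun μ h1 h2 κ h => homog t ν μ (a μ) (hfin μ) (hsupp μ) (hexp μ h1 h2) κ h
  have z0 : sumz (fun _ => 0 : Fin n → ℤ) = 0 := by simp [sumz]
  by_cases hneg : sumz l < sumz ν
  · have r0 : HLQ t m ν l y = 0 := by
      by_contra hc
      have := sumz_mono (HLQ_ne t m ν l y hc).1
      omega
    rw [r0]
    apply finsum_eq_zero_of_forall_eq_zero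
    intro μ
    by_cases h : IsSig μ ∧ ∀ i, 0 ≤ μ i
    · rw [if_pos h]
      have : a μ l = 0 := by
        by_contra hc
        have h1 := hom μ h.1 h.2 l hc
        have h2 := sumz_mono (ν := fun _ => 0) h.2
        omega
      rw [this, zero_mul]
    · rw [if_neg h]
  · obtain ⟨s, hs⟩ : ∃ s : ℕ, sumz l = sumz ν + s := ⟨(sumz l - sumz ν).toNat, by omega⟩
    obtain ⟨C, hC0, hC⟩ := exists_box {ν, l}
    have bν0 := hC ν (by simp)
    have bl0 := hC l (by simp)
    rw [mem_Box] at bν0 bl0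
    have bν : ν ∈ Box n (-C) (C + s) := by
      rw [mem_Box]; intro i; have := bν0 i; omega
    have bl : l ∈ Box n (-C) (C + s) := by
      rw [mem_Box]; intro i; have := bl0 i; omega
    set M := (Box n 0 s).filter (fun μ => IsSig μ ∧ sumz μ = s) with hM
    have memM : ∀ μ ∈ M, IsSig μ ∧ ∀ i, 0 ≤ μ i := by
      intro μ hμ
      rw [hM, Finset.mem_filter, mem_Box] at hμ
      exact ⟨hμ.2.1, fun i => (hμ.1 i).1⟩
    obtain ⟨G, hG⟩ := qchain t n m y
    have hG0 : ∀ x : Fin n → L, (∀ i, x i ≠ 0) → G s x = ∑ μ ∈ M, HLQ t m (fun _ => 0) μ y * PP t n μ x := by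
      intro x hx
      have := hG s x hx (fun _ => 0) 0 s (fun _ _ _ => le_rfl) (by rw [mem_Box]; intro i; simp) (by simp)
      rw [PP_zero, one_mul] at this
      rw [this, hM, Finset.sum_filter]
      apply Finset.sum_congr rfl
      intro μ _
      rw [z0, zero_add]
      by_cases h0 : HLQ t m (fun _ => 0) μ y = 0
      · simp [h0]
      have : IsSig μ := (HLQ_ne t m _ μ y h0).2 (fun _ _ _ => le_rfl)
      simp [this]
    have eL : (∑ᶠ μ : Fin n → ℤ, if IsSig μ ∧ ∀ i, 0 ≤ μ i then a μ l * HLQ t m (fun _ => 0) μ y else 0)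
        = ∑ μ ∈ M, HLQ t m (fun _ => 0) μ y * a μ l := by
      have : ∑ μ ∈ M, HLQ t m (fun _ => 0) μ y * a μ l =
          ∑ μ ∈ M, if IsSig μ ∧ ∀ i, 0 ≤ μ i then a μ l * HLQ t m (fun _ => 0) μ y else 0 := by
        apply Finset.sum_congr rfl
        intro μ hμ
        rw [if_pos (memM μ hμ), mul_comm]
      rw [this]
      apply finsum_eq_sum_of_support_subset
      intro μ hμ
      rw [Function.mem_support] at hμ
      have h : IsSig μ ∧ ∀ i, 0 ≤ μ i := by
        by_contra hc
        exact hμ (if_neg hc)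
      rw [if_pos h] at hμ
      have h1 := hom μ h.1 h.2 l (left_ne_zero_of_mul hμ)
      rw [Finset.mem_coe, hM, Finset.mem_filter, mem_Box]
      refine ⟨fun i => ⟨h.2 i, ?_⟩, h.1, by omega⟩
      have := sumz_le (ν := fun _ => 0) h.2 i
      omega
    set S := ((Box n (-C) (C + s)) ∪ M.biUnion (fun μ => (hfin μ).toFinset)).filter IsSig with hS
    have D := linindep t n S (fun κ h => (Finset.mem_filter.1 h).2)
      (fun κ => ∑ μ ∈ M, HLQ t m (fun _ => 0) μ y * a μ κ -
        if κ ∈ Box n (-C) (C + s) ∧ sumz κ = sumz ν + s then HLQ t m ν κ y else 0) (by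
        intro x hx
        have e1 : ∑ κ ∈ S, (∑ μ ∈ M, HLQ t m (fun _ => 0) μ y * a μ κ) * PP t n κ x = PP t n ν x * G s x := by
          simp only [Finset.sum_mul]
          rw [Finset.sum_comm, hG0 x hx, Finset.mul_sum]
          apply Finset.sum_congr rfl
          intro μ hμ
          have := hexp μ (memM μ hμ).1 (memM μ hμ).2 x hx
          rw [finsum_eq_sum_of_support_subset (s := S)] at this
          · rw [mul_left_comm, this, Finset.mul_sum]
            apply Finset.sum_congr rfl
            intro κ _
            ring
          · intro κ hκ
            rw [Function.mem_support] at hκ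
            have hκ' := left_ne_zero_of_mul hκ
            rw [Finset.mem_coe, hS, Finset.mem_filter]
            refine ⟨Finset.mem_union_right _ (Finset.mem_biUnion.2 ⟨μ, hμ, ?_⟩), hsupp μ κ hκ'⟩
            rw [Set.Finite.mem_toFinset]
            exact hκ'
        have e2 : ∑ κ ∈ S, (if κ ∈ Box n (-C) (C + s) ∧ sumz κ = sumz ν + s then HLQ t m ν κ y else 0) * PP t n κ x
            = PP t n ν x * G s x := by
          rw [hG s x hx ν (-C) (C + s) hν bν (fun i => by have := bν0 i; omega)]
          trans ∑ᶠ κ, (if κ ∈ Box n (-C) (C + s) ∧ sumz κ = sumz ν + s then HLQ t m ν κ y else 0) * PP t n κ x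
          · symm
            apply finsum_eq_sum_of_support_subset
            intro κ hκ
            rw [Function.mem_support] at hκ
            have hκ' := left_ne_zero_of_mul hκ
            have h1 : κ ∈ Box n (-C) (C + s) ∧ sumz κ = sumz ν + s := by
              by_contra hc
              exact hκ' (if_neg hc)
            rw [if_pos h1] at hκ'
            rw [Finset.mem_coe, hS, Finset.mem_filter]
            exact ⟨Finset.mem_union_left _ h1.1, (HLQ_ne t m ν κ y hκ').2 hν⟩
          · rw [finsum_eq_sum_of_support_subset (s := Box n (-C) (C + s))]
            · apply Finset.sum_congr rfl
              intro κ hκ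
              by_cases h : sumz κ = sumz ν + s
              · rw [if_pos h, if_pos ⟨hκ, h⟩]
              · rw [if_neg h, if_neg (fun h' => h h'.2), zero_mul]
            · intro κ hκ
              rw [Function.mem_support] at hκ
              have hκ' := left_ne_zero_of_mul hκ
              by_contra hc
              exact hκ' (if_neg (fun h => hc h.1))
        simp only [sub_mul, Finset.sum_sub_distrib]
        rw [e1, e2, sub_self]) l (by
          rw [hS, Finset.mem_filter]
          exact ⟨Finset.mem_union_left _ bl, hl⟩)
    rw [if_pos ⟨bl, hs⟩] at D
    rw [eL]
    exact sub_eq_zero.1 D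

theorem phiHL_map {K L : Type} [Field K] [Field L] (f : K →+* L) (t : K) {p : ℕ} (l ν : Fin p → ℤ) :
    f (phiHL t l ν) = phiHL (f t) l ν := by
  rw [phiHL, phiHL]
  have := MonoidHom.map_finprod_of_injective (f : K →* L) f.injective
    (fun c : ℤ => if mcount l c = mcount ν c + 1 then 1 - t ^ mcount l c else 1)
  refine this.trans ?_
  apply finprod_congr
  intro c
  split_ifs <;> simp

theorem HLQ_map {K L : Type} [Field K] [Field L] (f : K →+* L) (t : K) {n : ℕ} (k : ℕ) (ν l : Fin n → ℤ) (x : Fin k → K) :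
    f (HLQ t k ν l x) = HLQ (f t) k ν l (fun i => f (x i)) := by
  induction k generalizing l with
  | zero =>
    simp only [HLQ]
    split_ifs <;> simp
  | succ k ih =>
    simp only [HLQ]
    have := AddMonoidHom.map_finsum_of_injective (f : K →+ L) f.injective
      (fun κ : Fin n → ℤ => if interQ κ l then
        phiHL t l κ * x (Fin.last k) ^ (sumz l - sumz κ) * HLQ t k ν κ fun i => x i.castSucc
      else 0)
    refine this.trans ?_
    apply finsum_congr
    intro κ
    split_ifs
    · simp [phiHL_map, ih]
    · simp

theorem descent (n : ℕ) (ν l : Fin n → ℤ) (hν : IsSig ν) (hl : IsSig l)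
    (c : (Fin n → ℤ) → (Fin n → ℤ) → Polynomial ℤ)
    (hfin : ∀ μ, {κ : Fin n → ℤ | c μ κ ≠ 0}.Finite)
    (hsupp : ∀ μ κ, c μ κ ≠ 0 → IsSig κ)
    (hexp : ∀ μ : Fin n → ℤ, IsSig μ → (∀ i, 0 ≤ μ i) →
      ∀ (K : Type) [Field K] (t : K) (x : Fin n → K), (∀ i, x i ≠ 0) →
        HLPfull t ν x * HLPfull t μ x
          = ∑ᶠ κ : Fin n → ℤ, Polynomial.aeval t (c μ κ) * HLPfull t κ x)
    (m : ℕ) (K : Type) [Field K] (t : K) (x : Fin m → K)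
    (L : Type) [Field L] [Infinite L] (f : K →+* L) :
    (∑ᶠ μ : Fin n → ℤ,
        if IsSig μ ∧ ∀ i, 0 ≤ μ i then
          Polynomial.aeval t (c μ l) * HLQ t m (fun _ => 0) μ x
        else 0)
      = HLQ t m ν l x := by
  have hc : ∀ μ κ, f (Polynomial.aeval t (c μ κ)) = Polynomial.aeval (f t) (c μ κ) := by
    intro μ κ
    exact (Polynomial.aeval_algHom_apply f.toIntAlgHom t (c μ κ)).symm
  have hne : ∀ μ κ, Polynomial.aeval (f t) (c μ κ) ≠ 0 → c μ κ ≠ 0 := by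
    intro μ κ h h0
    apply h
    rw [h0]
    simp
  have main := main_inf (f t) ν l hν hl (fun μ κ => Polynomial.aeval (f t) (c μ κ))
    (fun μ => (hfin μ).subset (fun κ h => hne μ κ h)) (fun μ κ h => hsupp μ κ (hne μ κ h))
    (by
      intro μ h1 h2 x hx
      have := hexp μ h1 h2 (L) (f t) x hx
      simpa only [HLPfull_PP] using this) (fun i => f (x i))
  apply f.injective
  rw [HLQ_map]
  refine Eq.trans ?_ main
  have := AddMonoidHom.map_finsum_of_injective (f : K →+ L) f.injective
    (fun μ : Fin n → ℤ =>
        if IsSig μ ∧ ∀ i, 0 ≤ μ i then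
          Polynomial.aeval t (c μ l) * HLQ t m (fun _ => 0) μ x
        else 0)
  refine this.trans ?_
  apply finsum_congr
  intro μ
  by_cases h : IsSig μ ∧ ∀ i, 0 ≤ μ i
  · rw [if_pos h, if_pos h, ← hc, ← HLQ_map]
    simp
  · rw [if_neg h, if_neg h]
    simp

/-- if `(c μ κ)_κ` is, for each `μ ∈ Sig_n⁺`, the (unique) finitely supported
family of polynomials in `ℤ[t]` with `P_ν · P_μ = ∑_κ c_{ν,μ}^κ(t) P_κ`, then for every `m ≥ 1`,
`∑_{μ ∈ Sig_n⁺} c_{ν,μ}^λ(t) Q_{μ/0[n]}(x₁,…,x_m;t) = Q_{λ/ν}(x₁,…,x_m;t)`. -/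
theorem stmt13 (n : ℕ) (hn : 1 ≤ n) (ν l : Fin n → ℤ) (hν : IsSig ν) (hl : IsSig l)
    (c : (Fin n → ℤ) → (Fin n → ℤ) → Polynomial ℤ)
    (hfin : ∀ μ, {κ : Fin n → ℤ | c μ κ ≠ 0}.Finite)
    (hsupp : ∀ μ κ, c μ κ ≠ 0 → IsSig κ)
    (hexp : ∀ μ : Fin n → ℤ, IsSig μ → (∀ i, 0 ≤ μ i) →
      ∀ (K : Type) [Field K] (t : K) (x : Fin n → K), (∀ i, x i ≠ 0) →
        HLPfull t ν x * HLPfull t μ x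
          = ∑ᶠ κ : Fin n → ℤ, Polynomial.aeval t (c μ κ) * HLPfull t κ x)
    (m : ℕ) (hm : 1 ≤ m) (K : Type) [Field K] (t : K) (x : Fin m → K) (hx : ∀ i, x i ≠ 0) :
    (∑ᶠ μ : Fin n → ℤ,
        if IsSig μ ∧ ∀ i, 0 ≤ μ i then
          Polynomial.aeval t (c μ l) * HLQ t m (fun _ => 0) μ x
        else 0)
      = HLQ t m ν l x := by
  have hinf : Infinite (RatFunc K) :=
    Infinite.of_injective _ (IsFractionRing.injective (Polynomial K) (RatFunc K))
  exact descent n ν l hν hl c hfin hsupp hexp m K t x (RatFunc K) (algebraMap K (RatFunc K))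

end
end
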